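/- Let 0 < ν ≤ 1/2 and let K be a compact subset of ℂ∖[−1,1]. Then there exist C > 0 and n₀ such that for all n ≥ n₀: Δ_n ≠ 0, and for all z ∈ K, |(inπ)^{−n} P_n(inπz) · e^{−n g(z)} · F(z)^{−1} − 1| ≤ C ε_n, where F(z) = (z(z+(z²−1)^{1/2})/(2(z²−1)))^{1/4} · exp(−(ν/4)·Log(((z²−1)^{1/2}−i)/((z²−1)^{1/2}+i))), the fourth root being the branch analytic on ℂ∖[−1,1] that tends to 1 as z → ∞ and Log the principal logarithm. -/

import Mathlib

open MeasureTheory Filter Real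

/-- The limiting moments `m_j = 2^j Γ((1+ν+j)/2)/Γ((1+ν−j)/2)` of the Bessel weight `J_ν`. -/
noncomputable def besselMoment (ν : ℝ) (j : ℕ) : ℝ :=
  2 ^ j * Real.Gamma ((1 + ν + j) / 2) / Real.Gamma ((1 + ν - j) / 2)

/-- The Hankel determinant `Δ_n = det [m_{i+j}]_{i,j=0}^{n-1}`. -/
noncomputable def hankelDet (ν : ℝ) (n : ℕ) : ℝ :=
  Matrix.det (Matrix.of fun i j : Fin n => besselMoment ν (i + j))

/-- `P` is the monic polynomial of degree `n` orthogonal with respect to the Bessel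
weight `J_ν` in the regularized sense of Asheim–Huybrechs. -/
def IsBesselOP (ν : ℝ) (n : ℕ) (P : Polynomial ℂ) : Prop :=
  P.Monic ∧ P.natDegree = n ∧
    ∀ j < n, ∑ k ∈ Finset.range (n + 1), P.coeff k * (besselMoment ν (j + k) : ℂ) = 0

/-- The equilibrium density `ψ(x) = (1/π) log((1+√(1-x²))/|x|)`. -/
noncomputable def psiDens (x : ℝ) : ℝ :=
  (1 / π) * Real.log ((1 + Real.sqrt (1 - x ^ 2)) / |x|)

/-- `(z²-1)^{1/2} = z √(1 - z⁻²)`, the branch analytic on `ℂ∖[-1,1]` which is positive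
for real `z > 1`. -/
noncomputable def sqBranch (z : ℂ) : ℂ := z * (1 - z⁻¹ ^ 2) ^ ((1 : ℂ) / 2)

/-- The `g`-function `g(z) = ∫_{-1}^1 log(z-x) ψ(x) dx` (principal logarithm). -/
noncomputable def gFun (z : ℂ) : ℂ :=
  ∫ x in (-1 : ℝ)..1, Complex.log (z - x) * (psiDens x : ℂ)

/-- `ε_n = n^{ν-1/2}/(log n)^{ν+1/2}`. -/
noncomputable def epsSeq (ν : ℝ) (n : ℕ) : ℝ :=
  (n : ℝ) ^ (ν - 1 / 2) / Real.log n ^ (ν + 1 / 2)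

/-- The leading factor in the outer asymptotics,
`F(z) = (z(z+(z²-1)^{1/2})/(2(z²-1)))^{1/4} exp(-(ν/4) Log(((z²-1)^{1/2}-i)/((z²-1)^{1/2}+i)))`. -/
noncomputable def outerFactor (ν : ℝ) (z : ℂ) : ℂ :=
  (z * (z + sqBranch z) / (2 * (z ^ 2 - 1))) ^ ((1 : ℂ) / 4) *
    Complex.exp (-(ν / 4 : ℂ) *
      Complex.log ((sqBranch z - Complex.I) / (sqBranch z + Complex.I)))

namespace BOP

/-- recurrence coefficients of the monic Meixner-Pollaczek polynomials (λ = 1/4) -/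
noncomputable def bc (k : ℕ) : ℝ := k * (2 * k - 1) / 8

lemma bc_zero : bc 0 = 0 := by simp [bc]

lemma bc_succ_pos (k : ℕ) : 0 < bc (k + 1) := by
  unfold bc; push_cast
  have : (0 : ℝ) ≤ k := Nat.cast_nonneg k
  have h : (0:ℝ) < 2 * (k + 1) - 1 := by linarith
  positivity

lemma bc_nonneg (k : ℕ) : 0 ≤ bc k := by
  cases k with
  | zero => simp [bc]
  | succ k => exact (bc_succ_pos k).le

/-- values of monic MP polynomials -/
noncomputable def mpe (x : ℂ) : ℕ → ℂ
  | 0 => 1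
  | 1 => x
  | (k + 2) => x * mpe x (k + 1) - (bc (k + 1) : ℂ) * mpe x k

/-- shifted monic MP polynomials -/
noncomputable def mp (s : ℂ) : ℕ → Polynomial ℂ
  | 0 => 1
  | 1 => Polynomial.X + Polynomial.C s
  | (k + 2) => (Polynomial.X + Polynomial.C s) * mp s (k + 1)
      - Polynomial.C (bc (k + 1) : ℂ) * mp s k

lemma mp_eval (s z : ℂ) : ∀ k, (mp s k).eval z = mpe (z + s) k
  | 0 => by simp [mp, mpe]
  | 1 => by simp [mp, mpe]
  | (k + 2) => by simp [mp, mpe, mp_eval s z k, mp_eval s z (k + 1)]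

lemma mp_monic_deg (s : ℂ) : ∀ k, (mp s k).Monic ∧ (mp s k).natDegree = k
  | 0 => by simp [mp]
  | 1 => by
    refine ⟨Polynomial.monic_X_add_C s, Polynomial.natDegree_X_add_C s⟩
  | (k + 2) => by
    obtain ⟨h1, d1⟩ := mp_monic_deg s k
    obtain ⟨h2, d2⟩ := mp_monic_deg s (k + 1)
    have hm : ((Polynomial.X + Polynomial.C s) * mp s (k + 1)).Monic :=
      (Polynomial.monic_X_add_C s).mul h2
    have hd : ((Polynomial.X + Polynomial.C s) * mp s (k + 1)).natDegree = k + 2 := by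
      rw [(Polynomial.monic_X_add_C s).natDegree_mul h2, Polynomial.natDegree_X_add_C, d2]
      omega
    have hlt : (Polynomial.C (bc (k + 1) : ℂ) * mp s k).degree
        < ((Polynomial.X + Polynomial.C s) * mp s (k + 1)).degree := by
      calc _ ≤ ((k : ℕ) : WithBot ℕ) := Polynomial.degree_le_of_natDegree_le
            ((Polynomial.natDegree_C_mul_le _ _).trans d1.le)
        _ < ((k + 2 : ℕ) : WithBot ℕ) := by exact_mod_cast (by omega : k < k + 2)
        _ = _ := by rw [Polynomial.degree_eq_natDegree hm.ne_zero, hd]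
    refine ⟨?_, ?_⟩
    · show (_ - _ : Polynomial ℂ).Monic
      exact hm.sub_of_left hlt
    · show (_ - _ : Polynomial ℂ).natDegree = _
      rw [Polynomial.natDegree_sub_eq_left_of_natDegree_lt, hd]
      have := Polynomial.natDegree_lt_natDegree_iff (p := (Polynomial.C (bc (k + 1) : ℂ) * mp s k)) (q := ((Polynomial.X + Polynomial.C s) * mp s (k + 1)))
      rw [hd]
      calc _ ≤ (mp s k).natDegree := Polynomial.natDegree_C_mul_le _ _
        _ < _ := by omega

lemma X_mul_mp (s : ℂ) (k : ℕ) : Polynomial.X * mp s (k + 1) =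
    mp s (k + 2) - Polynomial.C s * mp s (k + 1) + Polynomial.C (bc (k + 1) : ℂ) * mp s k := by
  simp only [mp]; ring

/-- norms -/
noncomputable def hn (k : ℕ) : ℝ := ∏ i ∈ Finset.range k, bc (i + 1)

lemma hn_zero : hn 0 = 1 := by simp [hn]
lemma hn_succ (k : ℕ) : hn (k + 1) = hn k * bc (k + 1) := by simp [hn, Finset.prod_range_succ]
lemma hn_pos (k : ℕ) : 0 < hn k := Finset.prod_pos fun i _ => bc_succ_pos i

section orth
variable (s : ℂ) (L : Polynomial ℂ →ₗ[ℂ] ℂ)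

lemma L_X_pow_mul (hL : ∀ k, L (mp s (k + 1)) = 0) :
    ∀ j k, j < k → L (Polynomial.X ^ j * mp s k) = 0 := by
  intro j
  induction j with
  | zero =>
    intro k hk
    obtain ⟨m, rfl⟩ := Nat.exists_eq_succ_of_ne_zero (by omega : k ≠ 0)
    simpa using hL m
  | succ j ih =>
    intro k hk
    obtain ⟨m, rfl⟩ := Nat.exists_eq_succ_of_ne_zero (by omega : k ≠ 0)
    have e : Polynomial.X ^ (j + 1) * mp s (m + 1) =
        Polynomial.X ^ j * mp s (m + 2) - s • (Polynomial.X ^ j * mp s (m + 1))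
          + (bc (m + 1) : ℂ) • (Polynomial.X ^ j * mp s m) := by
      rw [pow_succ, mul_assoc, X_mul_mp, Polynomial.smul_eq_C_mul, Polynomial.smul_eq_C_mul]; ring
    show L (Polynomial.X ^ (j + 1) * mp s (m + 1)) = 0
    rw [e, map_add, map_sub, map_smul, map_smul, ih _ (by omega), ih _ (by omega), ih _ (by omega)]
    simp

lemma L_X_pow_mul_self (hL : ∀ k, L (mp s (k + 1)) = 0) (k : ℕ) :
    L (Polynomial.X ^ k * mp s k) = L 1 * (hn k : ℂ) := by
  induction k with
  | zero => simp [mp, hn]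
  | succ j ih =>
    have e : Polynomial.X ^ (j + 1) * mp s (j + 1) =
        Polynomial.X ^ j * mp s (j + 2) - s • (Polynomial.X ^ j * mp s (j + 1))
          + (bc (j + 1) : ℂ) • (Polynomial.X ^ j * mp s j) := by
      rw [pow_succ, mul_assoc, X_mul_mp, Polynomial.smul_eq_C_mul, Polynomial.smul_eq_C_mul]; ring
    rw [e, map_add, map_sub, map_smul, map_smul, ih, L_X_pow_mul s L hL _ _ (by omega),
      L_X_pow_mul s L hL _ _ (by omega), hn_succ]
    push_cast; simp; ring

lemma L_mul_mp (hL : ∀ k, L (mp s (k + 1)) = 0) (q : Polynomial ℂ) (k : ℕ) (hq : q.degree < k) :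
    L (q * mp s k) = 0 := by
  by_cases h0 : q = 0
  · simp [h0]
  have hq' : q.natDegree < k := (Polynomial.natDegree_lt_iff_degree_lt h0).2 hq
  rw [Polynomial.as_sum_range_C_mul_X_pow' q hq', Finset.sum_mul, map_sum]
  refine Finset.sum_eq_zero fun i hi => ?_
  rw [mul_assoc, ← Polynomial.smul_eq_C_mul, map_smul, L_X_pow_mul s L hL i k (Finset.mem_range.1 hi),
    smul_zero]

lemma L_mp_mul_self (hL : ∀ k, L (mp s (k + 1)) = 0) (k : ℕ) :
    L (mp s k * mp s k) = L 1 * (hn k : ℂ) := by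
  have h1 : (mp s k - Polynomial.X ^ k).degree < ((k : ℕ) : WithBot ℕ) := by
    obtain ⟨hm, hd⟩ := mp_monic_deg s k
    have e : (mp s k).degree = k := by rw [Polynomial.degree_eq_natDegree hm.ne_zero, hd]
    rw [← e]
    refine Polynomial.degree_sub_lt_left ?_ hm.ne_zero ?_
    · rw [e, Polynomial.degree_X_pow]
    · rw [hm.leadingCoeff]; simp
  have e : mp s k * mp s k = (mp s k - Polynomial.X ^ k) * mp s k + Polynomial.X ^ k * mp s k := by ring
  rw [e, map_add, L_mul_mp s L hL _ k h1, L_X_pow_mul_self s L hL, zero_add]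

end orth

/-- every polynomial of degree `< n` is a combination of the first `n` polynomials -/
lemma exists_expansion (s : ℂ) (n : ℕ) : ∀ q : Polynomial ℂ, q.degree < (n : ℕ) →
    ∃ c : ℕ → ℂ, q = ∑ k ∈ Finset.range n, c k • mp s k := by
  induction n with
  | zero =>
    intro q hq
    refine ⟨0, ?_⟩
    have : q = 0 := by
      by_contra h
      rw [Polynomial.degree_eq_natDegree h] at hq
      exact absurd hq (by simp)
    simp [this]
  | succ n ih =>
    intro q hq
    obtain ⟨hm, hd⟩ := mp_monic_deg s n
    have h1 : (q - q.coeff n • mp s n).degree < (n : ℕ) := by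
      rw [Polynomial.degree_lt_iff_coeff_zero]
      intro m hmn
      rcases hmn.eq_or_lt with rfl | h
      · have : (mp s n).coeff n = 1 := by
          have := hm.coeff_natDegree
          rwa [hd] at this
        simp [this]
      · have a : q.coeff m = 0 := (Polynomial.degree_lt_iff_coeff_zero q (n+1)).1 hq m (by omega)
        have b : (mp s n).coeff m = 0 := Polynomial.coeff_eq_zero_of_natDegree_lt (by omega)
        simp [a, b]
    obtain ⟨c, hc⟩ := ih _ h1
    refine ⟨fun k => if k < n then c k else q.coeff n, ?_⟩
    rw [Finset.sum_range_succ]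
    have : ∑ k ∈ Finset.range n, (if k < n then c k else q.coeff n) • mp s k
        = ∑ k ∈ Finset.range n, c k • mp s k :=
      Finset.sum_congr rfl fun k hk => by rw [if_pos (Finset.mem_range.1 hk)]
    rw [this, ← hc]
    simp

end BOP

namespace BOP

lemma rpow_amgm {a b v p : ℝ} (ha : 0 < a) (hb : 0 < b) (hv : 0 < v) (hab : a * b ≤ v ^ 2)
    (hp : p ≤ 0) : 2 * v ^ p ≤ a ^ p + b ^ p := by
  have h1 : 2 * (a ^ (p/2) * b ^ (p/2)) ≤ a ^ p + b ^ p := by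
    have e1 : a ^ p = a ^ (p/2) * a ^ (p/2) := by rw [← rpow_add ha]; ring_nf
    have e2 : b ^ p = b ^ (p/2) * b ^ (p/2) := by rw [← rpow_add hb]; ring_nf
    rw [e1, e2]; nlinarith [sq_nonneg (a ^ (p/2) - b ^ (p/2))]
  have h2 : v ^ p ≤ a ^ (p/2) * b ^ (p/2) := by
    rw [← mul_rpow ha.le hb.le]
    have : v ^ p = (v ^ 2) ^ (p / 2) := by
      rw [← rpow_natCast, ← rpow_mul hv.le]; congr 1; push_cast; ring
    rw [this]
    exact rpow_le_rpow_of_nonpos (by positivity) hab (by linarith)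
  linarith

/-- symmetric difference inequality -/
lemma rpow_symm_diff {v γ : ℝ} (hv : 1 < v) (h0 : 0 < γ) (h1 : γ ≤ 1) :
    2 * γ * v ^ (γ - 1) ≤ (v + 1) ^ γ - (v - 1) ^ γ := by
  have hd : ∀ s ∈ Set.Icc (0:ℝ) 1, HasDerivAt (fun s => (v + s) ^ γ - (v - s) ^ γ - 2 * γ * v ^ (γ - 1) * s)
      (γ * (v + s) ^ (γ - 1) + γ * (v - s) ^ (γ - 1) - 2 * γ * v ^ (γ - 1)) s := by
    intro s hs
    have a := ((hasDerivAt_id s).const_add v).rpow_const (p := γ) (Or.inl (by have := hs.1; simp; linarith))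
    have b := ((hasDerivAt_id s).const_sub v).rpow_const (p := γ) (Or.inl (by have := hs.2; simp; linarith))
    have c := (hasDerivAt_id s).const_mul (2 * γ * v ^ (γ - 1))
    exact ((a.sub b).sub c).congr_deriv (by simp only [id]; ring)
  have hm : MonotoneOn (fun s => (v + s) ^ γ - (v - s) ^ γ - 2 * γ * v ^ (γ - 1) * s) (Set.Icc 0 1) := by
    refine monotoneOn_of_deriv_nonneg (convex_Icc 0 1) ?_ ?_ ?_
    · exact fun s hs => (hd s hs).continuousAt.continuousWithinAt
    · exact fun s hs => (hd s (interior_subset hs)).differentiableAt.differentiableWithinAt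
    · intro s hs
      have hs' := interior_subset hs
      rw [(hd s hs').deriv]
      have := rpow_amgm (a := v + s) (b := v - s) (v := v) (p := γ - 1) (by linarith [hs'.1])
        (by linarith [hs'.2]) (by linarith) (by nlinarith [sq_nonneg s]) (by linarith)
      nlinarith
  have := hm (Set.left_mem_Icc.2 zero_le_one) (Set.right_mem_Icc.2 zero_le_one) zero_le_one
  simp at this
  linarith

/-- majorant values -/
noncomputable def tau (c : ℝ) : ℕ → ℝ
  | 0 => 1
  | 1 => c
  | (k + 2) => c * tau c (k + 1) + bc (k + 1) * tau c k

/-- normalisation factor -/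
noncomputable def nf (k : ℕ) : ℝ := 2 ^ k / (k.factorial : ℝ)

lemma nf_pos (k : ℕ) : 0 < nf k := by unfold nf; positivity
lemma nf_zero : nf 0 = 1 := by simp [nf]
lemma nf_succ (k : ℕ) : nf (k + 1) * (k + 1) = 2 * nf k := by
  unfold nf; rw [Nat.factorial_succ]; push_cast; field_simp; ring

lemma nf_succ' (k : ℕ) : nf (k + 1) = 2 * nf k / (k + 1) := by
  rw [← nf_succ]; field_simp

lemma tau_nonneg {c : ℝ} (hc : 0 ≤ c) : ∀ k, 0 ≤ tau c k
  | 0 => by simp [tau]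
  | 1 => by simpa [tau]
  | (k + 2) => by
    have := tau_nonneg hc k
    have := tau_nonneg hc (k + 1)
    have := bc_nonneg (k + 1)
    simp only [tau]; positivity

noncomputable def rr (k : ℕ) : ℝ := nf k ^ 2 * hn k

lemma rr_pos (k : ℕ) : 0 < rr k := mul_pos (pow_pos (nf_pos k) 2) (hn_pos k)

lemma rr_succ (k : ℕ) : rr (k + 1) = rr k * ((2 * k + 1) / (2 * k + 2)) := by
  unfold rr; rw [nf_succ', hn_succ, bc]; push_cast; field_simp; ring

lemma rr_lower (k : ℕ) : 1 / (4 * k + 1) ≤ rr k ^ 2 := by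
  induction k with
  | zero => simp [rr, nf, hn]
  | succ k ih =>
    rw [rr_succ, mul_pow]
    calc _ ≤ 1 / (4 * (k:ℝ) + 1) * ((2 * k + 1) / (2 * k + 2)) ^ 2 := by
          rw [div_pow, div_mul_div_comm, div_le_div_iff₀ (by positivity) (by positivity)]
          push_cast
          have : (0:ℝ) ≤ k := Nat.cast_nonneg k
          nlinarith
      _ ≤ _ := by gcongr

lemma rr_upper (k : ℕ) : rr k ^ 2 ≤ 1 / (2 * k + 1) := by
  induction k with
  | zero => simp [rr, nf, hn]
  | succ k ih =>
    rw [rr_succ, mul_pow]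
    calc _ ≤ 1 / (2 * (k:ℝ) + 1) * ((2 * k + 1) / (2 * k + 2)) ^ 2 := by gcongr
      _ ≤ _ := by
          rw [div_pow, div_mul_div_comm, div_le_div_iff₀ (by positivity) (by positivity)]
          push_cast
          have : (0:ℝ) ≤ k := Nat.cast_nonneg k
          nlinarith

lemma tau_bound {c : ℝ} (hc : 0 ≤ c) (hc' : c ≤ 1 / 2) : ∀ k : ℕ,
    nf k * tau c k ≤ 2 * ((k:ℝ) + 1 / 2) ^ (c - 3 / 4)
  | 0 => by
    simp only [nf_zero, tau]
    have : (1:ℝ) ≤ (((0:ℕ):ℝ) + 1/2) ^ (c - 3/4) := by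
      apply Real.one_le_rpow_of_pos_of_le_one_of_nonpos <;> norm_num; linarith
    linarith
  | 1 => by
    simp only [tau]
    have h1 : nf 1 = 2 := by simp [nf]
    have : (1/2:ℝ) ≤ (((1:ℕ):ℝ) + 1/2) ^ (c - 3/4) := by
      calc (1/2:ℝ) ≤ (3/2:ℝ) ^ (-1:ℝ) := by rw [rpow_neg_one]; norm_num
        _ ≤ (3/2:ℝ) ^ (c - 3/4) := rpow_le_rpow_of_exponent_le (by norm_num) (by linarith)
        _ = _ := by norm_num
    rw [h1]; linarith
  | (k + 2) => by
    have i1 := tau_bound hc hc' k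
    have i2 := tau_bound hc hc' (k + 1)
    have hk : (0:ℝ) ≤ k := Nat.cast_nonneg k
    have e : ((k:ℝ) + 2) * (nf (k + 2) * tau c (k + 2)) =
        2 * c * (nf (k + 1) * tau c (k + 1)) + (k + 1/2) * (nf k * tau c k) := by
      have n2 := nf_succ (k + 1)
      have n1 := nf_succ k
      push_cast at n2
      simp only [tau, bc]; push_cast
      have n2' : nf (k + 2) * ((k:ℝ) + 2) = 2 * nf (k + 1) := by rw [← n2]; ring
      calc _ = (nf (k + 2) * ((k:ℝ) + 2)) * (c * tau c (k + 1) + (k + 1) * (2 * (k + 1) - 1) / 8 * tau c k) := by ring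
        _ = 2 * c * (nf (k + 1) * tau c (k + 1)) + (nf (k + 1) * (k + 1)) * (2 * (k + 1) - 1) / 4 * tau c k := by
            rw [n2']; ring
        _ = _ := by rw [n1]; ring
    set v : ℝ := k + 3 / 2 with hv
    set β := c - 3 / 4 with hβ
    have hs := rpow_symm_diff (v := v) (γ := β + 1) (by rw [hv]; linarith) (by rw [hβ]; linarith) (by rw [hβ]; linarith)
    have hvp : 0 < v := by rw [hv]; linarith
    have hv1 : 0 < v - 1 := by rw [hv]; linarith
    rw [show β + 1 - 1 = β by ring, rpow_add_one (by linarith), rpow_add_one (by linarith)] at hs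
    have hmono : (v + 1) ^ β ≤ v ^ β := rpow_le_rpow_of_nonpos hvp (by linarith) (by rw [hβ]; linarith)
    have key : 2 * c * (2 * v ^ β) + (v - 1) * (2 * (v - 1) ^ β) ≤ (k + 2) * (2 * (v + 1) ^ β) := by
      have : (k:ℝ) + 2 = v + 1/2 := by rw [hv]; ring
      rw [this]
      have hc2 : c = β + 3/4 := by rw [hβ]; ring
      rw [hc2]; nlinarith
    have a1 : ((k:ℝ) + 1/2) = v - 1 := by rw [hv]; ring
    have a2 : (((k + 1 : ℕ):ℝ) + 1/2) = v := by rw [hv]; push_cast; ring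
    have a3 : (((k + 2 : ℕ):ℝ) + 1/2) = v + 1 := by rw [hv]; push_cast; ring
    rw [a1] at i1 e
    rw [a2] at i2
    rw [a3]
    have : ((k:ℝ) + 2) * (nf (k + 2) * tau c (k + 2)) ≤ (k + 2) * (2 * (v + 1) ^ β) := by
      rw [e]
      refine le_trans (add_le_add (mul_le_mul_of_nonneg_left i2 (by linarith)) (mul_le_mul_of_nonneg_left i1 hv1.le)) key
    exact le_of_mul_le_mul_left this (by linarith)

/-- coefficients of the shift expansion -/
noncomputable def kap (α : ℝ) : ℕ → ℝ
  | 0 => 1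
  | 1 => 2 * α
  | (j + 2) => (2 * α * kap α (j + 1) + j * kap α j) / (j + 2)

lemma kap_nonneg {α : ℝ} (hα : 0 ≤ α) : ∀ j, 0 ≤ kap α j
  | 0 => by simp [kap]
  | 1 => by simpa [kap]
  | (j + 2) => by
    have := kap_nonneg hα j
    have := kap_nonneg hα (j + 1)
    simp only [kap]; positivity

lemma kap_bound {α : ℝ} (hα : 0 < α) (hα' : α ≤ 1 / 4) : ∀ j : ℕ,
    kap α (j + 1) ≤ ((j:ℝ) + 1) ^ (α - 1)
  | 0 => by simp [kap]; linarith
  | 1 => by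
    simp [kap]
    have : (1/2:ℝ) ≤ ((1:ℝ) + 1) ^ (α - 1) := by
      calc (1/2:ℝ) = (2:ℝ) ^ (-1:ℝ) := by rw [rpow_neg_one]; norm_num
        _ ≤ (2:ℝ) ^ (α - 1) := rpow_le_rpow_of_exponent_le (by norm_num) (by linarith)
        _ = _ := by norm_num
    nlinarith
  | (j + 2) => by
    have i1 := kap_bound hα hα' j
    have i2 := kap_bound hα hα' (j + 1)
    have hj : (0:ℝ) ≤ j := Nat.cast_nonneg j
    have hs := rpow_symm_diff (v := (j:ℝ) + 2) (γ := α) (by linarith) hα (by linarith)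
    have e1 : ((j:ℝ) + 2 - 1) ^ α = (j + 1) * ((j:ℝ) + 1) ^ (α - 1) := by
      rw [show (j:ℝ) + 2 - 1 = j + 1 by ring]
      rw [mul_comm, ← rpow_add_one (by linarith)]; ring_nf
    have e2 : ((j:ℝ) + 2 + 1) ^ α = (j + 3) * ((j:ℝ) + 3) ^ (α - 1) := by
      rw [show (j:ℝ) + 2 + 1 = j + 3 by ring]
      rw [mul_comm, ← rpow_add_one (by linarith)]; ring_nf
    rw [e1, e2] at hs
    show kap α (j + 1 + 2) ≤ _
    simp only [kap]
    push_cast at i2 ⊢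
    rw [show (j:ℝ) + 1 + 1 = j + 2 by ring] at i2
    rw [div_le_iff₀ (by linarith), show (j:ℝ) + 2 + 1 = j + 3 by ring, show (j:ℝ) + 1 + 2 = j + 3 by ring]
    have : 2 * α * kap α (j + 2) ≤ 2 * α * ((j:ℝ) + 2) ^ (α - 1) := by gcongr
    have : ((j:ℝ) + 1) * kap α (j + 1) ≤ (j + 1) * ((j:ℝ) + 1) ^ (α - 1) := by gcongr
    show 2 * α * kap α (j + 2) + (j + 1) * kap α (j + 1) ≤ _
    linarith


lemma nf_mpe_rec (x : ℂ) (n : ℕ) : ((n:ℂ) + 2) * ((nf (n + 2) : ℂ) * mpe x (n + 2)) =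
    2 * x * ((nf (n + 1) : ℂ) * mpe x (n + 1)) - (n + 1 / 2) * ((nf n : ℂ) * mpe x n) := by
  have n2 : (nf (n + 2) : ℂ) * ((n:ℂ) + 2) = 2 * nf (n + 1) := by
    have := nf_succ (n + 1)
    have h : nf (n + 2) * ((n:ℝ) + 2) = 2 * nf (n + 1) := by rw [← this]; push_cast; ring
    exact_mod_cast h
  have n1 : (nf (n + 1) : ℂ) * ((n:ℂ) + 1) = 2 * nf n := by exact_mod_cast nf_succ n
  simp only [mpe, bc]; push_cast
  calc _ = ((nf (n + 2) : ℂ) * ((n:ℂ) + 2)) * (x * mpe x (n + 1) - (n + 1) * (2 * (n + 1) - 1) / 8 * mpe x n) := by ring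
    _ = 2 * x * ((nf (n + 1) : ℂ) * mpe x (n + 1)) - (nf (n + 1) * ((n:ℂ) + 1)) * (2 * (n + 1) - 1) / 4 * mpe x n := by
        rw [n2]; ring
    _ = _ := by rw [n1]; ring

open PowerSeries in
lemma coeff_ode (F G : PowerSeries ℂ) (a b : ℂ)
    (h : (1 + X ^ 2) * derivative ℂ F = (C a - C b * X) * G) (n : ℕ) :
    coeff (n + 2) F * (n + 2) + coeff n F * n = a * coeff (n + 1) G - b * coeff n G := by
  have := congrArg (coeff (n + 1)) h
  rw [add_mul, one_mul, map_add, sub_mul, map_sub, mul_assoc, coeff_C_mul, coeff_C_mul,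
    coeff_succ_X_mul, pow_two, mul_assoc, coeff_succ_X_mul] at this
  rw [← this, coeff_derivative]
  push_cast
  cases n with
  | zero => simp; left; ring
  | succ n => rw [coeff_succ_X_mul, coeff_derivative]; push_cast; ring

open PowerSeries in
lemma ode_of_coeff (F G : PowerSeries ℂ) (a b : ℂ) (h1 : coeff 1 F = a * coeff 0 G)
    (h : ∀ n : ℕ, coeff (n + 2) F * (n + 2) + coeff n F * n = a * coeff (n + 1) G - b * coeff n G) :
    (1 + X ^ 2) * derivative ℂ F = (C a - C b * X) * G := by
  ext n
  rw [add_mul, one_mul, map_add, sub_mul, map_sub, mul_assoc, coeff_C_mul, coeff_C_mul,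
    pow_two, mul_assoc, coeff_derivative]
  cases n with
  | zero => simp [coeff_zero_eq_constantCoeff] at h1 ⊢; rw [h1]
  | succ n =>
    rw [coeff_succ_X_mul, coeff_succ_X_mul, ← h n]
    cases n with
    | zero => simp; left; ring
    | succ n => rw [coeff_succ_X_mul, coeff_derivative]; push_cast; ring

open PowerSeries in
/-- shift expansion -/
lemma shift_expansion (α : ℝ) (x : ℂ) (n : ℕ) : (nf n : ℂ) * mpe (x + Complex.I * α) n =
    ∑ j ∈ Finset.range (n + 1), Complex.I ^ j * (kap α j : ℂ) * ((nf (n - j) : ℂ) * mpe x (n - j)) := by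
  set A : PowerSeries ℂ := PowerSeries.mk fun n => (nf n : ℂ) * mpe x n with hA
  set K : PowerSeries ℂ := PowerSeries.mk fun j => Complex.I ^ j * (kap α j : ℂ) with hK
  have oA : (1 + X ^ 2) * derivative ℂ A = (C (2 * x) - C (1/2) * X) * A := by
    apply ode_of_coeff
    · simp [hA, nf, mpe]
    · intro n
      have := nf_mpe_rec x n
      simp only [hA, coeff_mk]
      linear_combination this
  have oK : (1 + X ^ 2) * derivative ℂ K = (C (2 * Complex.I * α) - C 0 * X) * K := by
    apply ode_of_coeff
    · simp [hK, kap]; ring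
    · intro n
      simp only [hK, coeff_mk, kap]
      push_cast
      have : (n:ℂ) + 2 ≠ 0 := by exact_mod_cast (by omega : n + 2 ≠ 0)
      field_simp
      have hI : Complex.I ^ (n + 2) = - Complex.I ^ n := by rw [pow_add]; simp
      rw [hI, pow_succ]
      linear_combination (-2 * Complex.I ^ n * α * kap α (n + 1)) * Complex.I_sq
  have oF : (1 + X ^ 2) * derivative ℂ (K * A) = (C (2 * (x + Complex.I * α)) - C (1/2) * X) * (K * A) := by
    rw [Derivation.leibniz]
    simp only [smul_eq_mul]
    calc _ = K * ((1 + X ^ 2) * derivative ℂ A) + A * ((1 + X ^ 2) * derivative ℂ K) := by ring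
      _ = _ := by
        rw [oA, oK, show (2 * (x + Complex.I * α)) = 2 * x + 2 * Complex.I * α by ring, map_add, map_zero]
        ring
  have key : ∀ n, coeff n (K * A) = (nf n : ℂ) * mpe (x + Complex.I * α) n ∧
      coeff (n + 1) (K * A) = (nf (n + 1) : ℂ) * mpe (x + Complex.I * α) (n + 1) := by
    intro n
    induction n with
    | zero =>
      constructor
      · simp [hA, hK, nf, mpe, kap, coeff_mul]
      · simp [hA, hK, nf, mpe, kap, coeff_mul, Finset.Nat.antidiagonal_succ]
        ring
    | succ n ih =>
      refine ⟨ih.2, ?_⟩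
      have h := coeff_ode _ _ _ _ oF n
      have h2 := nf_mpe_rec (x + Complex.I * α) n
      rw [ih.1, ih.2] at h
      have : (n:ℂ) + 2 ≠ 0 := by exact_mod_cast (by omega : n + 2 ≠ 0)
      apply mul_left_cancel₀ this
      show ((n:ℂ) + 2) * coeff (n + 2) (K * A) = _
      linear_combination h - h2
  rw [← (key n).1, coeff_mul, Finset.Nat.sum_antidiagonal_eq_sum_range_succ
    (fun i j => coeff i K * coeff j A)]
  simp [hA, hK]

end BOP

namespace BOP

lemma mpe_conj (x : ℝ) : ∀ k, (starRingEnd ℂ) (mpe x k) = mpe x k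
  | 0 => by simp [mpe]
  | 1 => by simp [mpe]
  | (k + 2) => by simp [mpe, mpe_conj x k, mpe_conj x (k + 1)]

lemma mpe_im (x : ℝ) (k : ℕ) : (mpe x k).im = 0 := Complex.conj_eq_iff_im.1 (mpe_conj x k)

lemma mpe_I (c : ℝ) : ∀ k, mpe (Complex.I * c) k = Complex.I ^ k * (tau c k : ℂ)
  | 0 => by simp [mpe, tau]
  | 1 => by simp [mpe, tau]
  | (k + 2) => by
    simp only [mpe, tau, mpe_I c k, mpe_I c (k + 1)]
    push_cast
    have hI : Complex.I ^ (k + 2) = - Complex.I ^ k := by rw [pow_add]; simp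
    rw [hI, pow_succ]
    linear_combination (Complex.I ^ k * c * tau c (k + 1)) * Complex.I_sq

lemma cd_formula (x y : ℂ) (n : ℕ) :
    (x - y) * ∑ k ∈ Finset.range (n + 1), mpe x k * mpe y k / (hn k : ℂ) =
      (mpe x (n + 1) * mpe y n - mpe x n * mpe y (n + 1)) / (hn n : ℂ) := by
  induction n with
  | zero => simp [mpe, hn]
  | succ n ih =>
    rw [Finset.sum_range_succ, mul_add, ih]
    have h1 : (hn n : ℂ) ≠ 0 := by exact_mod_cast (hn_pos n).ne'
    have h2 : (bc (n + 1) : ℂ) ≠ 0 := by exact_mod_cast (bc_succ_pos n).ne'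
    rw [hn_succ]
    simp only [mpe]
    push_cast
    field_simp
    ring

lemma tau_quarter (k : ℕ) : tau (1 / 4) (k + 1) = tau (1 / 4) k * ((k + 1 / 2) / 2) := by
  induction k with
  | zero => simp [tau]; norm_num
  | succ k ih =>
    show 1 / 4 * tau (1/4) (k + 1) + bc (k + 1) * tau (1/4) k = _
    have e : bc (k + 1) * tau (1/4) k = tau (1/4) (k+1) * ((k + 1) / 2) := by
      rw [ih, bc]; push_cast; ring
    rw [e]; push_cast; ring

lemma tau_quarter_pos (k : ℕ) : 0 < tau (1/4) k := by
  induction k with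
  | zero => simp [tau]
  | succ k ih => rw [tau_quarter]; positivity

lemma tau_quarter_sum (n : ℕ) : ∑ k ∈ Finset.range (n + 1), tau (1/4) k ^ 2 / hn k =
    tau (1/4) (n + 1) ^ 2 / hn n * (8 / (n + 1 / 2)) := by
  induction n with
  | zero => simp [tau, hn]; norm_num
  | succ n ih =>
    rw [Finset.sum_range_succ, ih, tau_quarter (n + 1), hn_succ, bc]
    have := hn_pos n
    have h3 : (0:ℝ) < 2 * n + 1 := by positivity
    push_cast
    have h4 : (2:ℝ) * (n + 1) - 1 = 2 * n + 1 := by ring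
    rw [h4]
    field_simp
    ring

/-- the pointwise Christoffel-Darboux inequality -/
lemma cd_ineq (x : ℝ) (n : ℕ) : ‖mpe x n‖ ^ 2 / (x ^ 2 + 1 / 16) ≤
    hn n ^ 2 / tau (1/4) (n + 1) ^ 2 *
      ‖∑ k ∈ Finset.range (n + 1), (Complex.I ^ k * (tau (1/4) k : ℂ) / (hn k : ℂ)) * mpe x k‖ ^ 2 := by
  have h := cd_formula x (Complex.I * (1/4 : ℝ)) n
  rw [mpe_I, mpe_I] at h
  have e : ∑ k ∈ Finset.range (n + 1), mpe x k * mpe (Complex.I * (1/4:ℝ)) k / (hn k : ℂ) =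
      ∑ k ∈ Finset.range (n + 1), (Complex.I ^ k * (tau (1/4) k : ℂ) / (hn k : ℂ)) * mpe x k :=
    Finset.sum_congr rfl fun k _ => by rw [mpe_I]; ring
  rw [e] at h
  set S := ∑ k ∈ Finset.range (n + 1), (Complex.I ^ k * (tau (1/4) k : ℂ) / (hn k : ℂ)) * mpe x k
  have hn0 := hn_pos n
  have ht := tau_quarter_pos (n + 1)
  have h1 : ‖((x:ℂ) - Complex.I * (1/4:ℝ)) * S‖ ^ 2 = (x ^ 2 + 1/16) * ‖S‖ ^ 2 := by
    rw [norm_mul, mul_pow]; congr 1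
    rw [← Complex.normSq_eq_norm_sq, Complex.normSq_apply]; simp; ring
  obtain ⟨a, ha⟩ : ∃ a : ℝ, mpe x n = a := ⟨(mpe x n).re, by
    apply Complex.ext <;> simp [mpe_im]⟩
  obtain ⟨b, hb⟩ : ∃ b : ℝ, mpe x (n + 1) = b := ⟨(mpe x (n+1)).re, by
    apply Complex.ext <;> simp [mpe_im]⟩
  have h2 : ‖a‖ ^ 2 * tau (1/4) (n + 1) ^ 2 / hn n ^ 2 ≤ (x ^ 2 + 1/16) * ‖S‖ ^ 2 := by
    rw [← h1, h, ha, hb]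
    have : (b * (Complex.I ^ n * (tau (1/4) n : ℂ)) - a * (Complex.I ^ (n + 1) * (tau (1/4) (n + 1) : ℂ)))
      = Complex.I ^ n * (b * tau (1/4) n - a * tau (1/4) (n + 1) * Complex.I) := by rw [pow_succ]; ring
    rw [this, norm_div, norm_mul, norm_pow, Complex.norm_I, one_pow, one_mul, div_pow]
    rw [Complex.norm_real, norm_of_nonneg hn0.le]
    gcongr
    rw [← Complex.normSq_eq_norm_sq, Complex.normSq_apply]
    simp
    nlinarith [sq_nonneg (b * tau (1/4) n)]
  have h3 : ‖mpe x n‖ = ‖a‖ := by rw [ha, Complex.norm_real]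
  rw [h3, div_le_iff₀ (by positivity)]
  rw [div_le_iff₀ (by positivity)] at h2
  rw [div_mul_eq_mul_div, div_mul_eq_mul_div, le_div_iff₀ (by positivity)]
  linarith

section weight
variable (w : ℝ → ℝ)

/-- admissible weights -/
structure Adm : Prop where
  nonneg : ∀ x, 0 ≤ w x
  int : ∀ q : Polynomial ℂ, Integrable (fun x : ℝ => q.eval (x : ℂ) * (w x : ℂ))
  orth : ∀ k, ∫ x : ℝ, (mp 0 (k + 1)).eval (x : ℂ) * (w x : ℂ) = 0

/-- squared norm -/
noncomputable def nsq (q : Polynomial ℂ) : ℝ := ∫ x : ℝ, ‖q.eval (x : ℂ)‖ ^ 2 * w x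

/-- conjugate polynomial -/
noncomputable def pconj (q : Polynomial ℂ) : Polynomial ℂ := q.map (starRingEnd ℂ)

lemma pconj_eval (q : Polynomial ℂ) (x : ℝ) :
    (pconj q).eval (x : ℂ) = (starRingEnd ℂ) (q.eval (x : ℂ)) := by
  unfold pconj
  rw [Polynomial.eval_map, Polynomial.eval₂_eq_sum_range, Polynomial.eval_eq_sum_range, map_sum]
  simp

lemma pconj_degree (q : Polynomial ℂ) : (pconj q).degree = q.degree :=
  Polynomial.degree_map q _

lemma mul_pconj_eval (q : Polynomial ℂ) (x : ℝ) :
    (q * pconj q).eval (x : ℂ) = ((‖q.eval (x : ℂ)‖ ^ 2 : ℝ) : ℂ) := by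
  rw [Polynomial.eval_mul, pconj_eval, Complex.mul_conj, Complex.normSq_eq_norm_sq]

variable {w}

lemma Adm.intsq (hw : Adm w) (q : Polynomial ℂ) : Integrable (fun x : ℝ => ‖q.eval (x : ℂ)‖ ^ 2 * w x) := by
  have := (hw.int (q * pconj q)).re
  refine this.congr (Eventually.of_forall fun x => ?_)
  simp only [mul_pconj_eval]
  norm_cast

/-- functional of weight -/
noncomputable def Adm.L (hw : Adm w) : Polynomial ℂ →ₗ[ℂ] ℂ where
  toFun q := ∫ x : ℝ, q.eval (x : ℂ) * (w x : ℂ)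
  map_add' p q := by
    rw [← integral_add (hw.int p) (hw.int q)]
    congr 1; ext x; simp [add_mul]
  map_smul' c q := by
    simp only [RingHom.id_apply, smul_eq_mul]
    rw [← integral_const_mul]
    congr 1; ext x; simp [mul_assoc]

lemma Adm.L_nsq (hw : Adm w) (q : Polynomial ℂ) : hw.L (q * pconj q) = (nsq w q : ℂ) := by
  show ∫ x : ℝ, (q * pconj q).eval (x : ℂ) * (w x : ℂ) = _
  unfold nsq
  rw [← integral_complex_ofReal]
  congr 1; ext x; rw [mul_pconj_eval]; push_cast; rfl

lemma pconj_mp (k : ℕ) : pconj (mp 0 k) = mp 0 k := by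
  have : ∀ k, pconj (mp 0 k) = mp 0 k ∧ pconj (mp 0 (k + 1)) = mp 0 (k + 1) := by
    intro k
    induction k with
    | zero => constructor <;> simp [pconj, mp]
    | succ k ih =>
      refine ⟨ih.2, ?_⟩
      have h1 := ih.1
      have h2 := ih.2
      unfold pconj at h1 h2 ⊢
      simp only [mp, Polynomial.map_sub, Polynomial.map_mul, Polynomial.map_add, h1, h2]
      simp
  exact (this k).1

lemma Adm.L_mp_mul (hw : Adm w) (j k : ℕ) :
    hw.L (mp 0 j * mp 0 k) = if j = k then hw.L 1 * (hn k : ℂ) else 0 := by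
  have hL : ∀ k, hw.L (mp 0 (k + 1)) = 0 := hw.orth
  have hdeg : ∀ k, (mp 0 k).degree = (k : ℕ) := fun k => by
    rw [Polynomial.degree_eq_natDegree (mp_monic_deg 0 k).1.ne_zero, (mp_monic_deg 0 k).2]
  split_ifs with h
  · subst h; exact L_mp_mul_self 0 hw.L hL j
  · rcases lt_or_gt_of_ne h with h | h
    · exact L_mul_mp 0 hw.L hL _ k (by rw [hdeg]; exact_mod_cast h)
    · rw [mul_comm]; exact L_mul_mp 0 hw.L hL _ j (by rw [hdeg]; exact_mod_cast h)

lemma Adm.L_one (hw : Adm w) : hw.L 1 = ((∫ x, w x : ℝ) : ℂ) := by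
  show ∫ x : ℝ, (1 : Polynomial ℂ).eval (x : ℂ) * (w x : ℂ) = _
  rw [← integral_complex_ofReal]; simp

lemma pconj_sum_smul (n : ℕ) (c : ℕ → ℂ) :
    pconj (∑ k ∈ Finset.range n, c k • mp 0 k) = ∑ k ∈ Finset.range n, (starRingEnd ℂ) (c k) • mp 0 k := by
  have : ∀ k, (mp 0 k).map (starRingEnd ℂ) = mp 0 k := pconj_mp
  unfold pconj
  rw [Polynomial.map_sum]
  refine Finset.sum_congr rfl fun k _ => ?_
  rw [Polynomial.smul_eq_C_mul, Polynomial.map_mul, this, Polynomial.map_C, Polynomial.smul_eq_C_mul]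

lemma Adm.nsq_expansion (hw : Adm w) (n : ℕ) (c : ℕ → ℂ) :
    nsq w (∑ k ∈ Finset.range n, c k • mp 0 k) =
      (∫ x, w x) * ∑ k ∈ Finset.range n, ‖c k‖ ^ 2 * hn k := by
  have h := hw.L_nsq (∑ k ∈ Finset.range n, c k • mp 0 k)
  rw [pconj_sum_smul, Finset.sum_mul_sum, map_sum] at h
  have : ∀ j ∈ Finset.range n, hw.L (∑ k ∈ Finset.range n, c j • mp 0 j * (starRingEnd ℂ) (c k) • mp 0 k)
      = ((∫ x, w x : ℝ) : ℂ) * ((‖c j‖ ^ 2 * hn j : ℝ) : ℂ) := by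
    intro j hj
    rw [map_sum, Finset.sum_eq_single j]
    · rw [smul_mul_smul_comm, map_smul, hw.L_mp_mul, if_pos rfl, hw.L_one, smul_eq_mul,
        Complex.mul_conj, Complex.normSq_eq_norm_sq]
      push_cast; ring
    · intro k _ hk
      rw [smul_mul_smul_comm, map_smul, hw.L_mp_mul, if_neg (Ne.symm hk), smul_zero]
    · intro h; exact absurd hj h
  rw [Finset.sum_congr rfl this, ← Finset.mul_sum] at h
  exact_mod_cast h.symm

/-- Christoffel-Darboux integral bound -/
lemma Adm.cd_int (hw : Adm w) (n : ℕ) :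
    Integrable (fun x : ℝ => ‖mpe x n‖ ^ 2 / (x ^ 2 + 1 / 16) * w x) ∧
    ∫ x : ℝ, ‖mpe x n‖ ^ 2 / (x ^ 2 + 1 / 16) * w x ≤ (∫ x, w x) * (8 * hn n / (n + 1 / 2)) := by
  set c : ℕ → ℂ := fun k => Complex.I ^ k * (tau (1/4) k : ℂ) / (hn k : ℂ) with hc
  have he : ∀ x : ℝ, (∑ k ∈ Finset.range (n + 1), c k • mp 0 k).eval (x : ℂ) =
      ∑ k ∈ Finset.range (n + 1), (Complex.I ^ k * (tau (1/4) k : ℂ) / (hn k : ℂ)) * mpe x k := by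
    intro x
    rw [Polynomial.eval_finsetSum]
    simp [mp_eval, hc]
  have h0 := hw.nsq_expansion (n + 1) c
  have hi := hw.intsq (∑ k ∈ Finset.range (n + 1), c k • mp 0 k)
  unfold nsq at h0
  simp only [he] at h0 hi
  have hcn : ∀ k, ‖c k‖ ^ 2 * hn k = tau (1/4) k ^ 2 / hn k := by
    intro k
    have := hn_pos k
    simp only [hc, norm_div, norm_mul, norm_pow, Complex.norm_I, one_pow, one_mul, Complex.norm_real,
      norm_of_nonneg this.le, norm_of_nonneg (tau_quarter_pos k).le]
    field_simp
  simp only [hcn] at h0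
  rw [tau_quarter_sum] at h0
  have hdom : ∀ x : ℝ, ‖mpe x n‖ ^ 2 / (x ^ 2 + 1 / 16) * w x ≤ hn n ^ 2 / tau (1/4) (n + 1) ^ 2 *
      (‖∑ k ∈ Finset.range (n + 1), (Complex.I ^ k * (tau (1/4) k : ℂ) / (hn k : ℂ)) * mpe x k‖ ^ 2 * w x) := by
    intro x
    rw [← mul_assoc]
    exact mul_le_mul_of_nonneg_right (cd_ineq x n) (hw.nonneg x)
  have hint : Integrable (fun x : ℝ => ‖mpe x n‖ ^ 2 / (x ^ 2 + 1 / 16) * w x) := by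
    have hq := hw.intsq (mp 0 n)
    simp only [mp_eval, add_zero] at hq
    refine (hq.const_mul 16).mono ?_ (Eventually.of_forall fun x => ?_)
    · have : AEStronglyMeasurable (fun x : ℝ => (1 / (x ^ 2 + 1/16))) volume :=
        (Continuous.div continuous_const (by fun_prop) (fun x => by positivity)).aestronglyMeasurable
      refine (this.mul hq.aestronglyMeasurable).congr (Eventually.of_forall fun x => ?_)
      simp; ring
    · have h1 := hw.nonneg x
      rw [norm_of_nonneg (by positivity), norm_of_nonneg (by positivity), div_mul_eq_mul_div,
        div_le_iff₀ (by positivity)]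
      have : 0 ≤ ‖mpe x n‖ ^ 2 * w x := by positivity
      nlinarith [sq_nonneg x, mul_nonneg this (sq_nonneg x)]
  refine ⟨hint, ?_⟩
  calc _ ≤ ∫ x : ℝ, hn n ^ 2 / tau (1/4) (n + 1) ^ 2 *
      (‖∑ k ∈ Finset.range (n + 1), (Complex.I ^ k * (tau (1/4) k : ℂ) / (hn k : ℂ)) * mpe x k‖ ^ 2 * w x) :=
        integral_mono hint (hi.const_mul _) hdom
    _ = _ := by
      rw [integral_const_mul, h0]
      have := hn_pos n
      have := tau_quarter_pos (n + 1)
      field_simp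

end weight
end BOP

namespace BOP

lemma mp_near (s : ℂ) {ρ : ℝ} (hρ : 0 < ρ) (x : ℝ) (hx : |x| ≤ ρ) : ∀ k,
    ‖mpe (x + s) k‖ ≤ tau (ρ + ‖s‖) k ∧ ‖mpe (x + s) k - mpe s k‖ ≤ |x| / ρ * tau (ρ + ‖s‖) k
  | 0 => by simp [mpe, tau]; positivity
  | 1 => by
    simp only [mpe, tau]
    constructor
    · calc _ ≤ ‖(x:ℂ)‖ + ‖s‖ := norm_add_le _ _
        _ ≤ _ := by simp; linarith
    · simp
      rw [div_mul_eq_mul_div, le_div_iff₀ hρ]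
      nlinarith [abs_nonneg x, norm_nonneg s, mul_nonneg (abs_nonneg x) (norm_nonneg s)]
  | (k + 2) => by
    obtain ⟨a1, d1⟩ := mp_near s hρ x hx k
    obtain ⟨a2, d2⟩ := mp_near s hρ x hx (k + 1)
    have hb := bc_nonneg (k + 1)
    have ht1 := tau_nonneg (c := ρ + ‖s‖) (by positivity) k
    have ht2 := tau_nonneg (c := ρ + ‖s‖) (by positivity) (k + 1)
    have nb : ‖(bc (k + 1) : ℂ)‖ = bc (k + 1) := by rw [Complex.norm_real, norm_of_nonneg hb]
    have nx : ‖(x:ℂ)‖ = |x| := by simp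
    simp only [mpe, tau]
    constructor
    · calc _ ≤ ‖(x + s) * mpe (x + s) (k + 1)‖ + ‖(bc (k + 1) : ℂ) * mpe (x + s) k‖ := norm_sub_le _ _
        _ ≤ (ρ + ‖s‖) * tau (ρ + ‖s‖) (k + 1) + bc (k + 1) * tau (ρ + ‖s‖) k := by
          rw [norm_mul, norm_mul, nb]
          gcongr
          refine (norm_add_le _ _).trans ?_
          rw [nx]; linarith
    · have e : (x + s) * mpe (x + s) (k + 1) - (bc (k + 1) : ℂ) * mpe (x + s) k
          - (s * mpe s (k + 1) - (bc (k + 1) : ℂ) * mpe s k) =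
          x * mpe (x + s) (k + 1) + s * (mpe (x + s) (k + 1) - mpe s (k + 1))
            - (bc (k + 1) : ℂ) * (mpe (x + s) k - mpe s k) := by ring
      rw [e]
      calc _ ≤ ‖(x:ℂ) * mpe (x + s) (k + 1)‖ + ‖s * (mpe (x + s) (k + 1) - mpe s (k + 1))‖
            + ‖(bc (k + 1) : ℂ) * (mpe (x + s) k - mpe s k)‖ :=
            (norm_sub_le _ _).trans (add_le_add_left (norm_add_le _ _) _)
        _ ≤ |x| * tau (ρ + ‖s‖) (k + 1) + ‖s‖ * (|x| / ρ * tau (ρ + ‖s‖) (k + 1))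
            + bc (k + 1) * (|x| / ρ * tau (ρ + ‖s‖) k) := by
          rw [norm_mul, norm_mul, norm_mul, nb, nx]; gcongr
        _ = _ := by field_simp

lemma sum_rpow_le {γ : ℝ} (h0 : 0 < γ) (h1 : γ ≤ 1) (n : ℕ) :
    ∑ k ∈ Finset.range n, ((k:ℝ) + 1) ^ (γ - 1) ≤ (n:ℝ) ^ γ / γ := by
  induction n with
  | zero => simp [zero_rpow h0.ne']
  | succ n ih =>
    rw [Finset.sum_range_succ]
    have hk : (0:ℝ) < n + 1 := by positivity
    have h := _root_.rpow_one_add_le_one_add_mul_self (s := -1 / ((n:ℝ) + 1)) (p := γ)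
      (by rw [le_div_iff₀ hk]; have : (0:ℝ) ≤ n := Nat.cast_nonneg n; linarith) h0.le h1
    have e : (1 + -1 / ((n:ℝ) + 1)) = n / (n + 1) := by field_simp; ring
    rw [e, div_rpow (Nat.cast_nonneg n) hk.le, div_le_iff₀ (by positivity)] at h
    have e2 : ((n:ℝ) + 1) ^ (γ - 1) = ((n:ℝ) + 1) ^ γ / (n + 1) := rpow_sub_one hk.ne' γ
    have : γ * ((n:ℝ) + 1) ^ (γ - 1) ≤ ((n:ℝ) + 1) ^ γ - (n:ℝ) ^ γ := by
      rw [e2]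
      have : (1 + γ * (-1 / ((n:ℝ) + 1))) * ((n:ℝ) + 1) ^ γ = ((n:ℝ) + 1) ^ γ - γ * (((n:ℝ) + 1) ^ γ / (n + 1)) := by
        ring
      linarith
    push_cast
    rw [le_div_iff₀ h0] at ih ⊢
    linarith

lemma half_rpow {k p : ℝ} (hk : 0 ≤ k) (hp : -1 ≤ p) (hp' : p ≤ 0) :
    (k + 1 / 2) ^ p ≤ 2 * (k + 1) ^ p := by
  calc (k + 1 / 2) ^ p ≤ ((k + 1) / 2) ^ p :=
        rpow_le_rpow_of_nonpos (by linarith) (by linarith) hp'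
    _ = (k + 1) ^ p * (1/2) ^ p := by rw [← mul_rpow (by linarith) (by norm_num)]; ring_nf
    _ ≤ (k + 1) ^ p * 2 := by
      gcongr
      calc (1/2:ℝ) ^ p ≤ (1/2:ℝ) ^ (-1:ℝ) := rpow_le_rpow_of_exponent_ge (by norm_num) (by norm_num) hp
        _ = 2 := by rw [rpow_neg_one]; norm_num
    _ = _ := by ring

lemma tau_sum_bound {ρ : ℝ} (h0 : 0 < ρ) (h1 : ρ ≤ 1 / 2) (n : ℕ) :
    ∑ k ∈ Finset.range n, tau ρ k ^ 2 / hn k ≤ 8 / ρ * (n:ℝ) ^ (2 * ρ) := by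
  calc _ ≤ ∑ k ∈ Finset.range n, 16 * ((k:ℝ) + 1) ^ (2 * ρ - 1) := by
        refine Finset.sum_le_sum fun k _ => ?_
        have hk : (0:ℝ) ≤ k := Nat.cast_nonneg k
        have hp : (0:ℝ) < k + 1/2 := by linarith
        have e : tau ρ k ^ 2 / hn k = (nf k * tau ρ k) ^ 2 / rr k := by
          have := hn_pos k; have := nf_pos k
          unfold rr; field_simp
        have b1 := tau_bound h0.le h1 k
        have b0 : 0 ≤ nf k * tau ρ k := mul_nonneg (nf_pos k).le (tau_nonneg h0.le k)
        have b2 : 1 / (2 * (k + 1/2:ℝ) ^ (1/2:ℝ)) ≤ rr k := by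
          have hs : ((k + 1/2:ℝ) ^ (1/2:ℝ)) ^ 2 = k + 1/2 := by
            rw [← rpow_natCast, ← rpow_mul hp.le]; norm_num
          refine le_of_sq_le_sq ?_ (rr_pos k).le
          refine le_trans ?_ (rr_lower k)
          rw [div_pow, mul_pow, hs]
          rw [one_pow]
          apply one_div_le_one_div_of_le <;> linarith
        rw [e]
        calc _ ≤ (2 * ((k:ℝ) + 1 / 2) ^ (ρ - 3 / 4)) ^ 2 / (1 / (2 * (k + 1/2:ℝ) ^ (1/2:ℝ))) := by
              gcongr
          _ = 8 * ((k:ℝ) + 1/2) ^ (2 * ρ - 1) := by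
              have : ((k:ℝ) + 1/2) ^ (2 * ρ - 1) = (((k:ℝ) + 1 / 2) ^ (ρ - 3 / 4)) ^ 2 * (k + 1/2:ℝ) ^ (1/2:ℝ) := by
                rw [← rpow_natCast, ← rpow_mul hp.le, ← rpow_add hp]; congr 1; push_cast; ring
              rw [this]; field_simp; ring
          _ ≤ 8 * (2 * ((k:ℝ) + 1) ^ (2 * ρ - 1)) := by
              gcongr; exact half_rpow hk (by linarith) (by linarith)
          _ = _ := by ring
    _ ≤ 16 * ((n:ℝ) ^ (2 * ρ) / (2 * ρ)) := by
        rw [← Finset.mul_sum]; gcongr; exact sum_rpow_le (by linarith) (by linarith) n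
    _ = _ := by field_simp; ring

lemma conv_bound {α : ℝ} (h0 : 0 < α) (h1 : α ≤ 1 / 4) (n : ℕ) :
    ∑ j ∈ Finset.range (n + 1), kap α j * (((n - j : ℕ) : ℝ) + 1) ^ (-3/4 : ℝ)
      ≤ (2 / α + 9) * ((n:ℝ) + 1) ^ (α - 3/4) := by
  have hn : (0:ℝ) < n + 1 := by positivity
  have hn1 : (1:ℝ) ≤ n + 1 := by linarith [(Nat.cast_nonneg n : (0:ℝ) ≤ n)]
  rw [Finset.sum_range_succ']
  have t0 : kap α 0 * (((n - 0 : ℕ) : ℝ) + 1) ^ (-3/4 : ℝ) ≤ ((n:ℝ) + 1) ^ (α - 3/4) := by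
    simp only [kap, Nat.sub_zero, one_mul]
    exact rpow_le_rpow_of_exponent_le hn1 (by linarith)
  have t1 : ∀ j ∈ Finset.range n, kap α (j + 1) * (((n - (j + 1) : ℕ) : ℝ) + 1) ^ (-3/4 : ℝ) ≤
      2 * ((n:ℝ) + 1) ^ (-3/4:ℝ) * ((j:ℝ) + 1) ^ (α - 1)
        + 2 * ((n:ℝ) + 1) ^ (α - 1) * (((n - 1 - j : ℕ) : ℝ) + 1) ^ ((1/4:ℝ) - 1) := by
    intro j hj
    have hj' := Finset.mem_range.1 hj
    have hc : (((n - (j + 1) : ℕ) : ℝ) + 1) = n - j := by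
      rw [Nat.cast_sub (by omega)]; push_cast; ring
    have hc2 : (((n - 1 - j : ℕ) : ℝ) + 1) = n - j := by
      rw [← hc]; congr 2; omega
    rw [hc, hc2, show (1/4:ℝ) - 1 = -3/4 by norm_num]
    have hjn : (j:ℝ) + 1 ≤ n := by exact_mod_cast hj'
    have hj0 : (0:ℝ) ≤ j := Nat.cast_nonneg j
    have hk := kap_bound h0 h1 j
    have p1 : 0 ≤ ((n:ℝ) - j) ^ (-3/4:ℝ) := rpow_nonneg (by linarith) _
    have p2 : 0 ≤ ((j:ℝ) + 1) ^ (α - 1) := by positivity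
    have p3 : 0 ≤ ((n:ℝ) + 1) ^ (-3/4:ℝ) := by positivity
    have p4 : 0 ≤ ((n:ℝ) + 1) ^ (α - 1) := by positivity
    have key : ∀ y p : ℝ, ((n:ℝ) + 1) / 2 ≤ y → -1 ≤ p → p ≤ 0 → y ^ p ≤ 2 * ((n:ℝ) + 1) ^ p := by
      intro y p hy hp hp'
      have := half_rpow (k := (n:ℝ)) (p := p) (by linarith) hp hp'
      calc y ^ p ≤ (((n:ℝ) + 1) / 2) ^ p := rpow_le_rpow_of_nonpos (by linarith) hy hp'
        _ = (n + 1:ℝ) ^ p * (1/2) ^ p := by rw [← mul_rpow (by linarith) (by norm_num)]; ring_nf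
        _ ≤ (n + 1:ℝ) ^ p * 2 := by
          gcongr
          calc (1/2:ℝ) ^ p ≤ (1/2:ℝ) ^ (-1:ℝ) := rpow_le_rpow_of_exponent_ge (by norm_num) (by norm_num) hp
            _ = 2 := by rw [rpow_neg_one]; norm_num
        _ = _ := by ring
    refine (mul_le_mul_of_nonneg_right hk p1).trans ?_
    by_cases hc : ((n:ℝ) + 1) / 2 ≤ j + 1
    · have := key _ (α - 1) hc (by linarith) (by linarith)
      have := mul_le_mul_of_nonneg_right this p1
      have := mul_nonneg p3 p2
      linarith
    · have := key (n - j) (-3/4) (by linarith) (by norm_num) (by norm_num)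
      have := mul_le_mul_of_nonneg_left this p2
      have := mul_nonneg p4 p1
      linarith
  have t2 := Finset.sum_le_sum t1
  rw [Finset.sum_add_distrib, ← Finset.mul_sum, ← Finset.mul_sum,
    Finset.sum_range_reflect (fun j => ((j:ℝ) + 1) ^ ((1/4:ℝ) - 1)) n] at t2
  have s1 := sum_rpow_le h0 (by linarith) n
  have s2 := sum_rpow_le (γ := 1/4) (by norm_num) (by norm_num) n
  have m1 : (n:ℝ) ^ α ≤ ((n:ℝ) + 1) ^ α := rpow_le_rpow (Nat.cast_nonneg n) (by linarith) h0.le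
  have m2 : (n:ℝ) ^ (1/4:ℝ) ≤ ((n:ℝ) + 1) ^ (1/4:ℝ) := rpow_le_rpow (Nat.cast_nonneg n) (by linarith) (by norm_num)
  have e1 : ((n:ℝ) + 1) ^ (-3/4:ℝ) * ((n:ℝ) + 1) ^ α = ((n:ℝ) + 1) ^ (α - 3/4) := by
    rw [← rpow_add hn]; ring_nf
  have e2 : ((n:ℝ) + 1) ^ (α - 1) * ((n:ℝ) + 1) ^ (1/4:ℝ) = ((n:ℝ) + 1) ^ (α - 3/4) := by
    rw [← rpow_add hn]; ring_nf
  have u1 : 2 * ((n:ℝ) + 1) ^ (-3/4:ℝ) * ∑ j ∈ Finset.range n, ((j:ℝ) + 1) ^ (α - 1) ≤ 2 / α * ((n:ℝ) + 1) ^ (α - 3/4) := by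
    calc _ ≤ 2 * ((n:ℝ) + 1) ^ (-3/4:ℝ) * (((n:ℝ) + 1) ^ α / α) := by
          gcongr; exact s1.trans (by gcongr)
      _ = _ := by rw [← e1]; ring
  have u2 : 2 * ((n:ℝ) + 1) ^ (α - 1) * ∑ j ∈ Finset.range n, ((j:ℝ) + 1) ^ ((1/4:ℝ) - 1) ≤ 8 * ((n:ℝ) + 1) ^ (α - 3/4) := by
    calc _ ≤ 2 * ((n:ℝ) + 1) ^ (α - 1) * (((n:ℝ) + 1) ^ (1/4:ℝ) / (1/4)) := by
          gcongr; exact s2.trans (by gcongr)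
      _ = _ := by rw [← e2]; ring
  linarith

section weight
variable {w : ℝ → ℝ}

lemma nsq_nonneg (hw : Adm w) (q : Polynomial ℂ) : 0 ≤ nsq w q :=
  integral_nonneg fun x => mul_nonneg (by positivity) (hw.nonneg x)

/-- evaluation bound -/
lemma Adm.coef_bound (hw : Adm w) (hw0 : 0 < ∫ x, w x) (n : ℕ) (c : ℕ → ℂ) (t : ℕ → ℝ) (ht : ∀ k, 0 ≤ t k) :
    ∑ k ∈ Finset.range n, ‖c k‖ * t k ≤
      √(nsq w (∑ k ∈ Finset.range n, c k • mp 0 k) / ∫ x, w x) *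
        √(∑ k ∈ Finset.range n, t k ^ 2 / hn k) := by
  rw [hw.nsq_expansion, mul_div_cancel_left₀ _ hw0.ne']
  have := Real.sum_mul_le_sqrt_mul_sqrt (Finset.range n) (fun k => ‖c k‖ * √(hn k)) (fun k => t k / √(hn k))
  refine le_trans (le_of_eq ?_) (this.trans (le_of_eq ?_))
  · refine Finset.sum_congr rfl fun k _ => ?_
    have := Real.sqrt_pos.2 (hn_pos k)
    field_simp
  congr 1
  · congr 1
    refine Finset.sum_congr rfl fun k _ => ?_
    rw [mul_pow, Real.sq_sqrt (hn_pos k).le]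
  · congr 1
    refine Finset.sum_congr rfl fun k _ => ?_
    rw [div_pow, Real.sq_sqrt (hn_pos k).le]

lemma Adm.value_bound (hw : Adm w) (hw0 : 0 < ∫ x, w x) (n : ℕ) (q : Polynomial ℂ)
    (hq : q.degree < (n:ℕ)) (z : ℂ) :
    ‖q.eval z‖ ≤ √(nsq w q / ∫ x, w x) * √(∑ k ∈ Finset.range n, ‖mpe z k‖ ^ 2 / hn k) := by
  obtain ⟨c, rfl⟩ := exists_expansion 0 n q hq
  refine le_trans ?_ (hw.coef_bound hw0 n c (fun k => ‖mpe z k‖) (fun k => norm_nonneg _))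
  rw [Polynomial.eval_finsetSum]
  refine (norm_sum_le _ _).trans (Finset.sum_le_sum fun k _ => ?_)
  simp [mp_eval]

lemma Adm.near_bound (hw : Adm w) (hw0 : 0 < ∫ x, w x) {ρ : ℝ} (h0 : 0 < ρ) (h1 : ρ ≤ 1/2) (n : ℕ) (q : Polynomial ℂ)
    (hq : q.degree < (n:ℕ)) (x : ℝ) (hx : |x| ≤ ρ) :
    ‖q.eval (x:ℂ)‖ ≤ √(nsq w q / ∫ x, w x) * √(8 / ρ * (n:ℝ) ^ (2 * ρ)) ∧
    ‖q.eval (x:ℂ) - q.eval 0‖ ≤ |x| / ρ * (√(nsq w q / ∫ x, w x) * √(8 / ρ * (n:ℝ) ^ (2 * ρ))) := by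
  obtain ⟨c, rfl⟩ := exists_expansion 0 n q hq
  have hb : ∑ k ∈ Finset.range n, ‖c k‖ * tau ρ k ≤
      √(nsq w (∑ k ∈ Finset.range n, c k • mp 0 k) / ∫ x, w x) * √(8 / ρ * (n:ℝ) ^ (2 * ρ)) :=
    (hw.coef_bound hw0 n c (tau ρ) (tau_nonneg h0.le)).trans
      (mul_le_mul_of_nonneg_left (Real.sqrt_le_sqrt (tau_sum_bound h0 h1 n)) (Real.sqrt_nonneg _))
  have hm := fun k => mp_near 0 h0 x hx k
  simp only [norm_zero, add_zero] at hm
  constructor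
  · refine le_trans ?_ hb
    rw [Polynomial.eval_finsetSum]
    refine (norm_sum_le _ _).trans (Finset.sum_le_sum fun k _ => ?_)
    simp only [Polynomial.eval_smul, mp_eval, add_zero, norm_smul]
    exact mul_le_mul_of_nonneg_left (hm k).1 (norm_nonneg _)
  · refine le_trans ?_ (mul_le_mul_of_nonneg_left hb (by positivity))
    rw [Polynomial.eval_finsetSum, Polynomial.eval_finsetSum, ← Finset.sum_sub_distrib, Finset.mul_sum]
    refine (norm_sum_le _ _).trans (Finset.sum_le_sum fun k _ => ?_)
    simp only [Polynomial.eval_smul, mp_eval, add_zero, ← smul_sub, norm_smul]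
    refine (mul_le_mul_of_nonneg_left (hm k).2 (norm_nonneg _)).trans_eq (by ring)

lemma cd_norm_bound (k : ℕ) : nf k ^ 2 * (8 * hn k / (k + 1 / 2)) ≤ (4 * ((k:ℝ) + 1) ^ (-3/4:ℝ)) ^ 2 := by
  have hk : (0:ℝ) ≤ k := Nat.cast_nonneg k
  have e : nf k ^ 2 * (8 * hn k / (k + 1 / 2)) = 16 * rr k / (2 * k + 1) := by
    unfold rr; field_simp; ring
  rw [e]
  set u : ℝ := ((k:ℝ) + 1) ^ (-1/4:ℝ)
  have hu : 0 < u := by positivity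
  have hu4 : u ^ 4 = 1 / (k + 1) := by
    rw [← rpow_natCast, ← rpow_mul (by linarith)]; norm_num [rpow_neg_one]
  have e2 : ((k:ℝ) + 1) ^ (-3/4:ℝ) = u ^ 3 := by
    rw [← rpow_natCast, ← rpow_mul (by linarith)]; norm_num
  rw [e2]
  have h1 : rr k ≤ u ^ 2 := by
    refine le_of_sq_le_sq ?_ (by positivity)
    refine (rr_upper k).trans ?_
    rw [← pow_mul, hu4]
    apply one_div_le_one_div_of_le <;> linarith
  have h2 : 1 / (2 * (k:ℝ) + 1) ≤ u ^ 4 := by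
    rw [hu4]; apply one_div_le_one_div_of_le <;> linarith
  calc 16 * rr k / (2 * k + 1) = 16 * (rr k * (1 / (2 * (k:ℝ) + 1))) := by ring
    _ ≤ 16 * (u ^ 2 * u ^ 4) := by gcongr
    _ = _ := by ring

/-- far bound for the model polynomial -/
lemma Adm.far_bound (hw : Adm w) {α : ℝ} (h0 : 0 < α) (h1 : α ≤ 1 / 4) (n : ℕ) :
    Integrable (fun x : ℝ => ‖mpe (x + Complex.I * α) n‖ ^ 2 / (x ^ 2 + 1 / 16) * w x) ∧
    ∫ x : ℝ, ‖mpe (x + Complex.I * α) n‖ ^ 2 / (x ^ 2 + 1 / 16) * w x ≤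
      (∫ x, w x) * ((2 / α + 9) * 4 * ((n:ℝ) + 1) ^ (α - 3/4) / nf n) ^ 2 := by
  set B : ℕ → ℝ := fun j => 4 * (((n - j : ℕ):ℝ) + 1) ^ (-3/4:ℝ) with hB
  have hBp : ∀ j, 0 < B j := fun j => by simp only [hB]; positivity
  set S : ℝ := ∑ j ∈ Finset.range (n + 1), kap α j * B j with hS
  have hk := fun j => kap_nonneg h0.le j
  have hS0 : 0 ≤ S := Finset.sum_nonneg fun j _ => mul_nonneg (hk j) (hBp j).le
  have hSb : S ≤ (2 / α + 9) * 4 * ((n:ℝ) + 1) ^ (α - 3/4) := by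
    have := conv_bound h0 h1 n
    calc S = 4 * ∑ j ∈ Finset.range (n + 1), kap α j * (((n - j : ℕ) : ℝ) + 1) ^ (-3/4 : ℝ) := by
          rw [hS, Finset.mul_sum]; exact Finset.sum_congr rfl fun j _ => by simp only [hB]; ring
      _ ≤ 4 * ((2 / α + 9) * ((n:ℝ) + 1) ^ (α - 3/4)) := by gcongr
      _ = _ := by ring
  have hint := fun j => (hw.cd_int j).1
  have pt : ∀ x : ℝ, ‖mpe (x + Complex.I * α) n‖ ^ 2 / (x ^ 2 + 1 / 16) * w x ≤
      (1 / nf n ^ 2 * S) * ∑ j ∈ Finset.range (n + 1), kap α j / B j * nf (n - j) ^ 2 *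
        (‖mpe x (n - j)‖ ^ 2 / (x ^ 2 + 1 / 16) * w x) := by
    intro x
    have h := shift_expansion α x n
    have hh : nf n * ‖mpe (x + Complex.I * α) n‖ ≤ ∑ j ∈ Finset.range (n + 1), kap α j * (nf (n - j) * ‖mpe x (n - j)‖) := by
      have : nf n * ‖mpe (x + Complex.I * α) n‖ = ‖(nf n : ℂ) * mpe (x + Complex.I * α) n‖ := by
        rw [norm_mul, Complex.norm_real, norm_of_nonneg (nf_pos n).le]
      rw [this, h]
      refine (norm_sum_le _ _).trans (Finset.sum_le_sum fun j _ => ?_)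
      rw [norm_mul, norm_mul, norm_mul, norm_pow, Complex.norm_I, one_pow, one_mul, Complex.norm_real, Complex.norm_real,
        norm_of_nonneg (nf_pos _).le, norm_of_nonneg (hk j)]
    have cs : (∑ j ∈ Finset.range (n + 1), kap α j * (nf (n - j) * ‖mpe x (n - j)‖)) ^ 2 ≤
        S * ∑ j ∈ Finset.range (n + 1), kap α j / B j * nf (n - j) ^ 2 * ‖mpe x (n - j)‖ ^ 2 := by
      have := Finset.sum_mul_sq_le_sq_mul_sq (Finset.range (n + 1)) (fun j => √(kap α j * B j))
        (fun j => √(kap α j / B j) * (nf (n - j) * ‖mpe x (n - j)‖))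
      refine le_trans (le_of_eq ?_) (this.trans (le_of_eq ?_))
      · congr 1
        refine Finset.sum_congr rfl fun j _ => ?_
        rw [← mul_assoc √(kap α j * B j), ← Real.sqrt_mul (mul_nonneg (hk j) (hBp j).le)]
        have : kap α j * B j * (kap α j / B j) = kap α j ^ 2 := by have := hBp j; field_simp
        rw [this, Real.sqrt_sq (hk j)]
      · congr 1
        · exact Finset.sum_congr rfl fun j _ => Real.sq_sqrt (mul_nonneg (hk j) (hBp j).le)
        · refine Finset.sum_congr rfl fun j _ => ?_
          rw [mul_pow, mul_pow, Real.sq_sqrt (div_nonneg (hk j) (hBp j).le)]; ring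
    have hsq : nf n ^ 2 * ‖mpe (x + Complex.I * α) n‖ ^ 2 ≤
        S * ∑ j ∈ Finset.range (n + 1), kap α j / B j * nf (n - j) ^ 2 * ‖mpe x (n - j)‖ ^ 2 := by
      rw [← mul_pow]
      exact (pow_le_pow_left₀ (mul_nonneg (nf_pos n).le (norm_nonneg _)) hh 2).trans cs
    have hnf := nf_pos n
    have hwx := hw.nonneg x
    calc ‖mpe (x + Complex.I * α) n‖ ^ 2 / (x ^ 2 + 1 / 16) * w x
        = (nf n ^ 2 * ‖mpe (x + Complex.I * α) n‖ ^ 2) * (1 / nf n ^ 2 * (1 / (x ^ 2 + 1/16) * w x)) := by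
          field_simp
      _ ≤ (S * ∑ j ∈ Finset.range (n + 1), kap α j / B j * nf (n - j) ^ 2 * ‖mpe x (n - j)‖ ^ 2) *
          (1 / nf n ^ 2 * (1 / (x ^ 2 + 1/16) * w x)) := by gcongr
      _ = (1 / nf n ^ 2 * S) * ((∑ j ∈ Finset.range (n + 1), kap α j / B j * nf (n - j) ^ 2 * ‖mpe x (n - j)‖ ^ 2) *
          (1 / (x ^ 2 + 1/16) * w x)) := by ring
      _ = _ := by
          congr 1; rw [Finset.sum_mul]
          exact Finset.sum_congr rfl fun j _ => by ring
  have hI : Integrable (fun x : ℝ => (1 / nf n ^ 2 * S) * ∑ j ∈ Finset.range (n + 1), kap α j / B j * nf (n - j) ^ 2 *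
        (‖mpe x (n - j)‖ ^ 2 / (x ^ 2 + 1 / 16) * w x)) :=
    (integrable_finsetSum _ fun j _ => (hint (n - j)).const_mul _).const_mul _
  have hI1 : Integrable (fun x : ℝ => ‖mpe (x + Complex.I * α) n‖ ^ 2 / (x ^ 2 + 1 / 16) * w x) := by
    refine hI.mono ?_ (Eventually.of_forall fun x => ?_)
    · have hq := (hw.intsq (mp (Complex.I * α) n)).aestronglyMeasurable
      simp only [mp_eval] at hq
      have : AEStronglyMeasurable (fun x : ℝ => (1 / (x ^ 2 + 1/16))) volume :=
        (Continuous.div continuous_const (by fun_prop) (fun x => by positivity)).aestronglyMeasurable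
      refine (this.mul hq).congr (Eventually.of_forall fun x => ?_)
      simp; ring
    · have hwx := hw.nonneg x
      rw [norm_of_nonneg (by positivity)]
      exact (pt x).trans (le_norm_self _)
  refine ⟨hI1, (integral_mono hI1 hI pt).trans ?_⟩
  rw [integral_const_mul, integral_finsetSum _ fun j _ => (hint (n - j)).const_mul _]
  have hw0 : 0 ≤ ∫ x, w x := integral_nonneg hw.nonneg
  have term : ∀ j ∈ Finset.range (n + 1), ∫ x : ℝ, kap α j / B j * nf (n - j) ^ 2 *
        (‖mpe x (n - j)‖ ^ 2 / (x ^ 2 + 1 / 16) * w x) ≤ (∫ x, w x) * (kap α j * B j) := by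
    intro j _
    rw [integral_const_mul]
    calc _ ≤ kap α j / B j * nf (n - j) ^ 2 * ((∫ x, w x) * (8 * hn (n - j) / ((n - j : ℕ) + 1 / 2))) := by
          have := hk j; have := hBp j
          gcongr; exact (hw.cd_int (n - j)).2
      _ = kap α j / B j * (∫ x, w x) * (nf (n - j) ^ 2 * (8 * hn (n - j) / ((n - j : ℕ) + 1 / 2))) := by ring
      _ ≤ kap α j / B j * (∫ x, w x) * (B j) ^ 2 := by
          have := hk j; have := hBp j
          gcongr; exact cd_norm_bound (n - j)
      _ = _ := by have := hBp j; field_simp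
  have hnf := nf_pos n
  calc _ ≤ 1 / nf n ^ 2 * S * ∑ j ∈ Finset.range (n + 1), (∫ x, w x) * (kap α j * B j) := by
        gcongr with j hj; exact term j hj
    _ = (∫ x, w x) * (S / nf n) ^ 2 := by rw [← Finset.mul_sum]; ring
    _ ≤ _ := by gcongr

end weight
end BOP

namespace BOP

lemma cauchy_schwarz_int {f g : ℝ → ℝ} (hf0 : ∀ x, 0 ≤ f x) (hg0 : ∀ x, 0 ≤ g x)
    (hf : Integrable f) (hg : Integrable g) :
    Integrable (fun x => √(f x) * √(g x)) ∧
    ∫ x, √(f x) * √(g x) ≤ √(∫ x, f x) * √(∫ x, g x) := by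
  have mf : MemLp (fun x => √(f x)) 2 volume := by
    rw [memLp_two_iff_integrable_sq (hf.aestronglyMeasurable.aemeasurable.sqrt.aestronglyMeasurable)]
    exact hf.congr (Eventually.of_forall fun x => (Real.sq_sqrt (hf0 x)).symm)
  have mg : MemLp (fun x => √(g x)) 2 volume := by
    rw [memLp_two_iff_integrable_sq (hg.aestronglyMeasurable.aemeasurable.sqrt.aestronglyMeasurable)]
    exact hg.congr (Eventually.of_forall fun x => (Real.sq_sqrt (hg0 x)).symm)
  refine ⟨mf.integrable_mul mg, ?_⟩
  have := integral_mul_le_Lp_mul_Lq_of_nonneg (μ := volume) (p := 2) (q := 2) (f := fun x => √(f x)) (g := fun x => √(g x))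
    Real.HolderConjugate.two_two (Eventually.of_forall fun x => Real.sqrt_nonneg _)
    (Eventually.of_forall fun x => Real.sqrt_nonneg _) (by simpa using mf) (by simpa using mg)
  simp only [rpow_ofNat, Real.sq_sqrt (hf0 _), Real.sq_sqrt (hg0 _), ← Real.sqrt_eq_rpow] at this
  exact this

/-- data for the comparison argument -/
structure Cmp (α ρ : ℝ) (w : ℝ → ℝ) (W w0 : ℝ → ℂ) (κ0 κ1 : ℂ) (c C : ℝ) : Prop where
  adm : Adm w
  wpos : 0 < ∫ x, w x
  α0 : 0 < α
  α1 : α ≤ 1 / 4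
  ρ0 : 0 < ρ
  ρ1 : ρ ≤ 1 / 4
  cpos : 0 < c
  Cpos : 0 < C
  Wint : ∀ q : Polynomial ℂ, Integrable (fun x : ℝ => q.eval (x : ℂ) * W x)
  coer : ∀ q : Polynomial ℂ, c * nsq w q ≤ ‖∫ x : ℝ, (q * pconj q).eval (x : ℂ) * W x‖
  w0int : ∀ q : Polynomial ℂ, Integrable (fun x : ℝ => (q.eval (x : ℂ) - q.eval 0) * w0 x)
  w0far : IntegrableOn w0 {x : ℝ | ρ < |x|}
  w0orth : ∀ (n : ℕ) (q : Polynomial ℂ), q.degree < (n : ℕ) →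
    κ1 * (q * mp (Complex.I * α) n).eval 0
      + ∫ x : ℝ, ((q * mp (Complex.I * α) n).eval (x : ℂ) - (q * mp (Complex.I * α) n).eval 0) * w0 x = 0
  far : ∀ x : ℝ, ρ < |x| → ‖W x - κ0 * w0 x‖ ≤ C * (w x / √(x ^ 2 + 1 / 16))

variable {α ρ : ℝ} {w : ℝ → ℝ} {W w0 : ℝ → ℂ} {κ0 κ1 : ℂ} {c C : ℝ}

lemma Cmp.split (h : Cmp α ρ w W w0 κ0 κ1 c C) (n : ℕ) (q : Polynomial ℂ) (hq : q.degree < (n : ℕ)) :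
    ∫ x : ℝ, (q * mp (Complex.I * α) n).eval (x : ℂ) * W x =
      (∫ x in {x : ℝ | ρ < |x|}, (q * mp (Complex.I * α) n).eval (x : ℂ) * (W x - κ0 * w0 x))
      + (∫ x in {x : ℝ | ρ < |x|}ᶜ, (q * mp (Complex.I * α) n).eval (x : ℂ) * W x)
      - κ0 * (κ1 * (q * mp (Complex.I * α) n).eval 0)
      - κ0 * (∫ x in {x : ℝ | ρ < |x|}ᶜ, ((q * mp (Complex.I * α) n).eval (x : ℂ) - (q * mp (Complex.I * α) n).eval 0) * w0 x)
      + κ0 * ((q * mp (Complex.I * α) n).eval 0 * ∫ x in {x : ℝ | ρ < |x|}, w0 x) := by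
  have ho := h.w0orth n q hq
  set f := q * mp (Complex.I * α) n
  have hm : MeasurableSet {x : ℝ | ρ < |x|} := measurableSet_lt measurable_const measurable_norm
  rw [← integral_add_compl hm (h.Wint f)]
  rw [← integral_add_compl hm (h.w0int f)] at ho
  have i1 : Integrable (fun x : ℝ => (f.eval (x : ℂ) - f.eval 0) * w0 x) (volume.restrict {x : ℝ | ρ < |x|}) :=
    (h.w0int f).integrableOn
  have i2 : Integrable (fun x : ℝ => f.eval 0 * w0 x) (volume.restrict {x : ℝ | ρ < |x|}) :=
    h.w0far.const_mul _
  have i3 : Integrable (fun x : ℝ => f.eval (x : ℂ) * w0 x) (volume.restrict {x : ℝ | ρ < |x|}) :=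
    (i1.add i2).congr (Eventually.of_forall fun x => by simp only [Pi.add_apply]; ring)
  have e1 : ∫ x in {x : ℝ | ρ < |x|}, (f.eval (x : ℂ) - f.eval 0) * w0 x =
      (∫ x in {x : ℝ | ρ < |x|}, f.eval (x : ℂ) * w0 x) - f.eval 0 * ∫ x in {x : ℝ | ρ < |x|}, w0 x := by
    rw [← integral_const_mul, ← integral_sub i3 i2]
    congr 1; ext x; ring
  have e2 : ∫ x in {x : ℝ | ρ < |x|}, f.eval (x : ℂ) * (W x - κ0 * w0 x) =
      (∫ x in {x : ℝ | ρ < |x|}, f.eval (x : ℂ) * W x) - κ0 * ∫ x in {x : ℝ | ρ < |x|}, f.eval (x : ℂ) * w0 x := by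
    rw [← integral_const_mul, ← integral_sub (h.Wint f).integrableOn (i3.const_mul _)]
    congr 1; ext x; ring
  rw [e2]
  rw [e1] at ho
  linear_combination κ0 * ho

lemma Cmp.far_part (h : Cmp α ρ w W w0 κ0 κ1 c C) (n : ℕ) (q : Polynomial ℂ) :
    ‖∫ x in {x : ℝ | ρ < |x|}, (q * mp (Complex.I * α) n).eval (x : ℂ) * (W x - κ0 * w0 x)‖ ≤
     C * (√((∫ x, w x) * ((2 / α + 9) * 4 * ((n:ℝ) + 1) ^ (α - 3/4) / nf n) ^ 2) * √(nsq w q)) := by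
  obtain ⟨hfi, hfb⟩ := h.adm.far_bound h.α0 h.α1 n
  obtain ⟨ci, cb⟩ := cauchy_schwarz_int (f := fun x : ℝ => ‖mpe (x + Complex.I * α) n‖ ^ 2 / (x ^ 2 + 1 / 16) * w x)
    (g := fun x : ℝ => ‖q.eval (x : ℂ)‖ ^ 2 * w x)
    (fun x => by have := h.adm.nonneg x; positivity) (fun x => by have := h.adm.nonneg x; positivity) hfi (h.adm.intsq q)
  have hm : MeasurableSet {x : ℝ | ρ < |x|} := measurableSet_lt measurable_const measurable_norm
  have pt : ∀ x ∈ {x : ℝ | ρ < |x|}, ‖(q * mp (Complex.I * α) n).eval (x : ℂ) * (W x - κ0 * w0 x)‖ ≤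
      C * (√(‖mpe (x + Complex.I * α) n‖ ^ 2 / (x ^ 2 + 1 / 16) * w x) * √(‖q.eval (x : ℂ)‖ ^ 2 * w x)) := by
    intro x hx
    have hw := h.adm.nonneg x
    rw [norm_mul, Polynomial.eval_mul, norm_mul, mp_eval]
    rw [Real.sqrt_mul (by positivity), Real.sqrt_mul (by positivity), Real.sqrt_div (by positivity), Real.sqrt_sq (norm_nonneg _),
      Real.sqrt_sq (norm_nonneg _)]
    calc _ ≤ ‖q.eval (x : ℂ)‖ * ‖mpe (x + Complex.I * α) n‖ * (C * (w x / √(x ^ 2 + 1 / 16))) := by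
          gcongr; exact h.far x hx
      _ = ‖q.eval (x : ℂ)‖ * ‖mpe (x + Complex.I * α) n‖ * (C * ((√(w x) * √(w x)) / √(x ^ 2 + 1 / 16))) := by
          rw [Real.mul_self_sqrt hw]
      _ = _ := by ring
  calc _ ≤ ∫ x in {x : ℝ | ρ < |x|}, C * (√(‖mpe (x + Complex.I * α) n‖ ^ 2 / (x ^ 2 + 1 / 16) * w x) * √(‖q.eval (x : ℂ)‖ ^ 2 * w x)) :=
        norm_integral_le_of_norm_le (ci.const_mul C).integrableOn ((ae_restrict_iff' hm).2 (Eventually.of_forall pt))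
    _ ≤ ∫ x : ℝ, C * (√(‖mpe (x + Complex.I * α) n‖ ^ 2 / (x ^ 2 + 1 / 16) * w x) * √(‖q.eval (x : ℂ)‖ ^ 2 * w x)) :=
        setIntegral_le_integral (ci.const_mul C) (Eventually.of_forall fun x => by have := h.Cpos; show (0:ℝ) ≤ _; positivity)
    _ ≤ _ := by
        rw [integral_const_mul]
        have := h.Cpos
        gcongr
        refine cb.trans ?_
        unfold nsq
        gcongr

/-- norm of the difference -/
lemma Cmp.bilin_bound (h : Cmp α ρ w W w0 κ0 κ1 c C) : ∃ C' > 0, ∀ n : ℕ, 1 ≤ n → ∀ q : Polynomial ℂ, q.degree < (n : ℕ) →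
    ‖∫ x : ℝ, (q * mp (Complex.I * α) n).eval (x : ℂ) * W x‖ ≤ C' * ((n:ℝ) ^ (2 * ρ + α - 3/4) / nf n) * √(nsq w q) := by
  set h0 := ∫ x, w x with hh0
  have h0p := h.wpos
  rw [← hh0] at h0p
  have hm : MeasurableSet {x : ℝ | ρ < |x|} := measurableSet_lt measurable_const measurable_norm
  have hα := h.α0
  have hα1 := h.α1
  have hρ := h.ρ0
  have hρ1 := h.ρ1
  have hC := h.Cpos
  set N1 := ∫ x in {x : ℝ | ρ < |x|}ᶜ, ‖W x‖
  set N2 := ∫ x in {x : ℝ | ρ < |x|}ᶜ, |x| / ρ * ‖w0 x‖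
  set N3 := ‖∫ x in {x : ℝ | ρ < |x|}, w0 x‖
  have hN1 : 0 ≤ N1 := integral_nonneg fun x => norm_nonneg _
  have hN2 : 0 ≤ N2 := integral_nonneg fun x => by positivity
  have iW : Integrable (fun x => ‖W x‖) (volume.restrict {x : ℝ | ρ < |x|}ᶜ) := by
    have := (h.Wint 1).norm
    simp at this
    exact this.integrableOn
  have iw0 : Integrable (fun x => |x| / ρ * ‖w0 x‖) (volume.restrict {x : ℝ | ρ < |x|}ᶜ) := by
    have := ((h.w0int Polynomial.X).norm.const_mul (1/ρ)).integrableOn (s := {x : ℝ | ρ < |x|}ᶜ)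
    simp at this
    exact this.congr (Eventually.of_forall fun x => by simp only; ring)
  set N := N1 + ‖κ0‖ * ‖κ1‖ + ‖κ0‖ * (2 * N2) + ‖κ0‖ * N3 with hN
  have hNn : 0 ≤ N := by positivity
  refine ⟨C * (√h0 * ((2 / α + 9) * 4)) + N * 2 * (√(8 / ρ) / √h0) + 1, by positivity, fun n hn1 q hq => ?_⟩
  have hn : (1:ℝ) ≤ n := by exact_mod_cast hn1
  have hnp : (0:ℝ) < n := by linarith
  have hnf := nf_pos n
  rw [h.split n q hq]
  set f := q * mp (Complex.I * α) n with hf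
  have fp := h.far_part n q
  rw [← hf, ← hh0] at fp
  -- near
  set t := tau (ρ + α) n
  set M := √(nsq w q / h0) * √(8 / ρ * (n:ℝ) ^ (2 * ρ)) with hM
  have hnα : ‖Complex.I * (α:ℂ)‖ = α := by simp [abs_of_pos hα]
  have ht0 : 0 ≤ t := tau_nonneg (by positivity) n
  have hM0 : 0 ≤ M := by positivity
  have near : ∀ x : ℝ, |x| ≤ ρ → ‖f.eval (x:ℂ)‖ ≤ t * M ∧ ‖f.eval (x:ℂ) - f.eval 0‖ ≤ 2 * (|x| / ρ) * (t * M) := by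
    intro x hx
    obtain ⟨a1, a2⟩ := mp_near (Complex.I * α) hρ x hx n
    rw [hnα] at a1 a2
    obtain ⟨b1, b2⟩ := h.adm.near_bound h.wpos hρ (by linarith) n q hq x hx
    obtain ⟨b3, -⟩ := h.adm.near_bound h.wpos hρ (by linarith) n q hq 0 (by simpa using hρ.le)
    rw [← hh0, ← hM] at b1 b2 b3
    simp only [Complex.ofReal_zero] at b3
    rw [hf, Polynomial.eval_mul, Polynomial.eval_mul, mp_eval, mp_eval, zero_add]
    constructor
    · rw [norm_mul, mul_comm]; gcongr
    · have e : q.eval (x:ℂ) * mpe (x + Complex.I * α) n - q.eval 0 * mpe (Complex.I * α) n =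
        (q.eval (x:ℂ) - q.eval 0) * mpe (x + Complex.I * α) n + q.eval 0 * (mpe (x + Complex.I * α) n - mpe (Complex.I * α) n) := by ring
      rw [e]
      refine (norm_add_le _ _).trans ?_
      rw [norm_mul, norm_mul]
      calc _ ≤ (|x| / ρ * M) * t + M * (|x| / ρ * t) := by gcongr
        _ = _ := by ring
  have hcm : ∀ x ∈ {x : ℝ | ρ < |x|}ᶜ, |x| ≤ ρ := fun x hx => not_lt.1 hx
  have n0 : ‖f.eval 0‖ ≤ t * M := by simpa using (near 0 (by simpa using hρ.le)).1
  have n1 : ‖∫ x in {x : ℝ | ρ < |x|}ᶜ, f.eval (x : ℂ) * W x‖ ≤ N1 * (t * M) := by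
    calc _ ≤ ∫ x in {x : ℝ | ρ < |x|}ᶜ, (t * M) * ‖W x‖ := by
          refine norm_integral_le_of_norm_le (iW.const_mul _) ((ae_restrict_iff' hm.compl).2 (Eventually.of_forall fun x hx => ?_))
          rw [norm_mul]; gcongr; exact (near x (hcm x hx)).1
      _ = _ := by rw [integral_const_mul]; ring
  have n2 : ‖∫ x in {x : ℝ | ρ < |x|}ᶜ, (f.eval (x : ℂ) - f.eval 0) * w0 x‖ ≤ 2 * N2 * (t * M) := by
    calc _ ≤ ∫ x in {x : ℝ | ρ < |x|}ᶜ, (2 * (t * M)) * (|x| / ρ * ‖w0 x‖) := by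
          refine norm_integral_le_of_norm_le (iw0.const_mul _) ((ae_restrict_iff' hm.compl).2 (Eventually.of_forall fun x hx => ?_))
          rw [norm_mul]
          refine (mul_le_mul_of_nonneg_right (near x (hcm x hx)).2 (norm_nonneg _)).trans_eq (by ring)
      _ = _ := by rw [integral_const_mul]; ring
  have tot : ∀ A B D E F : ℂ, ‖A + B - κ0 * D - κ0 * E + κ0 * F‖ ≤ ‖A‖ + ‖B‖ + ‖κ0‖ * ‖D‖ + ‖κ0‖ * ‖E‖ + ‖κ0‖ * ‖F‖ := by
    intro A B D E F
    refine (norm_add_le _ _).trans ?_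
    rw [norm_mul]; gcongr
    refine (norm_sub_le _ _).trans ?_
    rw [norm_mul]; gcongr
    refine (norm_sub_le _ _).trans ?_
    rw [norm_mul]; gcongr
    exact norm_add_le _ _
  refine (tot _ _ _ _ _).trans ?_
  have step : ‖∫ x in {x : ℝ | ρ < |x|}, f.eval (x : ℂ) * (W x - κ0 * w0 x)‖
      + ‖∫ x in {x : ℝ | ρ < |x|}ᶜ, f.eval (x : ℂ) * W x‖ + ‖κ0‖ * ‖κ1 * f.eval 0‖
      + ‖κ0‖ * ‖∫ x in {x : ℝ | ρ < |x|}ᶜ, (f.eval (x : ℂ) - f.eval 0) * w0 x‖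
      + ‖κ0‖ * ‖f.eval 0 * ∫ x in {x : ℝ | ρ < |x|}, w0 x‖
      ≤ C * (√(h0 * ((2 / α + 9) * 4 * ((n:ℝ) + 1) ^ (α - 3/4) / nf n) ^ 2) * √(nsq w q)) + N * (t * M) := by
    have e : N * (t * M) = N1 * (t * M) + ‖κ0‖ * (‖κ1‖ * (t * M)) + ‖κ0‖ * (2 * N2 * (t * M)) + ‖κ0‖ * ((t * M) * N3) := by
      rw [hN]; ring
    rw [e, norm_mul, norm_mul]
    have a1 : ‖κ0‖ * (‖κ1‖ * ‖f.eval 0‖) ≤ ‖κ0‖ * (‖κ1‖ * (t * M)) := by gcongr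
    have a2 : ‖κ0‖ * ‖∫ x in {x : ℝ | ρ < |x|}ᶜ, (f.eval (x : ℂ) - f.eval 0) * w0 x‖ ≤ ‖κ0‖ * (2 * N2 * (t * M)) := by gcongr
    have a3 : ‖κ0‖ * (‖f.eval 0‖ * N3) ≤ ‖κ0‖ * ((t * M) * N3) := by gcongr
    linarith
  refine step.trans ?_
  -- size estimates
  have s1 : √(h0 * ((2 / α + 9) * 4 * ((n:ℝ) + 1) ^ (α - 3/4) / nf n) ^ 2) ≤
      √h0 * ((2 / α + 9) * 4) * ((n:ℝ) ^ (2 * ρ + α - 3/4) / nf n) := by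
    rw [Real.sqrt_mul h0p.le, Real.sqrt_sq (by positivity)]
    have : ((n:ℝ) + 1) ^ (α - 3/4) ≤ (n:ℝ) ^ (2 * ρ + α - 3/4) :=
      (rpow_le_rpow_of_nonpos hnp (by linarith) (by linarith)).trans
        (rpow_le_rpow_of_exponent_le hn (by linarith))
    calc _ ≤ √h0 * ((2 / α + 9) * 4 * (n:ℝ) ^ (2 * ρ + α - 3/4) / nf n) := by gcongr
      _ = _ := by ring
  have s2 : t ≤ 2 * ((n:ℝ) ^ (ρ + α - 3/4) / nf n) := by
    have := tau_bound (c := ρ + α) (by positivity) (by linarith) n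
    have h2 : ((n:ℝ) + 1/2) ^ (ρ + α - 3/4) ≤ (n:ℝ) ^ (ρ + α - 3/4) :=
      rpow_le_rpow_of_nonpos hnp (by linarith) (by linarith)
    rw [← mul_div_assoc, le_div_iff₀ hnf]
    linarith
  have s3 : M = √(8 / ρ) / √h0 * (n:ℝ) ^ ρ * √(nsq w q) := by
    rw [hM, Real.sqrt_div' _ h0p.le, Real.sqrt_mul (by positivity)]
    have : √((n:ℝ) ^ (2 * ρ)) = (n:ℝ) ^ ρ := by
      rw [Real.sqrt_eq_rpow, ← rpow_mul hnp.le]; congr 1; ring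
    rw [this]; ring
  have s4 : t * M ≤ 2 * (√(8 / ρ) / √h0) * ((n:ℝ) ^ (2 * ρ + α - 3/4) / nf n) * √(nsq w q) := by
    rw [s3]
    calc _ ≤ (2 * ((n:ℝ) ^ (ρ + α - 3/4) / nf n)) * (√(8 / ρ) / √h0 * (n:ℝ) ^ ρ * √(nsq w q)) := by gcongr
      _ = 2 * (√(8 / ρ) / √h0) * (((n:ℝ) ^ (ρ + α - 3/4) * (n:ℝ) ^ ρ) / nf n) * √(nsq w q) := by ring
      _ = _ := by rw [← rpow_add hnp]; ring_nf
  have pz : 0 ≤ ((n:ℝ) ^ (2 * ρ + α - 3/4) / nf n) * √(nsq w q) := by positivity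
  calc _ ≤ C * (√h0 * ((2 / α + 9) * 4) * ((n:ℝ) ^ (2 * ρ + α - 3/4) / nf n) * √(nsq w q))
        + N * (2 * (√(8 / ρ) / √h0) * ((n:ℝ) ^ (2 * ρ + α - 3/4) / nf n) * √(nsq w q)) := by gcongr
    _ ≤ _ := by linarith

lemma nsq_pconj (q : Polynomial ℂ) : nsq w (pconj q) = nsq w q := by
  unfold nsq
  congr 1; ext x; rw [pconj_eval]; simp

lemma Cmp.Wfun (h : Cmp α ρ w W w0 κ0 κ1 c C) (p q : Polynomial ℂ) (n : ℕ) (hq : q.degree < (n : ℕ))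
    (hp : ∀ j < n, ∫ x : ℝ, p.eval (x : ℂ) * (x:ℂ) ^ j * W x = 0) :
    ∫ x : ℝ, (q * p).eval (x : ℂ) * W x = 0 := by
  by_cases h0 : q = 0
  · simp [h0]
  have hq' : q.natDegree < n := (Polynomial.natDegree_lt_iff_degree_lt h0).2 hq
  have e : ∀ x : ℝ, (q * p).eval (x : ℂ) * W x = ∑ j ∈ Finset.range n, q.coeff j * (p.eval (x : ℂ) * (x:ℂ) ^ j * W x) := by
    intro x
    rw [Polynomial.eval_mul, Polynomial.eval_eq_sum_range' hq', Finset.sum_mul, Finset.sum_mul]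
    exact Finset.sum_congr rfl fun j _ => by ring
  simp only [e]
  rw [integral_finsetSum]
  · refine Finset.sum_eq_zero fun j hj => ?_
    rw [integral_const_mul, hp j (Finset.mem_range.1 hj), mul_zero]
  · intro j _
    have := h.Wint (p * Polynomial.X ^ j)
    simp only [Polynomial.eval_mul, Polynomial.eval_pow, Polynomial.eval_X] at this
    exact this.const_mul _

lemma Cmp.diff_bound (h : Cmp α ρ w W w0 κ0 κ1 c C) : ∃ C' > 0, ∀ n : ℕ, 1 ≤ n → ∀ p : Polynomial ℂ, p.Monic → p.natDegree = n →
    (∀ j < n, ∫ x : ℝ, p.eval (x : ℂ) * (x:ℂ) ^ j * W x = 0) →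
    (p - mp (Complex.I * α) n).degree < (n : ℕ) ∧
    √(nsq w (p - mp (Complex.I * α) n)) ≤ C' * ((n:ℝ) ^ (2 * ρ + α - 3/4) / nf n) := by
  obtain ⟨C1, hC1, hb⟩ := h.bilin_bound
  have hc := h.cpos
  refine ⟨C1 / c, by positivity, fun n hn p hpm hpd hpo => ?_⟩
  obtain ⟨hm, hd⟩ := mp_monic_deg (Complex.I * α) n
  set e := p - mp (Complex.I * α) n with he
  have hdeg : e.degree < (n : ℕ) := by
    have e1 : p.degree = (n : ℕ) := by rw [Polynomial.degree_eq_natDegree hpm.ne_zero, hpd]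
    have e2 : (mp (Complex.I * α) n).degree = (n : ℕ) := by rw [Polynomial.degree_eq_natDegree hm.ne_zero, hd]
    rw [← e1]
    exact Polynomial.degree_sub_lt_left (by rw [e1, e2]) hpm.ne_zero (by rw [hpm.leadingCoeff, hm.leadingCoeff])
  refine ⟨hdeg, ?_⟩
  have hdeg' : (pconj e).degree < (n : ℕ) := by rwa [pconj_degree]
  have h1 := h.coer e
  have z := h.Wfun p (pconj e) n hdeg' hpo
  have i1 := h.Wint (pconj e * p)
  have i2 := h.Wint (pconj e * mp (Complex.I * α) n)
  have e3 : ∫ x : ℝ, (e * pconj e).eval (x : ℂ) * W x = - ∫ x : ℝ, (pconj e * mp (Complex.I * α) n).eval (x : ℂ) * W x := by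
    rw [← zero_sub, ← z, ← integral_sub i1 i2]
    congr 1; ext x
    simp only [Polynomial.eval_mul, he, Polynomial.eval_sub]; ring
  rw [e3, norm_neg] at h1
  have h2 := hb n hn (pconj e) hdeg'
  rw [nsq_pconj] at h2
  have h3 := h1.trans h2
  set s := √(nsq w e) with hs
  have hsn : nsq w e = s * s := (Real.mul_self_sqrt (nsq_nonneg h.adm e)).symm
  rw [hsn] at h3
  have hs0 : 0 ≤ s := Real.sqrt_nonneg _
  rw [div_mul_eq_mul_div, le_div_iff₀ hc]
  rcases hs0.eq_or_lt with h4 | h4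
  · rw [← h4, zero_mul]; have := nf_pos n; positivity
  · exact le_of_mul_le_mul_right (by linarith : s * c * s ≤ _) h4

end BOP

namespace BOP

lemma sinh_subst (b : ℝ) (hb : 0 < b) :
    IntegrableOn (fun t : ℝ => Real.exp (-b * Real.sinh (t / 2) ^ 2) * Real.cosh (t / 2)) (Set.Ioi 0) ∧
    ∫ t in Set.Ioi (0:ℝ), Real.exp (-b * Real.sinh (t / 2) ^ 2) * Real.cosh (t / 2) = √(π / b) := by
  have him : (fun t : ℝ => Real.sinh (t / 2)) '' Set.Ioi 0 = Set.Ioi 0 := by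
    ext u
    simp only [Set.mem_image, Set.mem_Ioi]
    constructor
    · rintro ⟨t, ht, rfl⟩
      exact Real.sinh_pos_iff.2 (by linarith)
    · intro hu
      obtain ⟨s, hs⟩ := Real.sinh_surjective u
      refine ⟨2 * s, ?_, by rw [mul_div_cancel_left₀ _ (two_ne_zero)]; exact hs⟩
      have : 0 < s := Real.sinh_pos_iff.1 (by rw [hs]; exact hu)
      linarith
  have hinj : Set.InjOn (fun t : ℝ => Real.sinh (t / 2)) (Set.Ioi 0) := by
    intro a _ c _ h
    have := Real.sinh_injective h
    linarith
  have hder : ∀ t ∈ Set.Ioi (0:ℝ), HasDerivWithinAt (fun t : ℝ => Real.sinh (t / 2)) (Real.cosh (t / 2) * (1 / 2)) (Set.Ioi 0) t := by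
    intro t _
    exact ((Real.hasDerivAt_sinh _).comp t ((hasDerivAt_id t).div_const 2)).hasDerivWithinAt
  have h1 := integral_image_eq_integral_abs_deriv_smul measurableSet_Ioi hder hinj (fun u => Real.exp (-b * u ^ 2))
  have h2 := integrableOn_image_iff_integrableOn_abs_deriv_smul measurableSet_Ioi hder hinj (fun u => Real.exp (-b * u ^ 2))
  rw [him] at h1 h2
  have h3 := h2.1 (integrable_exp_neg_mul_sq hb).integrableOn
  rw [integral_gaussian_Ioi] at h1
  have e : ∀ t : ℝ, |Real.cosh (t / 2) * (1 / 2)| • Real.exp (-b * Real.sinh (t / 2) ^ 2) =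
      (Real.exp (-b * Real.sinh (t / 2) ^ 2) * Real.cosh (t / 2)) * (1/2) := by
    intro t
    rw [abs_of_pos (by have := Real.cosh_pos (t/2); positivity), smul_eq_mul]; ring
  simp only [e] at h1 h3
  refine ⟨?_, ?_⟩
  · refine (h3.mul_const 2).congr (Eventually.of_forall fun t => ?_)
    simp only []; ring
  · rw [integral_mul_const] at h1
    linarith

/-- modified Bessel function `K_ν` -/
noncomputable def bK (ν y : ℝ) : ℝ :=
  ∫ t in Set.Ioi (0:ℝ), Real.exp (-y * Real.cosh t) * Real.cosh (ν * t)

lemma cosh_half (t : ℝ) : Real.cosh t = 1 + 2 * Real.sinh (t / 2) ^ 2 := by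
  have h := Real.cosh_two_mul (t / 2)
  have h2 := Real.cosh_sq (t / 2)
  rw [mul_div_cancel₀ _ (two_ne_zero)] at h
  rw [h, h2]; ring

lemma bK_int {ν y : ℝ} (h0 : 0 ≤ ν) (h1 : ν ≤ 1 / 2) (hy : 0 < y) :
    IntegrableOn (fun t => Real.exp (-y * Real.cosh t) * Real.cosh (ν * t)) (Set.Ioi 0) := by
  have hi := (sinh_subst (2 * y) (by linarith)).1.const_mul (Real.exp (-y))
  refine Integrable.mono' hi (by fun_prop) ?_
  filter_upwards [ae_restrict_mem measurableSet_Ioi] with t ht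
  have ht : 0 < t := ht
  rw [Real.norm_of_nonneg (mul_nonneg (Real.exp_pos _).le (Real.cosh_pos _).le), cosh_half t, ← mul_assoc, ← Real.exp_add]
  gcongr
  · apply le_of_eq; ring
  · rw [Real.cosh_le_cosh, abs_of_nonneg (by positivity), abs_of_nonneg (by positivity)]
    nlinarith

lemma bK_upper {ν y : ℝ} (h0 : 0 ≤ ν) (h1 : ν ≤ 1 / 2) (hy : 0 < y) :
    bK ν y ≤ √(π / (2 * y)) * Real.exp (-y) := by
  have hs := sinh_subst (2 * y) (by linarith)
  rw [← hs.2, mul_comm, ← integral_const_mul]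
  unfold bK
  refine setIntegral_mono_on (bK_int h0 h1 hy) (hs.1.const_mul _) measurableSet_Ioi ?_
  intro t ht
  have ht : 0 < t := ht
  rw [cosh_half t, ← mul_assoc, ← Real.exp_add]
  gcongr
  · apply le_of_eq; ring
  · rw [Real.cosh_le_cosh, abs_of_nonneg (by positivity), abs_of_nonneg (by positivity)]
    nlinarith

lemma bK_lower {ν y : ℝ} (h0 : 0 ≤ ν) (h1 : ν ≤ 1 / 2) (hy : 0 < y) :
    √(π / (2 * y)) * Real.exp (-y) * (1 - 1 / y) ≤ bK ν y := by
  have hs := sinh_subst (2 * y) (by linarith)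
  have hs' := sinh_subst y hy
  have key : Real.exp (-y) * √(π / (2 * y)) - Real.exp (-y) * (1 / (2 * y)) * √(π / y) ≤ bK ν y := by
    rw [← hs.2, ← hs'.2, ← integral_const_mul, ← integral_const_mul, ← integral_sub (hs.1.const_mul _) (hs'.1.const_mul _)]
    unfold bK
    refine setIntegral_mono_on ((hs.1.const_mul _).sub (hs'.1.const_mul _)) (bK_int h0 h1 hy)  measurableSet_Ioi ?_
    intro t ht
    set s := Real.sinh (t / 2) ^ 2 with hsd
    set c := Real.cosh (t / 2) with hc
    have hs0 : 0 ≤ s := sq_nonneg _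
    have hc1 : 1 ≤ c := Real.one_le_cosh _
    have hcs : c ^ 2 = s + 1 := Real.cosh_sq _
    have hcc : c * (1 - s / 2) ≤ 1 := by
      have : c ≤ 1 + s / 2 := by nlinarith
      by_cases h : 1 - s / 2 ≤ 0
      · nlinarith
      · push Not at h
        nlinarith
    have h1c := Real.one_le_cosh (ν * t)
    have hexp : y * s ≤ Real.exp (y * s) := by linarith [Real.add_one_le_exp (y * s)]
    have e1 : Real.exp (-y * s) = Real.exp (-(2 * y) * s) * Real.exp (y * s) := by
      rw [← Real.exp_add]; congr 1; ring
    have e2 : Real.exp (-y * Real.cosh t) = Real.exp (-y) * Real.exp (-(2 * y) * s) := by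
      rw [cosh_half, ← Real.exp_add]; congr 1; ring
    rw [e1, e2]
    have hA := mul_pos (Real.exp_pos (-y)) (Real.exp_pos (-(2 * y) * s))
    set A := Real.exp (-y) * Real.exp (-(2 * y) * s)
    have h5 : s ≤ 1 / y * Real.exp (y * s) := by
      rw [one_div, ← div_eq_inv_mul, le_div_iff₀ hy]; linarith
    calc _ = A * (c * (1 - 1/2 * (1 / y * Real.exp (y * s)))) := by
            simp only [A]; field_simp
      _ ≤ A * (c * (1 - s / 2)) := by
            have : c * (1 - 1/2 * (1 / y * Real.exp (y * s))) ≤ c * (1 - s / 2) := by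
              apply mul_le_mul_of_nonneg_left _ (by linarith); linarith
            exact mul_le_mul_of_nonneg_left this hA.le
      _ ≤ A * Real.cosh (ν * t) := mul_le_mul_of_nonneg_left (by linarith) hA.le
  refine le_trans ?_ key
  have h6 : √(π / y) ≤ 2 * √(π / (2 * y)) := by
    rw [show (2:ℝ) = √4 by rw [show (4:ℝ) = 2 ^ 2 by norm_num, Real.sqrt_sq (by norm_num)], ← Real.sqrt_mul (by norm_num)]
    rw [show √4 = (2:ℝ) by rw [show (4:ℝ) = 2 ^ 2 by norm_num, Real.sqrt_sq (by norm_num)]]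
    apply Real.sqrt_le_sqrt
    rw [show 4 * (π / (2 * y)) = 2 * (π / y) by field_simp; norm_num]
    have : 0 < π / y := by positivity
    linarith
  have h7 : 0 ≤ Real.exp (-y) * (1 / (2 * y)) := by positivity
  have h8 := mul_le_mul_of_nonneg_left h6 h7
  have h9 : Real.exp (-y) * (1 / (2 * y)) * (2 * √(π / (2 * y))) = √(π / (2 * y)) * Real.exp (-y) * (1 / y) := by
    field_simp
  linarith

lemma bK_approx {ν y : ℝ} (h0 : 0 ≤ ν) (h1 : ν ≤ 1 / 2) (hy : 0 < y) :
    |bK ν y - √(π / (2 * y)) * Real.exp (-y)| ≤ √(π / (2 * y)) * Real.exp (-y) / y := by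
  have hu := bK_upper h0 h1 hy
  have hl := bK_lower h0 h1 hy
  rw [abs_le]
  have : 0 ≤ √(π / (2 * y)) * Real.exp (-y) / y := by positivity
  have e : √(π / (2 * y)) * Real.exp (-y) * (1 - 1 / y) = √(π / (2 * y)) * Real.exp (-y) - √(π / (2 * y)) * Real.exp (-y) / y := by ring
  constructor <;> linarith

lemma bK_anti {ν : ℝ} (h0 : 0 ≤ ν) (h1 : ν ≤ 1 / 2) : AntitoneOn (bK ν) (Set.Ioi 0) := by
  intro x hx y hy hxy
  refine setIntegral_mono_on (bK_int h0 h1 hy) (bK_int h0 h1 hx) measurableSet_Ioi ?_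
  intro t _
  have := Real.cosh_pos t
  have := Real.cosh_pos (ν * t)
  gcongr

lemma bK_nonneg (ν y : ℝ) : 0 ≤ bK ν y :=
  setIntegral_nonneg measurableSet_Ioi fun t _ => by
    have := Real.cosh_pos (ν * t)
    positivity

lemma bK_lower' {ν : ℝ} (h0 : 0 ≤ ν) (h1 : ν ≤ 1 / 2) :
    ∃ c > 0, ∀ y > 0, c * (Real.exp (-y) / √(1 + y)) ≤ bK ν y := by
  refine ⟨1/2 * √(π / 4) * Real.exp (-2), by positivity, ?_⟩
  intro y hy
  have h2 := bK_lower h0 h1 (y := 2) (by norm_num)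
  rcases le_total 2 y with h | h
  · have hl := bK_lower h0 h1 hy
    refine le_trans ?_ hl
    have hq : 1 / 2 ≤ 1 - 1 / y := by
      have : 1 / y ≤ 1 / 2 := one_div_le_one_div_of_le (by norm_num) h
      linarith
    have hr : 1 / √(1 + y) ≤ √(π / (2 * y)) := by
      rw [← Real.sqrt_one, ← Real.sqrt_div (by norm_num), Real.sqrt_one]
      apply Real.sqrt_le_sqrt
      rw [div_le_div_iff₀ (by positivity) (by positivity)]
      nlinarith [Real.pi_gt_three]
    have hs : √(π / 4) ≤ 1 := by
      rw [Real.sqrt_le_iff]; constructor <;> linarith [Real.pi_le_four]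
    have he : Real.exp (-2) ≤ 1 := Real.exp_le_one_iff.2 (by norm_num)
    calc 1/2 * √(π / 4) * Real.exp (-2) * (Real.exp (-y) / √(1 + y))
        ≤ 1/2 * 1 * 1 * (Real.exp (-y) / √(1 + y)) := by gcongr
      _ = (1 / √(1 + y)) * Real.exp (-y) * (1/2) := by ring
      _ ≤ _ := by gcongr
  · refine le_trans ?_ (bK_anti h0 h1 hy (by norm_num : (2:ℝ) ∈ Set.Ioi 0) h)
    refine le_trans ?_ h2
    have h3 : Real.exp (-y) / √(1 + y) ≤ 1 := by
      rw [div_le_one (by positivity)]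
      have : Real.exp (-y) ≤ 1 := Real.exp_le_one_iff.2 (by linarith)
      have : 1 ≤ √(1 + y) := by rw [Real.one_le_sqrt]; linarith
      linarith
    calc _ ≤ 1/2 * √(π / 4) * Real.exp (-2) * 1 := by gcongr
      _ = _ := by norm_num; ring

lemma bK_meas {ν : ℝ} (h0 : 0 ≤ ν) (h1 : ν ≤ 1 / 2) :
    AEMeasurable (bK ν) (volume.restrict (Set.Ioi 0)) :=
  aemeasurable_restrict_of_antitoneOn measurableSet_Ioi (bK_anti h0 h1)

end BOP

namespace BOP

lemma cpow_half_re (v : ℂ) : 0 ≤ (v ^ ((1:ℂ)/2)).re := by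
  by_cases hv : v = 0
  · subst hv; simp
  rw [Complex.cpow_def_of_ne_zero hv, Complex.exp_re]
  have h1 : (Complex.log v * (1/2)).im = Complex.arg v / 2 := by
    rw [show (1/2 : ℂ) = ((1/2:ℝ):ℂ) by push_cast; rfl, Complex.im_mul_ofReal, Complex.log_im]; ring
  rw [h1]
  have := Complex.neg_pi_lt_arg v
  have := Complex.arg_le_pi v
  exact mul_nonneg (Real.exp_pos _).le (Real.cos_nonneg_of_neg_pi_div_two_le_of_le (by linarith) (by linarith))

lemma cpow_half_sq (v : ℂ) : (v ^ ((1:ℂ)/2)) ^ 2 = v := by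
  rw [one_div]; exact Complex.cpow_nat_inv_pow v two_ne_zero

lemma cpow_half_im {v : ℂ} (hv : 0 ≤ v.re) : |(v ^ ((1:ℂ)/2)).im| ≤ (v ^ ((1:ℂ)/2)).re := by
  have h1 := cpow_half_re v
  have h2 := congrArg Complex.re (cpow_half_sq v)
  rw [pow_two, Complex.mul_re] at h2
  apply abs_le_of_sq_le_sq _ h1
  nlinarith

/-- the elementary factor -/
noncomputable def gfac (v : ℂ) : ℂ := (v + 1/2) / (v ^ ((1:ℂ)/2) * (v + 1) ^ ((1:ℂ)/2))

lemma gfac_re {v : ℂ} (hv : 0 ≤ v.re) (h0 : v ≠ 0) : 0 ≤ (gfac v).re := by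
  have h1 : v + 1 ≠ 0 := by
    intro h; have := congrArg Complex.re h; simp at this; linarith
  have a2 := cpow_half_sq v
  have b2 := cpow_half_sq (v+1)
  have ai := cpow_half_im hv
  have bi := cpow_half_im (v := v + 1) (by simp; linarith)
  unfold gfac
  set a := v ^ ((1:ℂ)/2)
  set b := (v+1) ^ ((1:ℂ)/2)
  have ha : a ≠ 0 := by rintro h; rw [h] at a2; simp at a2; exact h0 a2.symm
  have hb : b ≠ 0 := by rintro h; rw [h] at b2; simp at b2; exact h1 b2.symm
  have e : (v + 1/2) / (a * b) = (1/2 : ℝ) * (a / b + b / a) := by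
    have : v + 1/2 = (1/2) * (a ^ 2 + b ^ 2) := by rw [a2, b2]; ring
    rw [this]; push_cast; field_simp
  rw [e, Complex.re_ofReal_mul, Complex.add_re, Complex.div_re, Complex.div_re]
  have hab : 0 ≤ a.re * b.re + a.im * b.im := by
    have h1 := abs_nonneg a.im
    have h2 := abs_nonneg b.im
    have : |a.im * b.im| ≤ a.re * b.re := by
      rw [abs_mul]; exact mul_le_mul ai bi h2 (h1.trans ai)
    linarith [neg_abs_le (a.im * b.im)]
  have na := Complex.normSq_nonneg a
  have nb := Complex.normSq_nonneg b
  rw [← add_div, ← add_div]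
  have : 0 ≤ (a.re * b.re + a.im * b.im) / Complex.normSq b := div_nonneg hab nb
  have : 0 ≤ (b.re * a.re + b.im * a.im) / Complex.normSq a := div_nonneg (by linarith) na
  linarith

lemma gfac_bound {v : ℂ} (hv : 0 ≤ v.re) (h0 : v ≠ 0) : ‖gfac v - 1‖ ≤ 1 / ‖v‖ ^ 2 := by
  have hr := gfac_re hv h0
  have h1 : v + 1 ≠ 0 := by
    intro h; have := congrArg Complex.re h; simp at this; linarith
  have e : (gfac v - 1) * (gfac v + 1) = (1/4) / (v * (v+1)) := by
    rw [show (gfac v - 1) * (gfac v + 1) = gfac v ^ 2 - 1 by ring, gfac, div_pow, mul_pow, cpow_half_sq, cpow_half_sq]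
    field_simp; ring
  have h2 : 1 ≤ ‖gfac v + 1‖ := by
    refine le_trans ?_ (Complex.re_le_norm _)
    simp; exact hr
  have h3 : ‖v‖ ≤ ‖v + 1‖ := by
    rw [Complex.norm_def, Complex.norm_def]
    apply Real.sqrt_le_sqrt
    simp [Complex.normSq_apply]; nlinarith
  have hvp : 0 < ‖v‖ := norm_pos_iff.2 h0
  calc ‖gfac v - 1‖ ≤ ‖gfac v - 1‖ * ‖gfac v + 1‖ := le_mul_of_one_le_right (norm_nonneg _) h2
    _ = (1/4) / (‖v‖ * ‖v+1‖) := by rw [← norm_mul, e]; simp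
    _ ≤ 1 / (‖v‖ * ‖v‖) := by gcongr; norm_num
    _ = _ := by rw [pow_two]

lemma gfac_sum {z : ℂ} {ρ : ℝ} (hρ : 0 < ρ) (hz : 0 ≤ z.re) (hzρ : ρ ≤ ‖z‖) (n : ℕ) :
    ∑ j ∈ Finset.range n, ‖gfac (z + j) - 1‖ ≤ (2 + 2 / ρ) / ‖z‖ := by
  have hm : 0 < ‖z‖ := by linarith
  have hz0 : z ≠ 0 := norm_pos_iff.1 hm
  set m := ‖z‖ with hmd
  have hj : ∀ j : ℕ, ‖gfac (z + j) - 1‖ ≤ 2 / (m + j) ^ 2 := by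
    intro j
    have h0 : z + j ≠ 0 := by
      intro h
      have h1 := congrArg Complex.re h
      have h2 := congrArg Complex.im h
      simp at h1 h2
      have hj0 : (0:ℝ) ≤ j := by positivity
      exact hz0 (Complex.ext (by simp; linarith) (by simpa using h2))
    refine (gfac_bound (by simp; positivity) h0).trans ?_
    have : (m + j) ^ 2 ≤ 2 * ‖z + j‖ ^ 2 := by
      have e1 : ‖z + j‖ ^ 2 = (z.re + j) ^ 2 + z.im ^ 2 := by
        rw [← Complex.normSq_eq_norm_sq, Complex.normSq_apply]; simp; ring
      have e2 : m ^ 2 = z.re ^ 2 + z.im ^ 2 := by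
        rw [hmd, ← Complex.normSq_eq_norm_sq, Complex.normSq_apply]; ring
      have hj0 : (0:ℝ) ≤ j := by positivity
      nlinarith [mul_nonneg hz hj0, sq_nonneg (m - j)]
    have hp : 0 < ‖z + j‖ := norm_pos_iff.2 h0
    rw [div_le_div_iff₀ (by positivity) (by positivity)]; linarith
  have key : ∀ n : ℕ, ∑ j ∈ Finset.range (n+1), ‖gfac (z + j) - 1‖ ≤ 2 / m ^ 2 + 2 / m - 2 / (m + n) := by
    intro n
    induction n with
    | zero => have := hj 0; simp at this ⊢; exact this
    | succ n ih =>
      rw [Finset.sum_range_succ]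
      have h1 := hj (n+1)
      have h2 : 2 / (m + ((n+1:ℕ):ℝ)) ^ 2 ≤ 2 / (m + n) - 2 / (m + ((n+1:ℕ):ℝ)) := by
        have hx : 0 < m + (n:ℝ) := by positivity
        push_cast
        rw [← add_assoc, div_sub_div _ _ hx.ne' (by positivity), div_le_div_iff₀ (by positivity) (by positivity)]
        nlinarith
      linarith
  have hmono : ∑ j ∈ Finset.range n, ‖gfac (z + j) - 1‖ ≤ ∑ j ∈ Finset.range (n+1), ‖gfac (z + j) - 1‖ := by
    rw [Finset.sum_range_succ]; linarith [norm_nonneg (gfac (z + n) - 1)]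
  refine (hmono.trans (key n)).trans ?_
  have : 0 ≤ 2 / (m + (n:ℝ)) := by positivity
  have e : (2 + 2/ρ) / m = 2 / m + (2/ρ) / m := by ring
  have : 2 / m ^ 2 ≤ (2 / ρ) / m := by
    rw [pow_two, ← div_div]; gcongr
  rw [e]; linarith

lemma prod_gfac {z : ℂ} (hz : ∀ j : ℕ, z + j ≠ 0) (n : ℕ) :
    ∏ j ∈ Finset.range n, gfac (z + j) =
      (∏ j ∈ Finset.range n, (z + 1/2 + j)) / (∏ j ∈ Finset.range n, (z + j)) * (z ^ ((1:ℂ)/2) / (z + n) ^ ((1:ℂ)/2)) := by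
  have hs : ∀ j : ℕ, (z + j) ^ ((1:ℂ)/2) ≠ 0 := by
    intro j h; have := cpow_half_sq (z + j); rw [h] at this; simp at this; exact hz j this.symm
  induction n with
  | zero =>
    have := hs 0; simp at this
    simp [hz 0]
    rw [div_self]
    simpa using hs 0
  | succ n ih =>
    rw [Finset.prod_range_succ, ih, Finset.prod_range_succ, Finset.prod_range_succ, gfac]
    have h1 := hs n
    have h2 := hs (n+1)
    have h3 := hz n
    have h4 := cpow_half_sq (z + n)
    have hp : ∏ j ∈ Finset.range n, (z + j) ≠ 0 := Finset.prod_ne_zero_iff.2 fun j _ => hz j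
    push_cast at h2 ⊢
    rw [add_assoc z (n:ℂ) 1]
    set A := (z + n) ^ ((1:ℂ)/2)
    set B := (z + (n + 1)) ^ ((1:ℂ)/2)
    rw [← h4]
    field_simp
    rw [h4]
    ring

lemma ofReal_mul_cpow {r : ℝ} (hr : 0 < r) {v : ℂ} (hv : v ≠ 0) (s : ℂ) :
    ((r:ℂ) * v) ^ s = (r:ℂ) ^ s * v ^ s := by
  have hr' : (r:ℂ) ≠ 0 := by exact_mod_cast hr.ne'
  rw [Complex.cpow_def_of_ne_zero (mul_ne_zero hr' hv), Complex.cpow_def_of_ne_zero hr',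
    Complex.cpow_def_of_ne_zero hv, Complex.log_ofReal_mul hr hv, ← Complex.exp_add, ← Complex.ofReal_log hr.le]
  congr 1; ring

lemma gamma_ratio {ρ : ℝ} (hρ : 0 < ρ) : ∃ C > 0, ∀ z : ℂ, 0 ≤ z.re → ρ ≤ ‖z‖ →
    ‖Complex.Gamma z / Complex.Gamma (z + 1/2) * z ^ ((1:ℂ)/2) - 1‖ ≤ C / ‖z‖ := by
  refine ⟨(2 + 2 / ρ) * Real.exp ((2 + 2 / ρ) / ρ), by positivity, ?_⟩
  intro z hz hzρ
  have hm : 0 < ‖z‖ := by linarith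
  have hz0 : z ≠ 0 := norm_pos_iff.1 hm
  have hzj : ∀ j : ℕ, z + j ≠ 0 := by
    intro j h
    have h1 := congrArg Complex.re h
    have h2 := congrArg Complex.im h
    simp at h1 h2
    have hj0 : (0:ℝ) ≤ j := by positivity
    exact hz0 (Complex.ext (by simp; linarith) (by simpa using h2))
  have hzj' : ∀ j : ℕ, z + 1/2 + j ≠ 0 := by
    intro j h
    have h1 := congrArg Complex.re h
    simp at h1
    have hj0 : (0:ℝ) ≤ j := by positivity
    linarith
  have hG : Complex.Gamma (z + 1/2) ≠ 0 := Complex.Gamma_ne_zero_of_re_pos (by simp; linarith)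
  have t1 := (Complex.GammaSeq_tendsto_Gamma z).div (Complex.GammaSeq_tendsto_Gamma (z+1/2)) hG
  -- the correction factor
  have t2 : Tendsto (fun n : ℕ => ((z + (n+1:ℕ)) / (n:ℂ)) ^ ((1:ℂ)/2)) atTop (nhds 1) := by
    have h1 : Tendsto (fun n : ℕ => (z + (n+1:ℕ)) / (n:ℂ)) atTop (nhds 1) := by
      have h2 : Tendsto (fun n : ℕ => (z + 1) / (n:ℂ) + 1) atTop (nhds (0 + 1)) :=
        (tendsto_const_div_atTop_nhds_zero_nat (z+1)).add_const 1
      rw [zero_add] at h2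
      refine h2.congr' ?_
      filter_upwards [eventually_ge_atTop 1] with n hn
      have : (n:ℂ) ≠ 0 := by exact_mod_cast (by omega : n ≠ 0)
      field_simp; push_cast; ring
    have h3 := (h1.cpow (tendsto_const_nhds (x := (1:ℂ)/2)) (by simp))
    simpa using h3
  have t3 : Tendsto (fun n : ℕ => ∏ j ∈ Finset.range (n+1), gfac (z + j)) atTop
      (nhds (Complex.Gamma z / Complex.Gamma (z + 1/2) * z ^ ((1:ℂ)/2))) := by
    have t4 := (t1.mul_const (z ^ ((1:ℂ)/2))).div t2 one_ne_zero
    rw [div_one] at t4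
    refine t4.congr' ?_
    filter_upwards [eventually_ge_atTop 1] with n hn
    have hn0 : (n:ℂ) ≠ 0 := by exact_mod_cast (by omega : n ≠ 0)
    rw [prod_gfac hzj, Pi.div_apply, Pi.div_apply, Complex.GammaSeq, Complex.GammaSeq]
    have e1 : ((z + (n+1:ℕ)) / (n:ℂ)) ^ ((1:ℂ)/2) = (z + (n+1:ℕ)) ^ ((1:ℂ)/2) / (n:ℂ) ^ ((1:ℂ)/2) := by
      have hnp : 0 < (n:ℝ) := by exact_mod_cast (by omega : 0 < n)
      have h5 := ofReal_mul_cpow hnp (v := (z + (n+1:ℕ)) / (n:ℂ)) (div_ne_zero (hzj _) hn0) ((1:ℂ)/2)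
      rw [Complex.ofReal_natCast, mul_div_cancel₀ _ hn0] at h5
      rw [h5, mul_div_cancel_left₀]
      intro h
      have := cpow_half_sq (n:ℂ); rw [h] at this; simp at this; exact hn0 (by exact_mod_cast this.symm)
    have hA : (n:ℂ) ^ ((1:ℂ)/2) ≠ 0 := by
      intro h
      have := cpow_half_sq (n:ℂ); rw [h] at this; simp at this; exact hn0 (by exact_mod_cast this.symm)
    have hB : (z + (n+1:ℕ)) ^ ((1:ℂ)/2) ≠ 0 := by
      intro h
      have := cpow_half_sq (z + (n+1:ℕ)); rw [h] at this; simp at this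
      exact hzj (n+1) (by push_cast; exact this.symm)
    have hC : (n:ℂ) ^ z ≠ 0 := by
      rw [Complex.cpow_def_of_ne_zero hn0]; exact Complex.exp_ne_zero _
    have hf : ((n.factorial : ℕ) : ℂ) ≠ 0 := by exact_mod_cast n.factorial_ne_zero
    have hp1 : ∏ j ∈ Finset.range (n+1), (z + j) ≠ 0 := Finset.prod_ne_zero_iff.2 fun j _ => hzj j
    have hp2 : ∏ j ∈ Finset.range (n+1), (z + 1/2 + j) ≠ 0 := Finset.prod_ne_zero_iff.2 fun j _ => hzj' j
    rw [e1, Complex.cpow_add _ _ hn0]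
    generalize (∏ j ∈ Finset.range (n+1), (z + j)) = p1 at *
    generalize (∏ j ∈ Finset.range (n+1), (z + 1/2 + j)) = p2 at *
    generalize (z + (n+1:ℕ)) ^ ((1:ℂ)/2) = B at *
    generalize (n:ℂ) ^ ((1:ℂ)/2) = A at *
    field_simp
  have hb : ∀ n : ℕ, ‖∏ j ∈ Finset.range (n+1), gfac (z + j) - 1‖ ≤ (2 + 2 / ρ) * Real.exp ((2 + 2 / ρ) / ρ) / ‖z‖ := by
    intro n
    have h1 := Finset.norm_prod_one_add_sub_one_le (Finset.range (n+1)) (fun j : ℕ => gfac (z + j) - 1)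
    simp only [add_sub_cancel] at h1
    refine h1.trans ?_
    have h2 := gfac_sum hρ hz hzρ (n+1)
    set X := (2 + 2 / ρ) / ‖z‖ with hX
    have hX0 : 0 ≤ X := by positivity
    have h3 : Real.exp X - 1 ≤ X * Real.exp X := by
      have := Real.add_one_le_exp (-X)
      have h4 : Real.exp (-X) * Real.exp X = 1 := by rw [← Real.exp_add]; simp
      nlinarith [Real.exp_pos X]
    have h4 : X ≤ (2 + 2 / ρ) / ρ := by rw [hX]; gcongr
    calc _ ≤ Real.exp X - 1 := by gcongr
      _ ≤ X * Real.exp X := h3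
      _ ≤ X * Real.exp ((2 + 2 / ρ) / ρ) := by gcongr
      _ = _ := by rw [hX]; ring
  exact le_of_tendsto ((t3.sub_const 1).norm) (Eventually.of_forall hb)

end BOP

namespace BOP

/-- product of Gamma functions on a vertical line -/
noncomputable def GG (A B x : ℝ) : ℂ := Complex.Gamma (A + Complex.I * x) * Complex.Gamma (B - Complex.I * x)

/-- the model weight -/
noncomputable def w0f (ν x : ℝ) : ℂ := GG (1/4 - ν/2) (1/4 + ν/2) x

lemma three_factor {h q d : ℂ} {A B E x ρ : ℝ} (hρ : 0 < ρ) (hx : ρ ≤ x) (hA : 0 ≤ A) (hB : 0 ≤ B) (hE : 0 ≤ E)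
    (h1 : ‖h - 1‖ ≤ A / x) (h2 : ‖q - 1‖ ≤ B / x) (h3 : ‖d - 1‖ ≤ E / x) :
    ‖h * q * d - 1‖ ≤ ((A * (1 + B / ρ) + B) * (1 + E / ρ) + E) / x := by
  have hx0 : 0 < x := by linarith
  have hq : ‖q‖ ≤ 1 + B / ρ := by
    calc ‖q‖ = ‖1 + (q - 1)‖ := by ring_nf
      _ ≤ ‖(1:ℂ)‖ + ‖q - 1‖ := norm_add_le _ _
      _ ≤ 1 + B / x := by simp; exact h2
      _ ≤ _ := by gcongr
  have hd : ‖d‖ ≤ 1 + E / ρ := by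
    calc ‖d‖ = ‖1 + (d - 1)‖ := by ring_nf
      _ ≤ ‖(1:ℂ)‖ + ‖d - 1‖ := norm_add_le _ _
      _ ≤ 1 + E / x := by simp; exact h3
      _ ≤ _ := by gcongr
  calc ‖h * q * d - 1‖ = ‖((h - 1) * q + (q - 1)) * d + (d - 1)‖ := by ring_nf
    _ ≤ ‖((h - 1) * q + (q - 1)) * d‖ + ‖d - 1‖ := norm_add_le _ _
    _ ≤ (A / x * (1 + B / ρ) + B / x) * (1 + E / ρ) + E / x := by
        rw [norm_mul]
        have : ‖(h - 1) * q + (q - 1)‖ ≤ A / x * (1 + B / ρ) + B / x := by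
          refine (norm_add_le _ _).trans ?_
          rw [norm_mul]; gcongr
        gcongr
    _ = _ := by ring

lemma quot_bound {a x : ℝ} (ha : 0 ≤ a) (hx : 0 < x) :
    ‖(Complex.I * x) ^ ((1:ℂ)/2) / (a + Complex.I * x) ^ ((1:ℂ)/2) - 1‖ ≤ a / x := by
  have hu0 : Complex.I * x ≠ 0 := by simp [hx.ne']
  have hv0 : (a:ℂ) + Complex.I * x ≠ 0 := by
    intro h; have := congrArg Complex.im h; simp at this; linarith
  have a2 := cpow_half_sq (Complex.I * x)
  have b2 := cpow_half_sq (a + Complex.I * x)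
  have ai := cpow_half_im (v := Complex.I * x) (by simp)
  have bi := cpow_half_im (v := a + Complex.I * x) (by simp [ha])
  set A := (Complex.I * x) ^ ((1:ℂ)/2)
  set B := (a + Complex.I * x) ^ ((1:ℂ)/2)
  have hb : B ≠ 0 := by rintro h; rw [h] at b2; simp at b2; exact hv0 b2.symm
  have hre : 0 ≤ (A / B).re := by
    rw [Complex.div_re]
    have h1 := abs_nonneg A.im
    have h2 := abs_nonneg B.im
    have : |A.im * B.im| ≤ A.re * B.re := by
      rw [abs_mul]; exact mul_le_mul ai bi h2 (h1.trans ai)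
    rw [← add_div]
    exact div_nonneg (by linarith [neg_abs_le (A.im * B.im)]) (Complex.normSq_nonneg _)
  have h2 : 1 ≤ ‖A / B + 1‖ := by
    refine le_trans ?_ (Complex.re_le_norm _)
    simp only [Complex.add_re, Complex.one_re]; linarith
  have e : (A / B - 1) * (A / B + 1) = - a / (a + Complex.I * x) := by
    rw [show (A / B - 1) * (A / B + 1) = (A / B) ^ 2 - 1 by ring, div_pow, a2, b2]
    field_simp; ring
  calc ‖A / B - 1‖ ≤ ‖A / B - 1‖ * ‖A / B + 1‖ := le_mul_of_one_le_right (norm_nonneg _) h2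
    _ = a / ‖(a:ℂ) + Complex.I * x‖ := by rw [← norm_mul, e, norm_div, norm_neg, Complex.norm_real, Real.norm_of_nonneg ha]
    _ ≤ a / x := by
      have : x ≤ ‖(a:ℂ) + Complex.I * x‖ := by
        refine le_trans ?_ ((le_abs_self _).trans (Complex.abs_im_le_norm _)); simp
      gcongr

lemma sin_fac (b x : ℝ) :
    Complex.sin (π * (b - Complex.I * x)) =
      (1 - Complex.exp (-(2 * π * b * Complex.I) - 2 * π * x)) * (Complex.exp (Complex.I * π * b) * Complex.exp (π * x)) / (2 * Complex.I) := by
  rw [Complex.sin, ← Complex.exp_add (Complex.I * π * b), sub_mul (1:ℂ), one_mul, ← Complex.exp_add]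
  have e1 : Complex.I * π * b + π * x = (π * (b - Complex.I * x)) * Complex.I := by
    ring_nf; simp; 
  have e2 : -(2 * π * b * Complex.I) - 2 * π * x + (Complex.I * π * b + π * x) = -(π * (b - Complex.I * x)) * Complex.I := by
    ring_nf; simp; ring
  rw [e2, e1]
  rw [eq_div_iff (by simp), div_mul_eq_mul_div, div_eq_iff (by norm_num)]
  ring_nf; simp

lemma sin_fac_bound {b x : ℝ} (hx : 0 < x) :
    ‖1 / (1 - Complex.exp (-(2 * π * b * Complex.I) - 2 * π * x)) - 1‖ ≤ 1 / x := by
  set e := Complex.exp (-(2 * π * b * Complex.I) - 2 * π * x) with he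
  have hn : ‖e‖ = Real.exp (-(2 * π * x)) := by
    rw [he, Complex.norm_exp]; congr 1; simp
  have h1 : 2 * π * x + 1 ≤ Real.exp (2 * π * x) := Real.add_one_le_exp _
  have hr : Real.exp (-(2 * π * x)) * Real.exp (2 * π * x) = 1 := by rw [← Real.exp_add]; simp
  have hpx : 0 < π * x := by positivity
  have h2 : Real.exp (-(2 * π * x)) < 1 := by rw [← Real.exp_zero]; exact Real.exp_lt_exp.2 (by linarith)
  have h3 : 1 - Real.exp (-(2 * π * x)) ≤ ‖1 - e‖ := by
    rw [← hn]; simpa using norm_sub_norm_le 1 e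
  have hne : 1 - e ≠ 0 := by
    intro h; rw [h] at h3; simp at h3; linarith
  rw [show 1 / (1 - e) - 1 = e / (1 - e) by field_simp; ring, norm_div, hn]
  have h4 : 0 < 1 - Real.exp (-(2 * π * x)) := by linarith
  calc _ ≤ Real.exp (-(2 * π * x)) / (1 - Real.exp (-(2 * π * x))) := by gcongr
    _ ≤ 1 / x := by
      rw [div_le_div_iff₀ h4 hx]
      have h5 := Real.exp_pos (-(2 * π * x))
      have : x * Real.exp (-(2 * π * x)) + Real.exp (-(2 * π * x)) ≤ Real.exp (-(2 * π * x)) * Real.exp (2 * π * x) := by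
        nlinarith [Real.pi_gt_three]
      linarith

lemma w0_approx {ν ρ : ℝ} (h0 : 0 ≤ ν) (h1 : ν ≤ 1/2) (hρ : 0 < ρ) :
    ∃ C > 0, ∀ x : ℝ, ρ ≤ x → ‖w0f ν x - 2 * π * Complex.exp (-(Complex.I * π * ν / 2)) * (Real.exp (-(π * x)) / √x : ℝ)‖
      ≤ C * (Real.exp (-(π * x)) / √x / x) := by
  obtain ⟨C, hC, hCz⟩ := gamma_ratio hρ
  set a := 1/4 - ν/2 with ha
  have ha0 : 0 ≤ a := by linarith
  refine ⟨2 * π * ((C * (1 + a / ρ) + a) * (1 + 1 / ρ) + 1), by positivity, ?_⟩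
  intro x hx
  have hx0 : 0 < x := by linarith
  set z : ℂ := a + Complex.I * x with hz
  have hzre : z.re = a := by simp [hz]
  have hzim : z.im = x := by simp [hz]
  have hxz : x ≤ ‖z‖ := by
    rw [← hzim]; exact (le_abs_self _).trans (Complex.abs_im_le_norm _)
  have b1 : ‖Complex.Gamma z / Complex.Gamma (z + 1/2) * z ^ ((1:ℂ)/2) - 1‖ ≤ C / x :=
    (hCz z (by rw [hzre]; exact ha0) (by linarith)).trans (by gcongr)
  have b2 := quot_bound ha0 hx0
  have b3 := sin_fac_bound (b := 1/4 + ν/2) hx0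
  have b4 := three_factor hρ hx hC.le ha0 zero_le_one b1 b2 b3
  have hz0 : z ≠ 0 := by intro h; rw [h] at hzim; simp at hzim; linarith
  have hzs : z ^ ((1:ℂ)/2) ≠ 0 := by
    intro h; have := cpow_half_sq z; rw [h] at this; simp at this; exact hz0 this.symm
  have hGne : Complex.Gamma (z + 1/2) ≠ 0 := Complex.Gamma_ne_zero_of_re_pos (by simp [hzre]; linarith)
  have hrefl := Complex.Gamma_mul_Gamma_one_sub (((1/4 + ν/2 : ℝ) : ℂ) - Complex.I * x)
  rw [sin_fac] at hrefl
  have e1 : 1 - (((1/4 + ν/2 : ℝ) : ℂ) - Complex.I * x) = z + 1/2 := by rw [hz, ha]; push_cast; ring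
  rw [e1] at hrefl
  have hE : 1 - Complex.exp (-(2 * π * ((1/4 + ν/2 : ℝ) : ℂ) * Complex.I) - 2 * π * x) ≠ 0 := by
    intro h
    rw [h] at hrefl; simp at hrefl
    rcases hrefl with h' | h'
    · refine Complex.Gamma_ne_zero_of_re_pos ?_ h'
      simp; linarith
    · exact hGne (by simpa using h')
  have hIx : (Complex.I * x) ^ ((1:ℂ)/2) = Complex.exp (Complex.I * π / 4) * (√x : ℝ) := by
    rw [mul_comm, ofReal_mul_cpow hx0 Complex.I_ne_zero, Complex.cpow_def_of_ne_zero Complex.I_ne_zero,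
      Complex.log_I, mul_comm, Real.sqrt_eq_rpow, Complex.ofReal_cpow hx0.le]
    congr 1
    · congr 1; ring
    · norm_num
  have hsx : ((√x : ℝ) : ℂ) ≠ 0 := by exact_mod_cast (Real.sqrt_pos.2 hx0).ne'
  have key : w0f ν x = 2 * π * Complex.exp (-(Complex.I * π * ν / 2)) * (Real.exp (-(π * x)) / √x : ℝ) *
      (Complex.Gamma z / Complex.Gamma (z + 1/2) * z ^ ((1:ℂ)/2) * ((Complex.I * x) ^ ((1:ℂ)/2) / (a + Complex.I * x) ^ ((1:ℂ)/2)) *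
       (1 / (1 - Complex.exp (-(2 * π * ((1/4 + ν/2 : ℝ) : ℂ) * Complex.I) - 2 * π * x)))) := by
    rw [w0f, GG, ← ha, ← hz]
    have hg : Complex.Gamma (((1/4 + ν/2 : ℝ) : ℂ) - Complex.I * x) = π / ((1 - Complex.exp (-(2 * π * ((1/4 + ν/2 : ℝ) : ℂ) * Complex.I) - 2 * π * x)) *
      (Complex.exp (Complex.I * π * ((1/4 + ν/2 : ℝ) : ℂ)) * Complex.exp (π * x)) / (2 * Complex.I)) / Complex.Gamma (z + 1/2) := by
      rw [eq_div_iff hGne]; exact hrefl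
    rw [hg, hIx]
    have x1 : Complex.exp (Complex.I * π * ((1/4 + ν/2 : ℝ) : ℂ)) = Complex.exp (Complex.I * π / 4) * Complex.exp (Complex.I * π * ν / 2) := by
      rw [← Complex.exp_add]; congr 1; push_cast; ring
    have x2 : Complex.exp (-(Complex.I * π * ν / 2)) = (Complex.exp (Complex.I * π * ν / 2))⁻¹ := Complex.exp_neg _
    have x3 : ((Real.exp (-(π * x)) / √x : ℝ) : ℂ) = (Complex.exp (π * x))⁻¹ / (√x : ℝ) := by
      rw [Complex.ofReal_div, Complex.ofReal_exp]; push_cast; rw [Complex.exp_neg]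
    have x4 : Complex.exp (Complex.I * π / 4) ^ 2 = Complex.I := by
      rw [← Complex.exp_nat_mul]; conv_rhs => rw [← Complex.exp_pi_div_two_mul_I]
      congr 1; push_cast; ring
    rw [x1, x2, x3]
    generalize hee : 1 - Complex.exp (-(2 * π * ((1/4 + ν/2 : ℝ) : ℂ) * Complex.I) - 2 * π * x) = E at *
    have y1 := Complex.exp_ne_zero (Complex.I * π / 4)
    have y2 := Complex.exp_ne_zero (Complex.I * π * ν / 2)
    have y3 := Complex.exp_ne_zero (π * x)
    generalize Complex.exp (Complex.I * π / 4) = E1 at *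
    generalize Complex.exp (Complex.I * π * ν / 2) = E2 at *
    generalize Complex.exp (π * x) = E3 at *
    generalize ((√x : ℝ) : ℂ) = s at *
    field_simp
    rw [x4]
  set X := (Complex.Gamma z / Complex.Gamma (z + 1/2) * z ^ ((1:ℂ)/2) * ((Complex.I * x) ^ ((1:ℂ)/2) / (a + Complex.I * x) ^ ((1:ℂ)/2)) *
       (1 / (1 - Complex.exp (-(2 * π * ((1/4 + ν/2 : ℝ) : ℂ) * Complex.I) - 2 * π * x))))
  rw [key, ← mul_sub_one, norm_mul]
  have hnorm : ‖2 * π * Complex.exp (-(Complex.I * π * ν / 2)) * ((Real.exp (-(π * x)) / √x : ℝ) : ℂ)‖ = 2 * π * (Real.exp (-(π * x)) / √x) := by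
    rw [norm_mul, norm_mul, Complex.norm_real, Complex.norm_exp]
    rw [Real.norm_of_nonneg (by positivity)]
    simp [abs_of_pos Real.pi_pos]
  rw [hnorm]
  calc _ ≤ 2 * π * (Real.exp (-(π * x)) / √x) * (((C * (1 + a / ρ) + a) * (1 + 1 / ρ) + 1) / x) := by gcongr
    _ = _ := by ring

end BOP

namespace BOP

lemma GG_cont {A B : ℝ} (hA : 0 < A) (hB : 0 < B) : Continuous (GG A B) := by
  unfold GG
  refine Continuous.mul ?_ ?_
  · rw [continuous_iff_continuousAt]
    intro x
    refine ContinuousAt.comp (f := fun x : ℝ => (A:ℂ) + Complex.I * x) (g := Complex.Gamma) ?_ (by fun_prop)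
    refine (Complex.differentiableAt_Gamma _ ?_).continuousAt
    intro m h
    have := congrArg Complex.re h
    simp at this
    have : (0:ℝ) ≤ m := by positivity
    linarith
  · rw [continuous_iff_continuousAt]
    intro x
    refine ContinuousAt.comp (f := fun x : ℝ => (B:ℂ) - Complex.I * x) (g := Complex.Gamma) ?_ (by fun_prop)
    refine (Complex.differentiableAt_Gamma _ ?_).continuousAt
    intro m h
    have := congrArg Complex.re h
    simp at this
    have : (0:ℝ) ≤ m := by positivity
    linarith

/-- the positive reference weight -/
noncomputable def w1 (x : ℝ) : ℝ := Complex.normSq (Complex.Gamma (1/4 + Complex.I * x))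

lemma w1_eq (x : ℝ) : ((w1 x : ℝ) : ℂ) = GG (1/4) (1/4) x := by
  rw [w1, Complex.normSq_eq_conj_mul_self, GG, ← Complex.Gamma_conj, mul_comm]
  congr 2
  · push_cast; rfl
  · simp [sub_eq_add_neg, Complex.conj_ofNat]

lemma w0f_zero (x : ℝ) : w0f 0 x = (w1 x : ℝ) := by
  rw [w1_eq, w0f]; norm_num

lemma w0f_neg (ν x : ℝ) : w0f ν (-x) = (starRingEnd ℂ) (w0f ν x) := by
  simp only [w0f, GG]
  rw [map_mul, ← Complex.Gamma_conj, ← Complex.Gamma_conj]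
  congr 2 <;> simp [sub_eq_add_neg, Complex.conj_ofNat]

lemma w1_neg (x : ℝ) : w1 (-x) = w1 x := by
  have := w0f_neg 0 x
  rw [w0f_zero, w0f_zero, Complex.conj_ofReal] at this
  exact_mod_cast this

lemma w1_pos (x : ℝ) : 0 < w1 x := by
  rw [w1, Complex.normSq_pos]
  exact Complex.Gamma_ne_zero_of_re_pos (by simp)

lemma w1_cont : Continuous w1 := by
  have : w1 = fun x => (GG (1/4) (1/4) x).re := by
    ext x; rw [← w1_eq]; simp
  rw [this]
  exact Complex.continuous_re.comp (GG_cont (by norm_num) (by norm_num))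

/-- comparison function -/
noncomputable def ph (x : ℝ) : ℝ := Real.exp (-(π * |x|)) / √(1 + |x|)

lemma ph_pos (x : ℝ) : 0 < ph x := by
  unfold ph
  have := abs_nonneg x
  positivity

lemma ph_cont : Continuous ph := by
  unfold ph
  refine Continuous.div (by fun_prop) (by fun_prop) ?_
  intro x
  have := abs_nonneg x
  positivity

lemma w1_bounds : ∃ c > 0, ∃ C > 0, ∀ x, c * ph x ≤ w1 x ∧ w1 x ≤ C * ph x := by
  obtain ⟨D, hD, hDx⟩ := w0_approx (ν := 0) le_rfl (by norm_num) (ρ := 1) one_pos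
  set X := max 1 D with hX
  have hX1 : 1 ≤ X := le_max_left _ _
  have hXD : D ≤ X := le_max_right _ _
  have hcont : Continuous (fun x => w1 x / ph x) := w1_cont.div ph_cont fun x => (ph_pos x).ne'
  obtain ⟨x1, hx1, hmin⟩ := (isCompact_Icc (a := (0:ℝ)) (b := X)).exists_isMinOn ⟨0, by constructor <;> linarith⟩ hcont.continuousOn
  obtain ⟨x2, hx2, hmax⟩ := (isCompact_Icc (a := (0:ℝ)) (b := X)).exists_isMaxOn ⟨0, by constructor <;> linarith⟩ hcont.continuousOn
  have hp1 : 0 < w1 x1 / ph x1 := div_pos (w1_pos _) (ph_pos _)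
  have hp2 : 0 < w1 x2 / ph x2 := div_pos (w1_pos _) (ph_pos _)
  have main : ∀ x, 0 ≤ x → min (w1 x1 / ph x1) 1 * ph x ≤ w1 x ∧ w1 x ≤ max (w1 x2 / ph x2) (2 * (2 * π + D)) * ph x := by
    intro x hx
    have hph := ph_pos x
    rcases le_total x X with h | h
    · have a1 := hmin (show x ∈ Set.Icc 0 X from ⟨hx, h⟩)
      have a2 := hmax (show x ∈ Set.Icc 0 X from ⟨hx, h⟩)
      simp only [Set.mem_ofPred_eq] at a1 a2
      rw [le_div_iff₀ hph] at a1
      rw [div_le_iff₀ hph] at a2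
      constructor
      · exact le_trans (mul_le_mul_of_nonneg_right (min_le_left _ _) hph.le) a1
      · exact a2.trans (mul_le_mul_of_nonneg_right (le_max_left _ _) hph.le)
    · have hx1 : 1 ≤ x := hX1.trans h
      have h3 := hDx x hx1
      rw [w0f_zero] at h3
      simp only [Complex.ofReal_zero, mul_zero, zero_div, neg_zero, Complex.exp_zero, mul_one] at h3
      set y := Real.exp (-(π * x)) / √x with hy
      have hy0 : 0 < y := by positivity
      have h4 : |w1 x - 2 * π * y| ≤ D * (y / x) := by
        have : ((w1 x : ℝ) : ℂ) - 2 * π * (y:ℝ) = ((w1 x - 2 * π * y : ℝ) : ℂ) := by push_cast; rfl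
        rw [this, Complex.norm_real] at h3
        exact h3
      rw [abs_le] at h4
      have h5 : D * (y / x) ≤ y := by
        rw [← mul_div_assoc, div_le_iff₀ (by linarith)]
        nlinarith
      have h5' : D * (y / x) ≤ D * y := by
        gcongr; exact div_le_self hy0.le hx1
      have h6 : ph x ≤ y := by
        rw [ph, abs_of_nonneg hx, hy]
        gcongr; linarith
      have h7 : y ≤ 2 * ph x := by
        rw [ph, abs_of_nonneg hx, hy, ← mul_div_assoc, mul_comm 2, mul_div_assoc, div_eq_mul_inv]
        gcongr
        rw [inv_eq_one_div, div_le_div_iff₀ (by positivity) (by positivity), one_mul,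
          show (2:ℝ) = √4 by rw [show (4:ℝ) = 2 ^ 2 by norm_num, Real.sqrt_sq (by norm_num)], ← Real.sqrt_mul (by norm_num)]
        apply Real.sqrt_le_sqrt; linarith
      have hpi := Real.pi_gt_three
      constructor
      · calc _ ≤ 1 * ph x := mul_le_mul_of_nonneg_right (min_le_right _ _) hph.le
          _ ≤ y := by linarith
          _ ≤ w1 x := by nlinarith
      · calc w1 x ≤ (2 * π + D) * y := by nlinarith
          _ ≤ (2 * π + D) * (2 * ph x) := by gcongr
          _ = (2 * (2 * π + D)) * ph x := by ring
          _ ≤ _ := mul_le_mul_of_nonneg_right (le_max_right _ _) hph.le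
  refine ⟨min (w1 x1 / ph x1) 1, lt_min hp1 one_pos, max (w1 x2 / ph x2) (2 * (2 * π + D)), lt_max_of_lt_left hp2, ?_⟩
  intro x
  rcases le_total 0 x with h | h
  · exact main x h
  · have := main (-x) (by linarith)
    rw [w1_neg] at this
    have e : ph (-x) = ph x := by simp [ph]
    rwa [e] at this

/-- the true weight -/
noncomputable def Wf (ν x : ℝ) : ℂ := Complex.exp (-(Complex.I * π * ν / 2) * (Real.sign x : ℝ)) * (bK ν (π * |x|) : ℝ)

lemma Wf_neg (ν x : ℝ) : Wf ν (-x) = (starRingEnd ℂ) (Wf ν x) := by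
  rw [Wf, Wf, map_mul, Complex.conj_ofReal, ← Complex.exp_conj, abs_neg, Real.sign_neg]
  congr 2
  simp
  rw [Complex.conj_ofNat]; ring

lemma far_bound {ν ρ : ℝ} (h0 : 0 ≤ ν) (h1 : ν ≤ 1/2) (hρ : 0 < ρ) :
    ∃ C > 0, ∀ x : ℝ, ρ < |x| → ‖Wf ν x - ((1 / (2 * √2 * π) : ℝ) : ℂ) * w0f ν x‖ ≤ C * (w1 x / √(x ^ 2 + 1 / 16)) := by
  obtain ⟨D, hD, hDx⟩ := w0_approx h0 h1 hρ
  obtain ⟨c, hc, C, hC, hw⟩ := w1_bounds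
  set κ : ℝ := 1 / (2 * √2 * π) with hκ
  have hκ0 : 0 < κ := by positivity
  set r := √(1 + ρ⁻¹) with hr
  have hr0 : 0 < r := by positivity
  set E := (1 + κ * D) * (r * ((1 + ρ⁻¹) / c)) with hE
  have hE0 : 0 < E := by positivity
  refine ⟨E, hE0, ?_⟩
  have main : ∀ x : ℝ, ρ < x → ‖Wf ν x - (κ : ℂ) * w0f ν x‖ ≤ E * (w1 x / √(x ^ 2 + 1 / 16)) := by
    intro x hx
    have hx0 : 0 < x := by linarith
    set y := Real.exp (-(π * x)) / √x with hy
    have hy0 : 0 < y := by positivity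
    have b1 := hDx x hx.le
    have b2 := bK_approx h0 h1 (y := π * x) (by positivity)
    have e1 : √(π / (2 * (π * x))) * Real.exp (-(π * x)) = y / √2 := by
      rw [hy, show π / (2 * (π * x)) = 1 / (2 * x) by field_simp, Real.sqrt_div (by norm_num), Real.sqrt_one, Real.sqrt_mul (by norm_num)]
      field_simp
    rw [e1] at b2
    have e2 : Wf ν x - (κ:ℂ) * w0f ν x = Complex.exp (-(Complex.I * π * ν / 2)) * ((bK ν (π * x) - y / √2 : ℝ) : ℂ)
        - κ * (w0f ν x - 2 * π * Complex.exp (-(Complex.I * π * ν / 2)) * (y : ℝ)) := by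
      rw [Wf, Real.sign_of_pos hx0, abs_of_pos hx0]
      have : (κ:ℂ) * (2 * π) = 1 / (√2 : ℝ) := by
        have : κ * (2 * π) = 1 / √2 := by rw [hκ]; field_simp
        exact_mod_cast this
      push_cast
      rw [mul_one]
      linear_combination -(Complex.exp (-(Complex.I * π * ν / 2)) * (y:ℂ)) * this
    rw [e2]
    have hn : ‖Complex.exp (-(Complex.I * π * ν / 2))‖ = 1 := by
      rw [Complex.norm_exp]; simp
    have s1 : ‖Complex.exp (-(Complex.I * π * ν / 2)) * ((bK ν (π * x) - y / √2 : ℝ) : ℂ)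
        - κ * (w0f ν x - 2 * π * Complex.exp (-(Complex.I * π * ν / 2)) * (y : ℝ))‖ ≤ (1 + κ * D) * (y / x) := by
      refine (norm_sub_le _ _).trans ?_
      rw [norm_mul, norm_mul, hn, one_mul, Complex.norm_real, Complex.norm_real, Real.norm_of_nonneg hκ0.le, Real.norm_eq_abs]
      have q1 : y / √2 / (π * x) ≤ y / x := by
        rw [div_div]
        have h2 : 1 ≤ √2 := Real.one_le_sqrt.2 (by norm_num)
        have hp : 1 ≤ π := by linarith [Real.pi_gt_three]
        gcongr
        calc x = 1 * (1 * x) := by ring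
          _ ≤ √2 * (π * x) := by gcongr
      calc _ ≤ y / x + κ * (D * (y / x)) := by gcongr; exact b2.trans q1
        _ = _ := by ring
    refine s1.trans ?_
    rw [hE, mul_assoc]
    refine mul_le_mul_of_nonneg_left ?_ (by positivity)
    have hxi : 1 ≤ ρ⁻¹ * x := by rw [← div_eq_inv_mul, le_div_iff₀ hρ]; linarith
    have s2 : y ≤ r * ph x := by
      rw [ph, abs_of_pos hx0, hy, ← mul_div_assoc, div_le_div_iff₀ (by positivity) (by positivity), mul_comm r, mul_assoc]
      gcongr
      rw [hr, ← Real.sqrt_mul (by positivity)]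
      apply Real.sqrt_le_sqrt
      nlinarith
    have s3 : ph x ≤ w1 x / c := by
      rw [le_div_iff₀ hc]; linarith [(hw x).1]
    have s4 : √(x ^ 2 + 1/16) ≤ (1 + ρ⁻¹) * x := by
      rw [Real.sqrt_le_left (by positivity)]
      have : 0 < ρ⁻¹ := by positivity
      nlinarith
    have hq : 0 < √(x ^ 2 + 1/16) := by positivity
    have hww := w1_pos x
    calc y / x ≤ r * (w1 x / c) / x := by gcongr; exact s2.trans (by gcongr)
      _ = r * ((1 + ρ⁻¹) / c) * (w1 x / ((1 + ρ⁻¹) * x)) := by field_simp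
      _ ≤ _ := by gcongr
  intro x hx
  rcases le_total 0 x with h | h
  · rw [abs_of_nonneg h] at hx; exact main x hx
  · rw [abs_of_nonpos h] at hx
    have := main (-x) hx
    rw [w1_neg, Wf_neg, w0f_neg, ← Complex.conj_ofReal, ← map_mul, ← map_sub, Complex.norm_conj, neg_sq] at this
    exact this

end BOP

namespace BOP

lemma integrable_even {f : ℝ → ℝ} (h : IntegrableOn f (Set.Ioi 0)) : Integrable (fun x : ℝ => f |x|) := by
  have h1 : IntegrableOn (fun x : ℝ => f |x|) (Set.Ioi 0) :=
    h.congr_fun (fun x hx => by simp only [abs_of_pos (show (0:ℝ) < x from hx)]) measurableSet_Ioi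
  have h2 : IntegrableOn (fun x : ℝ => f |x|) (Set.Iic 0) := by
    rw [integrableOn_Iic_iff_integrableOn_Iio]
    have h3 := (Measure.measurePreserving_neg (volume : Measure ℝ)).integrableOn_comp_preimage
      (Homeomorph.neg ℝ).measurableEmbedding (f := fun x : ℝ => f |x|) (s := Set.Ioi 0)
    have h4 := h3.2 h1
    have e1 : (Neg.neg ⁻¹' Set.Ioi (0:ℝ)) = Set.Iio 0 := by ext x; simp
    have e2 : (fun x : ℝ => f |x|) ∘ Neg.neg = fun x : ℝ => f |x| := by ext x; simp
    rw [e1, e2] at h4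
    exact h4
  have := h2.union h1
  rwa [Set.Iic_union_Ioi, integrableOn_univ] at this

/-- exponentially decaying weights with at most an inverse square root singularity -/
structure Dec (V : ℝ → ℂ) : Prop where
  meas : AEStronglyMeasurable V volume
  bd : ∃ C, 0 ≤ C ∧ ∀ x, x ≠ 0 → ‖V x‖ ≤ C * (Real.exp (-|x|) * |x| ^ (-(1/2):ℝ))

lemma dec_model (k : ℕ) : Integrable (fun x : ℝ => |x| ^ k * (Real.exp (-|x|) * |x| ^ (-(1/2):ℝ))) := by
  have h := Real.GammaIntegral_convergent (s := k + 1/2) (by positivity)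
  refine integrable_even (f := fun x => x ^ k * (Real.exp (-x) * x ^ (-(1/2):ℝ))) (h.congr_fun ?_ measurableSet_Ioi)
  intro x hx
  have hx : 0 < x := hx
  simp only
  rw [show (k:ℝ) + 1/2 - 1 = k + -(1/2) by ring, Real.rpow_add hx, Real.rpow_natCast]
  ring

lemma Dec.int {V : ℝ → ℂ} (h : Dec V) (q : Polynomial ℂ) : Integrable (fun x : ℝ => q.eval (x:ℂ) * V x) := by
  have hk : ∀ k : ℕ, Integrable (fun x : ℝ => (x:ℂ) ^ k * V x) := by
    intro k
    obtain ⟨C, hC, hb⟩ := h.bd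
    refine ((dec_model k).const_mul C).mono' (AEStronglyMeasurable.mul (by fun_prop) h.meas) ?_
    have : ∀ᵐ x : ℝ, x ≠ 0 := by simp [ae_iff]
    filter_upwards [this] with x hx
    rw [norm_mul, norm_pow, Complex.norm_real, Real.norm_eq_abs]
    have := hb x hx
    calc _ ≤ |x| ^ k * (C * (Real.exp (-|x|) * |x| ^ (-(1/2):ℝ))) := by gcongr
      _ = _ := by ring
  simp_rw [Polynomial.eval_eq_sum_range, Finset.sum_mul]
  refine integrable_finsetSum _ fun i _ => ?_
  simp_rw [mul_assoc]
  exact (hk i).const_mul _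

lemma norm_osc (x t : ℝ) : ‖Complex.exp (-(Complex.I * x * t))‖ = 1 := by
  rw [Complex.norm_exp]; simp

lemma Dec.intosc {V : ℝ → ℂ} (h : Dec V) (q : Polynomial ℂ) (t : ℝ) :
    Integrable (fun x : ℝ => q.eval (x:ℂ) * V x * Complex.exp (-(Complex.I * x * t))) := by
  refine (h.int q).norm.mono' ((h.int q).aestronglyMeasurable.mul (by fun_prop)) (Eventually.of_forall fun x => ?_)
  rw [norm_mul, norm_osc, mul_one]

/-- Fourier transform of a polynomial multiple of the weight -/
noncomputable def FT (V : ℝ → ℂ) (q : Polynomial ℂ) (t : ℝ) : ℂ :=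
  ∫ x : ℝ, q.eval (x:ℂ) * V x * Complex.exp (-(Complex.I * x * t))

lemma Dec.FT_deriv {V : ℝ → ℂ} (h : Dec V) (q : Polynomial ℂ) (t : ℝ) :
    HasDerivAt (FT V q) (-Complex.I * FT V (Polynomial.X * q) t) t := by
  have b1 : ∀ᵐ x : ℝ, ∀ s ∈ (Set.univ : Set ℝ), ‖-Complex.I * ((Polynomial.X * q).eval (x:ℂ) * V x * Complex.exp (-(Complex.I * x * s)))‖
      ≤ ‖(Polynomial.X * q).eval (x:ℂ) * V x‖ := by
    refine Eventually.of_forall fun x s _ => le_of_eq ?_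
    rw [norm_mul, norm_mul _ (Complex.exp _), norm_osc, norm_neg, Complex.norm_I, one_mul, mul_one]
  have b2 : ∀ᵐ x : ℝ, ∀ s ∈ (Set.univ : Set ℝ), HasDerivAt (fun s : ℝ => q.eval (x:ℂ) * V x * Complex.exp (-(Complex.I * x * s)))
      (-Complex.I * ((Polynomial.X * q).eval (x:ℂ) * V x * Complex.exp (-(Complex.I * x * s)))) s := by
    refine Eventually.of_forall fun x s _ => ?_
    have h1 : HasDerivAt (fun s : ℝ => -(Complex.I * x * (s:ℂ))) (-(Complex.I * x)) s := by
      have h2 := ((Complex.ofRealCLM.hasDerivAt (x := s)).const_mul (-(Complex.I * x)))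
      simpa [neg_mul] using h2
    have h3 := (h1.cexp).const_mul (q.eval (x:ℂ) * V x)
    refine h3.congr_deriv ?_
    rw [Polynomial.eval_mul, Polynomial.eval_X]; ring
  have := (hasDerivAt_integral_of_dominated_loc_of_deriv_le (μ := volume) (s := Set.univ) (x₀ := t) (univ_mem)
    (F := fun (t : ℝ) (x : ℝ) => q.eval (x:ℂ) * V x * Complex.exp (-(Complex.I * x * t)))
    (Eventually.of_forall fun s => (h.intosc q s).aestronglyMeasurable) (h.intosc q t)
    ((h.intosc (Polynomial.X * q) t).const_mul _).aestronglyMeasurable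
    b1 (h.int _).norm b2).2
  refine this.congr_deriv ?_
  rw [integral_const_mul]; rfl

lemma FT_add {V : ℝ → ℂ} (h : Dec V) (p q : Polynomial ℂ) (t : ℝ) : FT V (p + q) t = FT V p t + FT V q t := by
  rw [FT, FT, FT, ← integral_add (h.intosc p t) (h.intosc q t)]
  congr 1; ext x; simp; ring

lemma FT_smul {V : ℝ → ℂ} (c : ℂ) (q : Polynomial ℂ) (t : ℝ) : FT V (c • q) t = c * FT V q t := by
  rw [FT, FT, ← integral_const_mul]
  congr 1; ext x; simp; ring

/-- Lemma on Meixner-Pollaczek transforms -/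
lemma mp_transform (ν : ℝ) (Λ : Polynomial ℂ → ℝ → ℂ)
    (hadd : ∀ p q t, Λ (p + q) t = Λ p t + Λ q t) (hsmul : ∀ (c : ℂ) q t, Λ (c • q) t = c * Λ q t)
    (hder : ∀ q t, HasDerivAt (Λ q) (-Complex.I * Λ (Polynomial.X * q) t) t)
    (φ : ℝ → ℂ) (hφ : ∀ t, HasDerivAt φ (φ t * (-(ν/2) - (Real.tanh (t/2) : ℝ) / 4)) t)
    (h1 : ∀ t, Λ 1 t = φ t) (k : ℕ) (q : Polynomial ℂ) (hq : q.degree < k) :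
    Λ (q * mp (Complex.I * ((ν/2 : ℝ) : ℂ)) k) 0 = 0 := by
  set s : ℂ := Complex.I * ((ν/2 : ℝ) : ℂ) with hs
  have hT : ∀ t : ℝ, HasDerivAt (fun t : ℝ => ((Real.tanh (t/2) : ℝ) : ℂ)) ((1 - (Real.tanh (t/2) : ℝ) ^ 2) / 2 : ℂ) t := by
    intro t
    have h2 : HasDerivAt (fun t : ℝ => Real.tanh (t/2)) ((1 - Real.tanh (t/2) ^ 2) / 2) t := by
      have h3 : HasDerivAt Real.tanh (1 - Real.tanh (t/2) ^ 2) (t/2) := by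
        have h4 := (Real.hasDerivAt_sinh (t/2)).div (Real.hasDerivAt_cosh (t/2)) (Real.cosh_pos _).ne'
        have e : Real.tanh = fun x => Real.sinh x / Real.cosh x := by ext x; exact Real.tanh_eq_sinh_div_cosh x
        rw [e]
        refine h4.congr_deriv ?_
        have := (Real.cosh_pos (t/2)).ne'
        field_simp
      refine (h3.comp t ((hasDerivAt_id t).div_const 2)).congr_deriv ?_
      simp [div_eq_mul_inv]
    have := h2.ofReal_comp
    refine this.congr_deriv ?_
    push_cast; rfl
  set c : ℕ → ℂ := fun k => ∏ j ∈ Finset.range k, (-Complex.I * (1/4 + (j:ℂ)/2)) with hc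
  have hcs : ∀ k, c (k+1) = c k * (-Complex.I * (1/4 + (k:ℂ)/2)) := fun k => Finset.prod_range_succ _ _
  have hform : ∀ k, (∀ t, Λ (mp s k) t = c k * (φ t * ((Real.tanh (t/2) : ℝ) : ℂ) ^ k)) ∧
      (∀ t, Λ (mp s (k+1)) t = c (k+1) * (φ t * ((Real.tanh (t/2) : ℝ) : ℂ) ^ (k+1))) := by
    have hX : ∀ k t, (∀ t, Λ (mp s k) t = c k * (φ t * ((Real.tanh (t/2) : ℝ) : ℂ) ^ k)) →
        -Complex.I * Λ (Polynomial.X * mp s k) t = c k * ((φ t * (-(ν/2) - (Real.tanh (t/2) : ℝ) / 4)) * ((Real.tanh (t/2) : ℝ) : ℂ) ^ k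
          + φ t * (k * ((Real.tanh (t/2) : ℝ) : ℂ) ^ (k - 1) * ((1 - (Real.tanh (t/2) : ℝ) ^ 2) / 2 : ℂ))) := by
      intro k t hk
      have e : Λ (mp s k) = fun t => c k * (φ t * ((Real.tanh (t/2) : ℝ) : ℂ) ^ k) := funext hk
      have d1 := hder (mp s k) t
      rw [e] at d1
      exact d1.unique (((hφ t).mul ((hT t).pow k)).const_mul (c k))
    have hX' : ∀ k t, (∀ t, Λ (mp s k) t = c k * (φ t * ((Real.tanh (t/2) : ℝ) : ℂ) ^ k)) →
        Λ (Polynomial.X * mp s k) t = Complex.I * (c k * ((φ t * (-(ν/2) - (Real.tanh (t/2) : ℝ) / 4)) * ((Real.tanh (t/2) : ℝ) : ℂ) ^ k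
          + φ t * (k * ((Real.tanh (t/2) : ℝ) : ℂ) ^ (k - 1) * ((1 - (Real.tanh (t/2) : ℝ) ^ 2) / 2 : ℂ)))) := by
      intro k t hk
      rw [← hX k t hk, ← mul_assoc, mul_neg, Complex.I_mul_I]; ring
    intro k
    induction k with
    | zero =>
      have z0 : ∀ t, Λ (mp s 0) t = c 0 * (φ t * ((Real.tanh (t/2) : ℝ) : ℂ) ^ 0) := by
        intro t; simp [mp, hc, h1]
      refine ⟨z0, fun t => ?_⟩
      have e : mp s (0+1) = Polynomial.X * mp s 0 + s • mp s 0 := by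
        simp [mp, Polynomial.smul_eq_C_mul]
      rw [e, hadd, hsmul, hX' 0 t z0, z0, hcs, hs]
      push_cast
      simp; ring
    | succ k ih =>
      refine ⟨ih.2, fun t => ?_⟩
      have e : mp s (k+1+1) = (Polynomial.X * mp s (k+1) + s • mp s (k+1)) + (-(bc (k+1) : ℂ)) • mp s k := by
        rw [Polynomial.smul_eq_C_mul, Polynomial.smul_eq_C_mul, mp]; simp; ring
      rw [e, hadd, hadd, hsmul, hsmul, hX' (k+1) t ih.2, ih.2, ih.1, hcs (k+1), hcs k, hs, bc, Nat.add_sub_cancel]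
      have hI : Complex.I ^ 2 = -1 := Complex.I_sq
      generalize ((Real.tanh (t/2) : ℝ) : ℂ) = T
      push_cast
      linear_combination (-(c k) * φ t * (1/4 + (k:ℂ)/2) * ((k:ℂ)+1) / 2 * T ^ k) * hI
  have h0 : ∀ k, Λ (mp s (k+1)) 0 = 0 := by
    intro k
    rw [(hform k).2]; simp
  let L : Polynomial ℂ →ₗ[ℂ] ℂ :=
    { toFun := fun q => Λ q 0
      map_add' := fun p q => hadd p q 0
      map_smul' := fun c q => by simp [hsmul] }
  exact L_mul_mp s L h0 q k hq

end BOP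

namespace BOP

/-- softplus -/
noncomputable def spl (t : ℝ) : ℝ := Real.log (1 + Real.exp t)

lemma spl_exp (t : ℝ) : Real.exp (spl t) = 1 + Real.exp t := Real.exp_log (by positivity)

lemma spl_deriv (t : ℝ) : HasDerivAt spl (Real.exp (t - spl t)) t := by
  have h := ((Real.hasDerivAt_exp t).const_add 1).log (by positivity)
  refine h.congr_deriv ?_
  rw [Real.exp_sub, spl_exp]

lemma spl_cont : Continuous spl := continuous_iff_continuousAt.2 fun t => (spl_deriv t).continuousAt

lemma spl_one_sub (t : ℝ) : 1 - Real.exp (t - spl t) = Real.exp (-spl t) := by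
  rw [Real.exp_sub, Real.exp_neg, spl_exp]
  have : 1 + Real.exp t ≠ 0 := by positivity
  field_simp; ring

lemma sig_deriv (t : ℝ) : HasDerivAt (fun t => Real.exp (t - spl t)) (Real.exp (t - 2 * spl t)) t := by
  have h := ((hasDerivAt_id t).sub (spl_deriv t)).exp
  refine h.congr_deriv ?_
  simp only [id, Pi.sub_apply]
  rw [spl_one_sub, ← Real.exp_add]; ring_nf

lemma sig_mono : StrictMono (fun t => Real.exp (t - spl t)) := by
  apply strictMono_of_deriv_pos
  intro t
  rw [(sig_deriv t).deriv]; positivity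

lemma sig_image : (fun t => Real.exp (t - spl t)) '' Set.univ = Set.Ioo 0 1 := by
  ext y
  simp only [Set.image_univ, Set.mem_range, Set.mem_Ioo]
  constructor
  · rintro ⟨t, rfl⟩
    refine ⟨Real.exp_pos _, ?_⟩
    have := spl_one_sub t
    have h2 := Real.exp_pos (-spl t)
    linarith
  · rintro ⟨h0, h1⟩
    refine ⟨Real.log (y / (1 - y)), ?_⟩
    have h3 : 0 < 1 - y := by linarith
    rw [Real.exp_sub, spl_exp, Real.exp_log (by positivity)]
    field_simp
    ring

lemma beta_point (u v : ℂ) (t : ℝ) :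
    |Real.exp (t - 2 * spl t)| • (((Real.exp (t - spl t) : ℝ) : ℂ) ^ (u - 1) * (1 - ((Real.exp (t - spl t) : ℝ) : ℂ)) ^ (v - 1))
     = Complex.exp (u * t - (u + v) * spl t) := by
  have e : (1 - ((Real.exp (t - spl t) : ℝ) : ℂ)) = ((Real.exp (-spl t) : ℝ) : ℂ) := by
    rw [← spl_one_sub]; push_cast; rfl
  rw [e, Complex.cpow_def_of_ne_zero (by exact_mod_cast (Real.exp_pos _).ne'), Complex.cpow_def_of_ne_zero (by exact_mod_cast (Real.exp_pos _).ne'),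
    ← Complex.ofReal_log (Real.exp_pos _).le, ← Complex.ofReal_log (Real.exp_pos _).le, Real.log_exp, Real.log_exp, abs_of_pos (Real.exp_pos _),
    Complex.real_smul, Complex.ofReal_exp, ← Complex.exp_add, ← Complex.exp_add]
  congr 1; push_cast; ring

lemma beta_line_int {u v : ℂ} (hu : 0 < u.re) (hv : 0 < v.re) :
    Integrable (fun t : ℝ => Complex.exp (u * t - (u + v) * spl t)) := by
  have h := (Complex.betaIntegral_convergent hu hv)
  rw [intervalIntegrable_iff_integrableOn_Ioo_of_le zero_le_one, ← sig_image,
    integrableOn_image_iff_integrableOn_abs_deriv_smul MeasurableSet.univ (fun t _ => (sig_deriv t).hasDerivWithinAt) sig_mono.injective.injOn,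
    integrableOn_univ] at h
  simpa only [beta_point] using h

lemma beta_line {u v : ℂ} :
    ∫ t : ℝ, Complex.exp (u * t - (u + v) * spl t) = Complex.betaIntegral u v := by
  rw [Complex.betaIntegral, intervalIntegral.integral_of_le zero_le_one, ← integral_Ioc_eq_integral_Ioo.symm, ← sig_image,
    integral_image_eq_integral_abs_deriv_smul MeasurableSet.univ (fun t _ => (sig_deriv t).hasDerivWithinAt) sig_mono.injective.injOn,
    Measure.restrict_univ]
  simp only [beta_point]

/-- Fourier inversion for products of Gamma functions -/
lemma GG_fourier {A B : ℝ} (hA : 0 < A) (hB : 0 < B) (hi : Integrable (GG A B)) (t : ℝ) :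
    ∫ x : ℝ, GG A B x * Complex.exp (-(Complex.I * x * t)) = 2 * π * Complex.Gamma (A + B) * Complex.exp (A * t - (A + B) * spl t) := by
  have hAB : Complex.Gamma (A + B) ≠ 0 := Complex.Gamma_ne_zero_of_re_pos (by simp; positivity)
  set h : ℝ → ℂ := fun t => Complex.exp (A * t - (A + B) * spl t) with hh
  have hc : Continuous h := by
    have := spl_cont
    rw [hh]; fun_prop
  have hint : Integrable h := beta_line_int (u := A) (v := B) (by simpa) (by simpa)
  have hF : ∀ w : ℝ, (FourierTransformInv.fourierInv h : ℝ → ℂ) w = GG A B (2 * π * w) / Complex.Gamma (A + B) := by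
    intro w
    rw [Real.fourierInv_eq']
    have e1 : ∀ v : ℝ, Complex.exp (↑(2 * π * inner ℝ v w) * Complex.I) • h v =
        Complex.exp ((A + Complex.I * (2 * π * w : ℝ)) * v - ((A + Complex.I * (2 * π * w : ℝ)) + (B - Complex.I * (2 * π * w : ℝ))) * spl v) := by
      intro v
      rw [hh, smul_eq_mul, ← Complex.exp_add]
      congr 1
      simp only [RCLike.inner_apply, conj_trivial]
      push_cast; ring
    simp_rw [e1]
    rw [beta_line, eq_div_iff hAB, GG, Complex.Gamma_mul_Gamma_eq_betaIntegral (by simp [hA]) (by simp [hB]), mul_comm]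
    congr 2; ring
  have hFi : Integrable (FourierTransformInv.fourierInv h : ℝ → ℂ) := by
    have : (FourierTransformInv.fourierInv h : ℝ → ℂ) = fun w => GG A B ((2 * π) * w) / Complex.Gamma (A + B) := funext hF
    rw [this]
    exact ((integrable_comp_mul_left_iff (GG A B) (by positivity)).2 hi).div_const _
  have hFi' : Integrable (FourierTransform.fourier h : ℝ → ℂ) := by
    have : (FourierTransform.fourier h : ℝ → ℂ) = fun w => (FourierTransformInv.fourierInv h : ℝ → ℂ) (-w) := by
      ext w; rw [Real.fourierInv_eq_fourier_neg, neg_neg]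
    rw [this]; exact hFi.comp_neg
  have inv := hc.fourier_fourierInv_eq hint hFi'
  have inv2 := congrFun inv t
  rw [Real.fourier_eq'] at inv2
  have e2 : ∀ v : ℝ, Complex.exp (↑(-2 * π * inner ℝ v t) * Complex.I) • (FourierTransformInv.fourierInv h : ℝ → ℂ) v =
      (fun x : ℝ => GG A B x * Complex.exp (-(Complex.I * x * t))) ((2 * π) * v) / Complex.Gamma (A + B) := by
    intro v
    rw [hF, smul_eq_mul]
    simp only [RCLike.inner_apply, conj_trivial]
    rw [mul_comm, div_mul_eq_mul_div]
    congr 3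
    push_cast; ring
  simp_rw [e2] at inv2
  rw [integral_div, Measure.integral_comp_mul_left (fun x : ℝ => GG A B x * Complex.exp (-(Complex.I * x * t)))] at inv2
  rw [div_eq_iff hAB, abs_of_pos (by positivity), Complex.real_smul] at inv2
  have hpi : (π:ℂ) ≠ 0 := by exact_mod_cast Real.pi_ne_zero
  push_cast at inv2
  field_simp at inv2
  rw [inv2, hh]; ring

end BOP

namespace BOP

lemma Dec.of_cont {V : ℝ → ℂ} (hV : Continuous V) {C : ℝ} (hC : 0 ≤ C)
    (hb : ∀ x, 1 ≤ |x| → ‖V x‖ ≤ C * (Real.exp (-|x|) * |x| ^ (-(1/2):ℝ))) : Dec V := by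
  refine ⟨hV.aestronglyMeasurable, ?_⟩
  obtain ⟨M, hM⟩ := (isCompact_Icc (a := (-1:ℝ)) (b := 1)).exists_bound_of_continuousOn hV.continuousOn
  have hM0 : 0 ≤ M := (norm_nonneg _).trans (hM 0 (by norm_num))
  refine ⟨C + M * Real.exp 1, by positivity, fun x hx => ?_⟩
  have hx0 : 0 < |x| := abs_pos.2 hx
  set m := Real.exp (-|x|) * |x| ^ (-(1/2):ℝ) with hm
  have hm0 : 0 < m := by positivity
  rcases le_total 1 |x| with h | h
  · refine (hb x h).trans ?_
    gcongr
    have : 0 ≤ M * Real.exp 1 := by positivity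
    linarith
  · have h1 : 1 ≤ Real.exp 1 * m := by
      have h2 : 1 ≤ |x| ^ (-(1/2):ℝ) := Real.one_le_rpow_of_pos_of_le_one_of_nonpos hx0 h (by norm_num)
      have h3 : 1 ≤ Real.exp 1 * Real.exp (-|x|) := by
        rw [← Real.exp_add]; exact Real.one_le_exp (by linarith)
      rw [hm, ← mul_assoc]
      nlinarith
    have h4 := hM x (abs_le.1 h)
    calc ‖V x‖ ≤ M * 1 := by linarith
      _ ≤ M * (Real.exp 1 * m) := by gcongr
      _ ≤ _ := by nlinarith

lemma Dec.integrable {V : ℝ → ℂ} (h : Dec V) : Integrable V := by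
  simpa using h.int 1

lemma w0f_far {ν : ℝ} (h0 : 0 ≤ ν) (h1 : ν ≤ 1/2) : ∃ C > 0, ∀ x : ℝ, 1 ≤ |x| →
    ‖w0f ν x‖ ≤ C * (Real.exp (-(2*|x|)) * |x| ^ (-(1/2):ℝ)) := by
  obtain ⟨D, hD, hDx⟩ := w0_approx h0 h1 one_pos
  have key : ∀ x : ℝ, 1 ≤ x → ‖w0f ν x‖ ≤ (D + 2 * π) * (Real.exp (-(2*x)) * x ^ (-(1/2):ℝ)) := by
    intro x hx
    have hx0 : 0 < x := by linarith
    have e : x ^ (-(1/2):ℝ) = 1 / √x := by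
      rw [Real.rpow_neg hx0.le, ← Real.sqrt_eq_rpow, one_div]
    set m := Real.exp (-(π * x)) / √x with hm
    have hm0 : 0 ≤ m := by positivity
    have a1 := hDx x hx
    have a2 : ‖2 * π * Complex.exp (-(Complex.I * π * ν / 2)) * (m : ℝ)‖ = 2 * π * m := by
      rw [norm_mul, norm_mul, norm_mul, Complex.norm_real, Complex.norm_real, Complex.norm_exp]
      simp [abs_of_pos Real.pi_pos, abs_of_nonneg hm0]
    have a3 : ‖w0f ν x‖ ≤ D * (m / x) + 2 * π * m := by
      have := norm_add_le (w0f ν x - 2 * π * Complex.exp (-(Complex.I * π * ν / 2)) * (m : ℝ)) (2 * π * Complex.exp (-(Complex.I * π * ν / 2)) * (m : ℝ))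
      rw [sub_add_cancel, a2] at this
      linarith
    have a4 : m / x ≤ m := div_le_self hm0 hx
    have a5 : m ≤ Real.exp (-(2*x)) * (1 / √x) := by
      rw [hm, div_eq_mul_one_div]
      gcongr
      linarith [Real.pi_gt_three]
    rw [e]
    have : D * (m / x) ≤ D * m := by gcongr
    calc _ ≤ (D + 2 * π) * m := by linarith
      _ ≤ _ := by gcongr
  refine ⟨D + 2 * π, by positivity, fun x hx => ?_⟩
  rcases le_total 0 x with h | h
  · rw [abs_of_nonneg h] at hx ⊢; exact key x hx
  · rw [abs_of_nonpos h] at hx ⊢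
    have := key (-x) hx
    rwa [w0f_neg, RCLike.norm_conj] at this

lemma w0f_dec {ν : ℝ} (h0 : 0 ≤ ν) (h1 : ν < 1/2) : Dec (w0f ν) := by
  obtain ⟨C, hC, hb⟩ := w0f_far h0 h1.le
  refine Dec.of_cont (GG_cont (by linarith) (by linarith)) hC.le fun x hx => (hb x hx).trans ?_
  gcongr
  linarith [abs_nonneg x]

/-- Gamma shift -/
lemma GG_shift {ν x : ℝ} (hx : x ≠ 0) : GG (1/4 - ν/2 + 1) (1/4 + ν/2) x = (((1/4 - ν/2 : ℝ) : ℂ) + Complex.I * x) * w0f ν x := by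
  rw [w0f, GG, GG, ← mul_assoc, ← Complex.Gamma_add_one]
  · congr 2; push_cast; ring
  · intro h
    have := congrArg Complex.im h
    simp at this
    exact hx this

lemma GGs_dec {ν : ℝ} (h0 : 0 ≤ ν) (h1 : ν ≤ 1/2) : Dec (GG (1/4 - ν/2 + 1) (1/4 + ν/2)) := by
  obtain ⟨C, hC, hb⟩ := w0f_far h0 h1
  refine Dec.of_cont (GG_cont (by linarith) (by linarith)) (C := 2 * C) (by positivity) fun x hx => ?_
  have hx0 : x ≠ 0 := by rintro rfl; norm_num at hx
  rw [GG_shift hx0, norm_mul]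
  have a1 : ‖((1/4 - ν/2 : ℝ) : ℂ) + Complex.I * x‖ ≤ 2 * Real.exp |x| := by
    refine (norm_add_le _ _).trans ?_
    rw [norm_mul, Complex.norm_I, Complex.norm_real, Complex.norm_real, Real.norm_eq_abs, Real.norm_eq_abs, abs_of_nonneg (by linarith)]
    have := Real.add_one_le_exp |x|
    linarith
  calc _ ≤ 2 * Real.exp |x| * (C * (Real.exp (-(2*|x|)) * |x| ^ (-(1/2):ℝ))) := by
        gcongr; exact hb x hx
    _ = 2 * C * (Real.exp |x| * Real.exp (-(2*|x|)) * |x| ^ (-(1/2):ℝ)) := by ring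
    _ = _ := by rw [← Real.exp_add]; ring_nf

/-- `x` times the model weight -/
noncomputable def xw (ν x : ℝ) : ℂ := -Complex.I * (GG (1/4 - ν/2 + 1) (1/4 + ν/2) x - ((1/4 - ν/2 : ℝ) : ℂ) * w0f ν x)

lemma xw_eq {ν x : ℝ} (hx : x ≠ 0) : xw ν x = x * w0f ν x := by
  rw [xw, GG_shift hx]
  linear_combination (-(x * w0f ν x)) * Complex.I_sq

lemma Dec.smul {V : ℝ → ℂ} (h : Dec V) (c : ℂ) : Dec (fun x => c * V x) := by
  refine ⟨h.meas.const_mul c, ?_⟩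
  obtain ⟨C, hC, hb⟩ := h.bd
  refine ⟨‖c‖ * C, by positivity, fun x hx => ?_⟩
  rw [norm_mul, mul_assoc]
  gcongr; exact hb x hx

lemma Dec.sub {V U : ℝ → ℂ} (h : Dec V) (h' : Dec U) : Dec (fun x => V x - U x) := by
  refine ⟨h.meas.sub h'.meas, ?_⟩
  obtain ⟨C, hC, hb⟩ := h.bd
  obtain ⟨C', hC', hb'⟩ := h'.bd
  refine ⟨C + C', by positivity, fun x hx => ?_⟩
  have := norm_sub_le (V x) (U x)
  have := hb x hx
  have := hb' x hx
  rw [add_mul]; linarith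

lemma aw0_dec {ν : ℝ} (h0 : 0 ≤ ν) (h1 : ν ≤ 1/2) : Dec (fun x => ((1/4 - ν/2 : ℝ) : ℂ) * w0f ν x) := by
  rcases h1.lt_or_eq with h | h
  · exact (w0f_dec h0 h).smul _
  · have : (1/4 - ν/2 : ℝ) = 0 := by linarith
    simp only [this, Complex.ofReal_zero, zero_mul]
    exact ⟨aestronglyMeasurable_const, 0, le_rfl, by simp⟩

lemma xw_dec {ν : ℝ} (h0 : 0 ≤ ν) (h1 : ν ≤ 1/2) : Dec (xw ν) := ((GGs_dec h0 h1).sub (aw0_dec h0 h1)).smul _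

/-- transform of the model weight -/
noncomputable def fν (ν t : ℝ) : ℂ := Complex.exp (((1/4 - ν/2 : ℝ) : ℂ) * t - 1/2 * spl t)

lemma tanh_half (t : ℝ) : Real.tanh (t/2) = 2 * Real.exp (t - spl t) - 1 := by
  rw [Real.tanh_eq_sinh_div_cosh, Real.sinh_eq, Real.cosh_eq, Real.exp_sub, spl_exp]
  have e : Real.exp t = Real.exp (t/2) * Real.exp (t/2) := by rw [← Real.exp_add]; ring_nf
  have e2 : Real.exp (-(t/2)) * Real.exp (t/2) = 1 := by rw [← Real.exp_add]; simp
  rw [e, Real.exp_neg]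
  have := Real.exp_pos (t/2)
  field_simp
  ring

lemma fν_deriv (ν t : ℝ) : HasDerivAt (fν ν) (fν ν t * (-(ν/2) - (Real.tanh (t/2) : ℝ) / 4)) t := by
  have h1 : HasDerivAt (fun t : ℝ => ((1/4 - ν/2 : ℝ) : ℂ) * t - 1/2 * spl t)
      (((1/4 - ν/2 : ℝ) : ℂ) * 1 - 1/2 * (Real.exp (t - spl t) : ℝ)) t :=
    (((hasDerivAt_id t).ofReal_comp).const_mul _).sub (((spl_deriv t).ofReal_comp).const_mul _)
  refine h1.cexp.congr_deriv ?_
  rw [tanh_half, fν]; push_cast; ring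

lemma w0f_FT {ν : ℝ} (h0 : 0 ≤ ν) (h1 : ν < 1/2) (t : ℝ) :
    ∫ x : ℝ, w0f ν x * Complex.exp (-(Complex.I * x * t)) = 2 * π * (√π : ℝ) * fν ν t := by
  have h := GG_fourier (A := 1/4 - ν/2) (B := 1/4 + ν/2) (by linarith) (by linarith) (w0f_dec h0 h1).integrable t
  simp only [w0f]
  rw [h]
  have e : (((1/4 - ν/2 : ℝ) : ℂ) + ((1/4 + ν/2 : ℝ) : ℂ)) = 1/2 := by push_cast; ring
  rw [e, Complex.Gamma_one_half_eq, fν]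
  congr 2
  rw [Real.sqrt_eq_rpow, Complex.ofReal_cpow Real.pi_pos.le]; norm_num

lemma xw_FT {ν : ℝ} (h0 : 0 ≤ ν) (h1 : ν ≤ 1/2) (t : ℝ) :
    ∫ x : ℝ, xw ν x * Complex.exp (-(Complex.I * x * t)) =
      Complex.I * (2 * π * (√π : ℝ)) * (fν ν t * (-(ν/2) - (Real.tanh (t/2) : ℝ) / 4)) := by
  have i1 := (GGs_dec h0 h1).intosc 1 t
  have i2 := (aw0_dec h0 h1).intosc 1 t
  simp only [Polynomial.eval_one, one_mul] at i1 i2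
  have hA := GG_fourier (A := 1/4 - ν/2 + 1) (B := 1/4 + ν/2) (by linarith) (by linarith) (GGs_dec h0 h1).integrable t
  have hB : ∫ x : ℝ, ((1/4 - ν/2 : ℝ) : ℂ) * w0f ν x * Complex.exp (-(Complex.I * x * t))
      = ((1/4 - ν/2 : ℝ) : ℂ) * (2 * π * (√π : ℝ) * fν ν t) := by
    rcases h1.lt_or_eq with h | h
    · simp_rw [mul_assoc ((1/4 - ν/2 : ℝ) : ℂ)]
      rw [integral_const_mul, w0f_FT h0 h]
    · have : (1/4 - ν/2 : ℝ) = 0 := by linarith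
      rw [this]; simp
  have hX : ∀ x : ℝ, xw ν x * Complex.exp (-(Complex.I * x * t)) = -Complex.I * (GG (1/4 - ν/2 + 1) (1/4 + ν/2) x * Complex.exp (-(Complex.I * x * t))
      - ((1/4 - ν/2 : ℝ) : ℂ) * w0f ν x * Complex.exp (-(Complex.I * x * t))) := by
    intro x; rw [xw]; ring
  simp_rw [hX]
  rw [integral_const_mul, integral_sub i1 i2, hA, hB]
  have e : (((1/4 - ν/2 + 1: ℝ) : ℂ) + ((1/4 + ν/2 : ℝ) : ℂ)) = 1/2 + 1 := by push_cast; ring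
  have e3 : Complex.exp ((1/4 - ν/2 + 1: ℝ) * t - (1/2 + 1) * spl t) = fν ν t * (Real.exp (t - spl t) : ℝ) := by
    rw [fν, Complex.ofReal_exp, ← Complex.exp_add]; congr 1; push_cast; ring
  have e4 : Complex.Gamma (1/2 + 1) = 1/2 * (√π : ℝ) := by
    rw [Complex.Gamma_add_one _ (by norm_num), Complex.Gamma_one_half_eq]
    congr 1
    rw [Real.sqrt_eq_rpow, Complex.ofReal_cpow Real.pi_pos.le]; norm_num
  rw [e, e3, e4, tanh_half]
  push_cast; ring

lemma divX_ev (r : Polynomial ℂ) (x : ℂ) : r.eval x - r.eval 0 = x * r.divX.eval x := by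
  have := congrArg (Polynomial.eval x) (Polynomial.X_mul_divX_add r)
  simp only [Polynomial.eval_add, Polynomial.eval_mul, Polynomial.eval_X, Polynomial.eval_C, Polynomial.coeff_zero_eq_eval_zero] at this
  linear_combination -this

/-- regularized functional -/
noncomputable def Lam (ν : ℝ) (q : Polynomial ℂ) (t : ℝ) : ℂ :=
  q.eval 0 * (2 * π * (√π : ℝ) * fν ν t) + FT (xw ν) q.divX t

lemma Lam_orth {ν : ℝ} (h0 : 0 ≤ ν) (h1 : ν ≤ 1/2) (k : ℕ) (q : Polynomial ℂ) (hq : q.degree < k) :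
    Lam ν (q * mp (Complex.I * ((ν/2 : ℝ) : ℂ)) k) 0 = 0 := by
  have hd := xw_dec h0 h1
  refine mp_transform ν (Lam ν) ?_ ?_ ?_ (fun t => 2 * π * (√π : ℝ) * fν ν t) ?_ ?_ k q hq
  · intro p q t
    rw [Lam, Lam, Lam, Polynomial.divX_add, FT_add hd, Polynomial.eval_add]; ring
  · intro c q t
    have : (c • q).divX = c • q.divX := by
      rw [Polynomial.smul_eq_C_mul, Polynomial.divX_C_mul, Polynomial.smul_eq_C_mul]
    rw [Lam, Lam, this, FT_smul, Polynomial.eval_smul, smul_eq_mul]; ring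
  · intro q t
    have d1 := (((fν_deriv ν t).const_mul (2 * π * (√π : ℝ) : ℂ)).const_mul (q.eval 0)).add (hd.FT_deriv q.divX t)
    refine d1.congr_deriv ?_
    have e1 : FT (xw ν) q t = FT (xw ν) (Polynomial.X * q.divX) t + q.eval 0 * FT (xw ν) 1 t := by
      rw [← FT_smul, ← FT_add hd]
      congr 1
      conv_lhs => rw [← Polynomial.X_mul_divX_add q]
      rw [Polynomial.smul_eq_C_mul, mul_one, Polynomial.coeff_zero_eq_eval_zero]
    have e2 : FT (xw ν) 1 t = Complex.I * (2 * π * (√π : ℝ)) * (fν ν t * (-(ν/2) - (Real.tanh (t/2) : ℝ) / 4)) := by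
      rw [← xw_FT h0 h1, FT]; simp
    have e3 : (Polynomial.X * q).divX = q := by
      ext n; simp [Polynomial.coeff_divX]
    rw [Lam, e3, e1, e2]
    simp only [Polynomial.eval_mul, Polynomial.eval_X, zero_mul, zero_add]
    generalize (Real.tanh (t/2) : ℝ) = T
    linear_combination (q.eval 0 * (2 * π * (√π : ℝ)) * (fν ν t * (-(ν/2) - T / 4))) * Complex.I_sq
  · intro t
    refine ((fν_deriv ν t).const_mul (2 * π * (√π : ℝ) : ℂ)).congr_deriv ?_
    ring
  · intro t
    rw [Lam]; simp [FT]

lemma w0_orth {ν : ℝ} (h0 : 0 ≤ ν) (h1 : ν ≤ 1/2) (n : ℕ) (q : Polynomial ℂ) (hq : q.degree < (n : ℕ)) :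
    (2 * π * (√π : ℝ) * fν ν 0) * (q * mp (Complex.I * ((ν/2 : ℝ) : ℂ)) n).eval 0
      + ∫ x : ℝ, ((q * mp (Complex.I * ((ν/2 : ℝ) : ℂ)) n).eval (x : ℂ) - (q * mp (Complex.I * ((ν/2 : ℝ) : ℂ)) n).eval 0) * w0f ν x = 0 := by
  have h := Lam_orth h0 h1 n q hq
  rw [Lam, mul_comm] at h
  convert h using 2
  rw [FT]
  apply integral_congr_ae
  have : ∀ᵐ x : ℝ, x ≠ 0 := by simp [ae_iff]
  filter_upwards [this] with x hx
  set r := q * mp (Complex.I * ((ν/2 : ℝ) : ℂ)) n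
  rw [xw_eq hx]
  rw [divX_ev]
  simp; ring

lemma w0_int {ν : ℝ} (h0 : 0 ≤ ν) (h1 : ν ≤ 1/2) (r : Polynomial ℂ) :
    Integrable (fun x : ℝ => (r.eval (x : ℂ) - r.eval 0) * w0f ν x) := by
  refine ((xw_dec h0 h1).int r.divX).congr ?_
  have : ∀ᵐ x : ℝ, x ≠ 0 := by simp [ae_iff]
  filter_upwards [this] with x hx
  rw [xw_eq hx]
  rw [divX_ev]
  ring

lemma w1_dec : Dec (fun x => ((w1 x : ℝ) : ℂ)) := by
  have := w0f_dec (ν := 0) le_rfl (by norm_num)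
  have e : w0f 0 = fun x => ((w1 x : ℝ) : ℂ) := funext w0f_zero
  rwa [e] at this

lemma w1_adm : Adm w1 := by
  refine ⟨fun x => (w1_pos x).le, w1_dec.int, fun k => ?_⟩
  have h := mp_transform 0 (FT (fun x => ((w1 x : ℝ) : ℂ))) (fun p q t => FT_add w1_dec p q t) (fun c q t => FT_smul c q t)
    (fun q t => w1_dec.FT_deriv q t) (fun t => 2 * π * (√π : ℝ) * fν 0 t) (fun t => by
      refine ((fν_deriv 0 t).const_mul (2 * π * (√π : ℝ) : ℂ)).congr_deriv ?_
      ring) (fun t => by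
      rw [← w0f_FT le_rfl (by norm_num), FT]
      simp [w0f_zero]) (k+1) 1 (by rw [Polynomial.degree_one]; exact_mod_cast Nat.succ_pos k)
  simpa [FT] using h

end BOP

namespace BOP

lemma bK_smeas (ν : ℝ) : Measurable (bK ν) := by
  have h : StronglyMeasurable (Function.uncurry fun y t : ℝ => Real.exp (-y * Real.cosh t) * Real.cosh (ν * t)) := by
    apply Continuous.stronglyMeasurable
    unfold Function.uncurry
    fun_prop
  have := h.integral_prod_right (ν := volume.restrict (Set.Ioi 0))
  exact this.measurable

lemma sign_meas : Measurable Real.sign := by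
  unfold Real.sign
  refine Measurable.ite measurableSet_Iio measurable_const ?_
  exact Measurable.ite measurableSet_Ioi measurable_const measurable_const

lemma Wf_meas (ν : ℝ) : Measurable (Wf ν) := by
  unfold Wf
  have h1 := sign_meas
  have h2 := (bK_smeas ν).comp (g := bK ν) (f := fun x : ℝ => π * |x|) (by fun_prop)
  refine Measurable.mul ?_ (Complex.measurable_ofReal.comp h2)
  exact Complex.measurable_exp.comp ((Complex.measurable_ofReal.comp h1).const_mul _)

lemma Wf_norm (ν x : ℝ) : ‖Wf ν x‖ = bK ν (π * |x|) := by
  rw [Wf, norm_mul, Complex.norm_exp, Complex.norm_real, Real.norm_eq_abs, abs_of_nonneg (bK_nonneg _ _)]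
  simp

lemma Wf_re {ν x : ℝ} (hx : x ≠ 0) : (Wf ν x).re = Real.cos (π * ν / 2) * bK ν (π * |x|) := by
  rw [Wf, Complex.re_mul_ofReal, Complex.exp_re]
  rcases lt_or_gt_of_ne hx with h | h
  · rw [Real.sign_of_neg h]; simp
  · rw [Real.sign_of_pos h]; simp

lemma Wf_dec {ν : ℝ} (h0 : 0 ≤ ν) (h1 : ν ≤ 1/2) : Dec (Wf ν) := by
  refine ⟨(Wf_meas ν).aestronglyMeasurable, 1, zero_le_one, fun x hx => ?_⟩
  have hx0 : 0 < |x| := abs_pos.2 hx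
  have hp := Real.pi_gt_three
  rw [Wf_norm, one_mul]
  refine (bK_upper h0 h1 (by positivity)).trans ?_
  rw [mul_comm, Real.rpow_neg hx0.le, ← Real.sqrt_eq_rpow, ← Real.sqrt_inv]
  have e1 : π / (2 * (π * |x|)) ≤ |x|⁻¹ := by
    rw [inv_eq_one_div, div_le_div_iff₀ (by positivity) hx0]; nlinarith
  have e2 : -(π * |x|) ≤ -|x| := by nlinarith
  gcongr

lemma w1_intpos : 0 < ∫ x, w1 x := by
  have hi : Integrable w1 := by
    have := w1_dec.integrable.re
    simpa using this
  rw [integral_pos_iff_support_of_nonneg (fun x => (w1_pos x).le) hi]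
  have : Function.support w1 = Set.univ := by
    ext x; simp [(w1_pos x).ne']
  rw [this]; simp

lemma Wf_coer {ν : ℝ} (h0 : 0 ≤ ν) (h1 : ν ≤ 1/2) : ∃ c > 0, ∀ q : Polynomial ℂ,
    c * nsq w1 q ≤ ‖∫ x : ℝ, (q * pconj q).eval (x : ℂ) * Wf ν x‖ := by
  obtain ⟨c, hc, C, hC, hw⟩ := w1_bounds
  obtain ⟨d, hd, hb⟩ := bK_lower' h0 h1
  have hcos : 0 < Real.cos (π * ν / 2) := by
    apply Real.cos_pos_of_mem_Ioo
    constructor <;> nlinarith [Real.pi_pos]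
  refine ⟨Real.cos (π * ν / 2) * d / (2 * C), by positivity, fun q => ?_⟩
  refine le_trans ?_ ((le_abs_self _).trans (Complex.abs_re_le_norm _))
  have hI := (Wf_dec h0 h1).int (q * pconj q)
  have e : (∫ x : ℝ, (q * pconj q).eval (x : ℂ) * Wf ν x).re = ∫ x : ℝ, ((q * pconj q).eval (x : ℂ) * Wf ν x).re := (integral_re hI).symm
  rw [e, nsq, ← integral_const_mul]
  refine integral_mono_ae ((w1_adm.intsq q).const_mul _) hI.re ?_
  have : ∀ᵐ x : ℝ, x ≠ 0 := by simp [ae_iff]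
  filter_upwards [this] with x hx
  have hx0 : 0 < |x| := abs_pos.2 hx
  rw [mul_pconj_eval, Complex.re_ofReal_mul, Wf_re hx]
  have b1 := hb (π * |x|) (by positivity)
  have b2 := (hw x).2
  have b3 : ph x / 2 ≤ Real.exp (-(π * |x|)) / √(1 + π * |x|) := by
    rw [ph, div_div]
    gcongr
    rw [show (2:ℝ) = √4 by rw [show (4:ℝ) = 2 ^ 2 by norm_num]; simp, ← Real.sqrt_mul (by positivity)]
    apply Real.sqrt_le_sqrt
    nlinarith [Real.pi_le_four]
  have b4 : d / (2 * C) * w1 x ≤ bK ν (π * |x|) := by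
    calc d / (2 * C) * w1 x ≤ d / (2 * C) * (C * ph x) := by gcongr
      _ = d * (ph x / 2) := by field_simp
      _ ≤ d * (Real.exp (-(π * |x|)) / √(1 + π * |x|)) := by gcongr
      _ ≤ _ := b1
  calc Real.cos (π * ν / 2) * d / (2 * C) * (‖q.eval (x:ℂ)‖ ^ 2 * w1 x)
      = ‖q.eval (x:ℂ)‖ ^ 2 * (Real.cos (π * ν / 2) * (d / (2 * C) * w1 x)) := by ring
    _ ≤ _ := by gcongr

lemma cmp_inst {ν : ℝ} (h0 : 0 < ν) (h1 : ν ≤ 1/2) : ∃ κ0 κ1 : ℂ, ∃ c C : ℝ, Cmp (ν/2) (ν/16) w1 (Wf ν) (w0f ν) κ0 κ1 c C := by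
  obtain ⟨c, hc, hcb⟩ := Wf_coer h0.le h1
  obtain ⟨C, hC, hCb⟩ := far_bound h0.le h1 (ρ := ν/16) (by linarith)
  refine ⟨((1 / (2 * √2 * π) : ℝ) : ℂ), 2 * π * (√π : ℝ) * fν ν 0, c, C, ?_⟩
  refine { adm := w1_adm, wpos := w1_intpos, α0 := by linarith, α1 := by linarith, ρ0 := by linarith, ρ1 := by linarith, cpos := hc, Cpos := hC
           Wint := (Wf_dec h0.le h1).int, coer := hcb, w0int := w0_int h0.le h1, w0far := ?_, w0orth := w0_orth h0.le h1, far := hCb }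
  have hd := (xw_dec h0.le h1).integrable
  have hm : MeasurableSet {x : ℝ | ν/16 < |x|} := measurableSet_lt measurable_const (by fun_prop)
  have hρ : 0 < ν/16 := by linarith
  have e : Set.EqOn (fun x : ℝ => ((x⁻¹ : ℝ) : ℂ) * xw ν x) (w0f ν) {x : ℝ | ν/16 < |x|} := by
    intro x hx
    have hx0 : x ≠ 0 := by
      rintro rfl
      simp at hx; linarith
    have : (x:ℂ) ≠ 0 := by exact_mod_cast hx0
    simp only [xw_eq hx0]
    push_cast; field_simp
  refine IntegrableOn.congr_fun ?_ e hm
  refine Integrable.mono' (g := fun x => 16/ν * ‖xw ν x‖) ((hd.norm.const_mul _).integrableOn) ?_ ?_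
  · exact ((by fun_prop : Measurable fun x : ℝ => ((x⁻¹ : ℝ) : ℂ)).aestronglyMeasurable.mul hd.aestronglyMeasurable).restrict
  · rw [ae_restrict_iff' hm]
    refine Eventually.of_forall fun x hx => ?_
    have hx' : ν/16 < |x| := hx
    rw [norm_mul, Complex.norm_real, Real.norm_eq_abs, abs_inv]
    gcongr
    rw [inv_eq_one_div, div_le_div_iff₀ (by linarith) h0]
    linarith

end BOP

namespace BOP

lemma exp_spl_two (j : ℕ) (ν t : ℝ) :
    Real.exp ((j + 1 + ν)/2 * (2 * t) - (j+1) * spl (2 * t)) = (Real.exp (ν * t) / Real.cosh t ^ (j+1)) / 2 ^ (j+1) := by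
  rw [Real.exp_sub]
  have e1 : Real.exp ((j+1) * spl (2*t)) = (Real.exp t * (2 * Real.cosh t)) ^ (j+1) := by
    rw [show ((j:ℝ)+1) * spl (2*t) = ((j+1 : ℕ) : ℝ) * spl (2*t) by push_cast; ring, Real.exp_nat_mul, spl_exp, Real.cosh_eq]
    congr 1
    have e2 : Real.exp (2*t) = Real.exp t * Real.exp t := by rw [← Real.exp_add]; ring_nf
    rw [e2, Real.exp_neg]
    have := Real.exp_pos t
    field_simp
    ring
  have e3 : Real.exp ((j + 1 + ν)/2 * (2 * t)) = Real.exp (ν * t) * Real.exp t ^ (j+1) := by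
    rw [← Real.exp_nat_mul, ← Real.exp_add]; congr 1; push_cast; ring
  rw [e1, e3, mul_pow, mul_pow]
  have := Real.exp_pos t
  have := Real.cosh_pos t
  field_simp

lemma cosh_line {ν : ℝ} (h0 : 0 ≤ ν) (h1 : ν < 1) (j : ℕ) :
    Integrable (fun t : ℝ => Real.exp (ν * t) / Real.cosh t ^ (j+1)) ∧
    ∫ t : ℝ, Real.exp (ν * t) / Real.cosh t ^ (j+1) = 2 ^ j * (Real.Gamma ((1 + ν + j)/2) * Real.Gamma ((1 - ν + j)/2)) / (j.factorial : ℝ) := by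
  set u : ℝ := (j + 1 + ν)/2 with hu
  set v : ℝ := (j + 1 - ν)/2 with hv
  have hu0 : 0 < u := by positivity
  have hv0 : 0 < v := by
    have : (0:ℝ) ≤ j := Nat.cast_nonneg j
    rw [hv]; linarith
  have huv : u + v = j + 1 := by rw [hu, hv]; ring
  have hk : ∀ t : ℝ, Complex.exp ((u:ℂ) * t - ((u:ℂ) + v) * spl t) = ((Real.exp (u * t - (j+1) * spl t) : ℝ) : ℂ) := by
    intro t; rw [← huv]; push_cast; rfl
  have i1 := beta_line_int (u := u) (v := v) (by simpa) (by simpa)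
  have i2 := beta_line (u := u) (v := v)
  simp_rw [hk] at i1 i2
  have i3 : Integrable (fun t : ℝ => Real.exp (u * t - (j+1) * spl t)) := by
    refine i1.re.congr (Eventually.of_forall fun t => ?_)
    exact Complex.ofReal_re _
  rw [integral_complex_ofReal] at i2
  have hG : Complex.betaIntegral u v = ((Real.Gamma u * Real.Gamma v / (j.factorial : ℝ) : ℝ) : ℂ) := by
    have h := Complex.Gamma_mul_Gamma_eq_betaIntegral (s := u) (t := v) (by simpa) (by simpa)
    rw [show ((u:ℂ) + v) = (j:ℂ) + 1 by rw [← Complex.ofReal_add, huv]; push_cast; rfl, Complex.Gamma_nat_eq_factorial,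
      Complex.Gamma_ofReal, Complex.Gamma_ofReal] at h
    have : (j.factorial : ℂ) ≠ 0 := by exact_mod_cast j.factorial_ne_zero
    push_cast
    rw [h]; field_simp
  rw [hG] at i2
  have i2' : ∫ t : ℝ, Real.exp (u * t - (j+1) * spl t) = Real.Gamma u * Real.Gamma v / (j.factorial : ℝ) := by exact_mod_cast i2
  have e : ∀ t : ℝ, Real.exp (ν * t) / Real.cosh t ^ (j+1) = 2 ^ (j+1) * (fun t : ℝ => Real.exp (u * t - (j+1) * spl t)) (2 * t) := by
    intro t
    simp only [hu]
    rw [exp_spl_two]; field_simp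
  simp_rw [e]
  refine ⟨((integrable_comp_mul_left_iff (fun t : ℝ => Real.exp (u * t - (j+1) * spl t)) two_ne_zero).2 i3).const_mul _, ?_⟩
  rw [integral_const_mul, Measure.integral_comp_mul_left (fun t : ℝ => Real.exp (u * t - (j+1) * spl t)), i2',
    show (1 + ν + j)/2 = u by rw [hu]; ring, show (1 - ν + j)/2 = v by rw [hv]; ring, pow_succ]
  simp
  ring

lemma cosh_halfline {ν : ℝ} (h0 : 0 ≤ ν) (h1 : ν < 1) (j : ℕ) :
    IntegrableOn (fun t : ℝ => Real.cosh (ν * t) / Real.cosh t ^ (j+1)) (Set.Ioi 0) ∧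
    ∫ t in Set.Ioi (0:ℝ), Real.cosh (ν * t) / Real.cosh t ^ (j+1) = 2 ^ j * (Real.Gamma ((1 + ν + j)/2) * Real.Gamma ((1 - ν + j)/2)) / (j.factorial : ℝ) / 2 := by
  obtain ⟨i1, i2⟩ := cosh_line h0 h1 j
  set f : ℝ → ℝ := fun t => Real.exp (ν * t) / Real.cosh t ^ (j+1) with hf
  have i3 : Integrable (fun t => f (-t)) := i1.comp_neg
  have e : ∀ t : ℝ, Real.cosh (ν * t) / Real.cosh t ^ (j+1) = (f t + f (-t)) / 2 := by
    intro t
    rw [hf]; simp only [Real.cosh_neg]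
    rw [Real.cosh_eq, mul_neg]; ring
  simp_rw [e]
  refine ⟨((i1.add i3).div_const 2).integrableOn, ?_⟩
  rw [integral_div, integral_add i1.integrableOn i3.integrableOn]
  congr 1
  rw [← i2, integral_comp_neg_Ioi, neg_zero, add_comm, ← setIntegral_union (Set.Iic_disjoint_Ioi le_rfl) measurableSet_Ioi i1.integrableOn i1.integrableOn,
    Set.Iic_union_Ioi, Measure.restrict_univ]

lemma gam_int (j : ℕ) {r : ℝ} (hr : 0 < r) : IntegrableOn (fun y : ℝ => y ^ j * Real.exp (-y * r)) (Set.Ioi 0) ∧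
    ∫ y in Set.Ioi (0:ℝ), y ^ j * Real.exp (-y * r) = (j.factorial : ℝ) / r ^ (j+1) := by
  have h := Real.integral_rpow_mul_exp_neg_mul_Ioi (a := j + 1) (r := r) (by positivity) hr
  have e : ∀ y : ℝ, y ^ ((j:ℝ) + 1 - 1) * Real.exp (-(r * y)) = y ^ j * Real.exp (-y * r) := by
    intro y; rw [add_sub_cancel_right, Real.rpow_natCast]; congr 2; ring
  simp_rw [e] at h
  have h2 : (1/r) ^ ((j:ℝ) + 1) * Real.Gamma (j+1) = (j.factorial : ℝ) / r ^ (j+1) := by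
    rw [Real.Gamma_nat_eq_factorial, show (j:ℝ) + 1 = ((j+1 : ℕ) : ℝ) by push_cast; rfl, Real.rpow_natCast]
    rw [one_div, inv_pow]; ring
  rw [h2] at h
  refine ⟨?_, h⟩
  by_contra hn
  have := integral_undef hn
  rw [h] at this
  have h3 : 0 < (j.factorial : ℝ) / r ^ (j+1) := by have := j.factorial_pos; positivity
  linarith

lemma bK_moment {ν : ℝ} (h0 : 0 ≤ ν) (h1 : ν < 1) (j : ℕ) :
    ∫ y in Set.Ioi (0:ℝ), y ^ j * bK ν y = 2 ^ j * (Real.Gamma ((1 + ν + j)/2) * Real.Gamma ((1 - ν + j)/2)) / 2 := by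
  obtain ⟨i1, i2⟩ := cosh_halfline h0 h1 j
  have hin : Integrable (Function.uncurry fun y t : ℝ => y ^ j * (Real.exp (-y * Real.cosh t) * Real.cosh (ν * t)))
      ((volume.restrict (Set.Ioi 0)).prod (volume.restrict (Set.Ioi 0))) := by
    have hc : Continuous (Function.uncurry fun y t : ℝ => y ^ j * (Real.exp (-y * Real.cosh t) * Real.cosh (ν * t))) := by
      unfold Function.uncurry; fun_prop
    rw [integrable_prod_iff' hc.aestronglyMeasurable]
    constructor
    · refine Eventually.of_forall fun t => ?_
      have := (gam_int j (Real.cosh_pos t)).1.mul_const (Real.cosh (ν * t))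
      simpa only [Function.uncurry, mul_assoc] using this
    · have : ∀ t : ℝ, ∫ y in Set.Ioi (0:ℝ), ‖Function.uncurry (fun y t : ℝ => y ^ j * (Real.exp (-y * Real.cosh t) * Real.cosh (ν * t))) (y, t)‖
          = (j.factorial : ℝ) * (Real.cosh (ν * t) / Real.cosh t ^ (j+1)) := by
        intro t
        rw [← mul_div_assoc, mul_div_right_comm, ← (gam_int j (Real.cosh_pos t)).2, ← integral_mul_const]
        refine setIntegral_congr_fun measurableSet_Ioi fun y hy => ?_
        have hy : 0 < y := hy
        have := Real.cosh_pos (ν * t)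
        simp only [Function.uncurry]
        rw [Real.norm_of_nonneg (by positivity)]; ring
      simp_rw [this]
      exact i1.const_mul _
  have hsw := integral_integral_swap hin
  have e1 : ∀ y : ℝ, ∫ t in Set.Ioi (0:ℝ), y ^ j * (Real.exp (-y * Real.cosh t) * Real.cosh (ν * t)) = y ^ j * bK ν y := by
    intro y; rw [integral_const_mul]; rfl
  have e2 : ∀ t : ℝ, ∫ y in Set.Ioi (0:ℝ), y ^ j * (Real.exp (-y * Real.cosh t) * Real.cosh (ν * t)) = (j.factorial : ℝ) * (Real.cosh (ν * t) / Real.cosh t ^ (j+1)) := by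
    intro t
    simp_rw [← mul_assoc]
    rw [integral_mul_const, (gam_int j (Real.cosh_pos t)).2]; ring
  simp_rw [e1, e2] at hsw
  rw [hsw, integral_const_mul, i2]
  have : (j.factorial : ℝ) ≠ 0 := by exact_mod_cast j.factorial_ne_zero
  field_simp

lemma moment_eq {ν : ℝ} (h0 : 0 < ν) (h1 : ν ≤ 1/2) (j : ℕ) :
    ∫ x : ℝ, (Complex.I * π * x) ^ j * Wf ν x = (besselMoment ν j : ℂ) := by
  set f : ℝ → ℂ := fun x => (Complex.I * π * x) ^ j * Wf ν x with hf
  have hi : Integrable f := by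
    have := ((Wf_dec h0.le h1).int (Polynomial.X ^ j)).const_mul ((Complex.I * π) ^ j)
    refine this.congr (Eventually.of_forall fun x => ?_)
    simp [hf, mul_pow]; ring
  have hneg : ∀ x, f (-x) = (starRingEnd ℂ) (f x) := by
    intro x
    simp only [hf, Wf_neg, map_mul, map_pow, Complex.conj_ofReal, Complex.conj_I]
    push_cast; ring
  have e1 : ∫ x, f x = (∫ x in Set.Ioi (0:ℝ), f (-x)) + ∫ x in Set.Ioi (0:ℝ), f x := by
    rw [integral_comp_neg_Ioi, neg_zero, ← setIntegral_union (Set.Iic_disjoint_Ioi le_rfl) measurableSet_Ioi hi.integrableOn hi.integrableOn,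
      Set.Iic_union_Ioi, Measure.restrict_univ]
  simp_rw [hneg] at e1
  rw [integral_conj] at e1
  have e2 : ∫ x in Set.Ioi (0:ℝ), f x = Complex.I ^ j * Complex.exp (-(Complex.I * π * ν / 2)) * ((π⁻¹ * (2 ^ j * (Real.Gamma ((1 + ν + j)/2) * Real.Gamma ((1 - ν + j)/2)) / 2) : ℝ) : ℂ) := by
    have e3 : ∫ x in Set.Ioi (0:ℝ), f x = ∫ x in Set.Ioi (0:ℝ), Complex.I ^ j * Complex.exp (-(Complex.I * π * ν / 2)) * (((fun y : ℝ => y ^ j * bK ν y) (π * x) : ℝ) : ℂ) := by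
      refine setIntegral_congr_fun measurableSet_Ioi fun x hx => ?_
      have hx : 0 < x := hx
      simp only [hf, Wf]
      rw [Real.sign_of_pos hx, abs_of_pos hx]
      push_cast; ring_nf
    rw [e3, integral_const_mul, integral_complex_ofReal, integral_comp_mul_left_Ioi (fun y : ℝ => y ^ j * bK ν y) 0 Real.pi_pos, mul_zero,
      bK_moment h0.le (by linarith) j, smul_eq_mul]
  rw [e2] at e1
  rw [e1]
  set A : ℝ := (π⁻¹ * (2 ^ j * (Real.Gamma ((1 + ν + j)/2) * Real.Gamma ((1 - ν + j)/2)) / 2)) with hA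
  have e4 : Complex.I ^ j * Complex.exp (-(Complex.I * π * ν / 2)) = Complex.exp (((π * (j - ν) / 2 : ℝ) : ℂ) * Complex.I) := by
    have e5 : Complex.I ^ j = Complex.exp ((j:ℂ) * (π / 2 * Complex.I)) := by
      rw [Complex.exp_nat_mul, Complex.exp_pi_div_two_mul_I]
    rw [e5, ← Complex.exp_add]
    congr 1; push_cast; ring
  rw [e4, map_mul, Complex.conj_ofReal, ← Complex.exp_conj, map_mul, Complex.conj_ofReal, Complex.conj_I, ← add_mul, add_comm, mul_neg, ← neg_mul, ← Complex.two_cos,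
    ← Complex.ofReal_cos, besselMoment]
  -- reflection
  set s : ℝ := (1 + ν - j)/2 with hs
  have hr := Real.Gamma_mul_Gamma_one_sub s
  have h1s : 1 - s = (1 - ν + j)/2 := by rw [hs]; ring
  have hsin : Real.sin (π * s) = Real.cos (π * (j - ν)/2) := by
    rw [hs, ← Real.cos_pi_div_two_sub]; congr 1; ring
  have hg1 : 0 < Real.Gamma ((1 - ν + j)/2) := Real.Gamma_pos_of_pos (by have : (0:ℝ) ≤ j := Nat.cast_nonneg j; linarith)
  have hg2 : Real.Gamma s ≠ 0 := by
    apply Real.Gamma_ne_zero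
    intro m hm
    have h3 : ν = ((j - 1 - 2 * m : ℤ) : ℝ) := by push_cast; rw [hs] at hm; linarith
    rw [h3] at h0 h1
    have h4 : (0:ℤ) < j - 1 - 2 * m := by exact_mod_cast h0
    have h5 : ((j - 1 - 2 * m : ℤ) : ℝ) < (1:ℤ) := by push_cast at h1 ⊢; linarith
    have h6 : (j - 1 - 2 * m : ℤ) < 1 := by exact_mod_cast h5
    omega
  rw [h1s, hsin] at hr
  have hcos : Real.cos (π * (j - ν)/2) ≠ 0 := by
    intro h; rw [h, div_zero] at hr
    exact (mul_ne_zero hg2 hg1.ne') hr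
  rw [eq_div_iff hcos] at hr
  have : 2 * Real.cos (π * (j - ν)/2) * A = 2 ^ j * Real.Gamma ((1 + ν + j)/2) / Real.Gamma s := by
    rw [hA, eq_div_iff hg2]
    have hp := Real.pi_pos.ne'
    field_simp
    linear_combination hr
  rw [← this]; push_cast; rfl

end BOP

namespace BOP

lemma mom_poly {ν : ℝ} (h0 : 0 < ν) (h1 : ν ≤ 1/2) (N : ℕ) (c : ℕ → ℂ) (j : ℕ) :
    ∫ x : ℝ, (∑ k ∈ Finset.range N, c k * (Complex.I * π * x) ^ k) * (Complex.I * π * x) ^ j * Wf ν x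
      = ∑ k ∈ Finset.range N, c k * (besselMoment ν (j + k) : ℂ) := by
  have hi : ∀ m : ℕ, Integrable (fun x : ℝ => (Complex.I * π * x) ^ m * Wf ν x) := by
    intro m
    have := ((Wf_dec h0.le h1).int (Polynomial.X ^ m)).const_mul ((Complex.I * π) ^ m)
    refine this.congr (Eventually.of_forall fun x => ?_)
    simp [mul_pow]; ring
  have e : ∀ x : ℝ, (∑ k ∈ Finset.range N, c k * (Complex.I * π * x) ^ k) * (Complex.I * π * x) ^ j * Wf ν x
      = ∑ k ∈ Finset.range N, c k * ((Complex.I * π * x) ^ (j + k) * Wf ν x) := by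
    intro x
    rw [Finset.sum_mul, Finset.sum_mul]
    refine Finset.sum_congr rfl fun k _ => ?_
    rw [pow_add]; ring
  simp_rw [e]
  rw [integral_finsetSum _ fun k _ => (hi _).const_mul _]
  refine Finset.sum_congr rfl fun k _ => ?_
  rw [integral_const_mul, moment_eq h0 h1]

lemma Ipi_ne : (Complex.I * π : ℂ) ≠ 0 := mul_ne_zero Complex.I_ne_zero (by exact_mod_cast Real.pi_ne_zero)

lemma OP_scale {ν : ℝ} (h0 : 0 < ν) (h1 : ν ≤ 1/2) (n : ℕ) (P : Polynomial ℂ) (hP : IsBesselOP ν n P) :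
    ∃ p : Polynomial ℂ, p.Monic ∧ p.natDegree = n ∧ (∀ j < n, ∫ x : ℝ, p.eval (x : ℂ) * (x:ℂ) ^ j * Wf ν x = 0) ∧
      ∀ z : ℂ, P.eval (Complex.I * π * z) = (Complex.I * π) ^ n * p.eval z := by
  obtain ⟨hm, hd, ho⟩ := hP
  have hne := Ipi_ne
  have hev : ∀ z : ℂ, P.eval (Complex.I * π * z) = (Complex.I * π) ^ n * (P.scaleRoots (Complex.I * π)⁻¹).eval z := by
    intro z
    have h := Polynomial.scaleRoots_eval₂_mul (p := P) (RingHom.id ℂ) (Complex.I * π * z) ((Complex.I * π)⁻¹)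
    simp only [RingHom.id_apply, Polynomial.eval₂_id] at h
    rw [hd, ← mul_assoc, inv_mul_cancel₀ hne, one_mul] at h
    rw [h, ← mul_assoc, ← mul_pow, mul_inv_cancel₀ hne, one_pow, one_mul]
  refine ⟨P.scaleRoots (Complex.I * π)⁻¹, (Polynomial.monic_scaleRoots_iff _).2 hm, by rw [Polynomial.natDegree_scaleRoots, hd], fun j hj => ?_, hev⟩
  have h2 := mom_poly h0 h1 (n+1) P.coeff j
  rw [ho j hj] at h2
  have e : ∀ x : ℝ, (∑ k ∈ Finset.range (n+1), P.coeff k * (Complex.I * π * x) ^ k) * (Complex.I * π * x) ^ j * Wf ν x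
     = ((Complex.I * π) ^ n * (Complex.I * π) ^ j) * ((P.scaleRoots (Complex.I * π)⁻¹).eval (x : ℂ) * (x:ℂ) ^ j * Wf ν x) := by
    intro x
    have := hev x
    rw [Polynomial.eval_eq_sum_range, hd] at this
    rw [this, mul_pow _ (x:ℂ)]; ring
  simp_rw [e] at h2
  rw [integral_const_mul] at h2
  rcases mul_eq_zero.1 h2 with h3 | h3
  · exact absurd h3 (mul_ne_zero (pow_ne_zero _ hne) (pow_ne_zero _ hne))
  · exact h3

lemma nsq_zero {q : Polynomial ℂ} (h : nsq w1 q = 0) : q = 0 := by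
  apply Polynomial.funext
  intro z
  have hq : q.degree < ((q.natDegree + 1 : ℕ) : WithBot ℕ) := Polynomial.degree_lt_iff_coeff_zero _ _ |>.2 fun m hm =>
    Polynomial.coeff_eq_zero_of_natDegree_lt (by omega)
  have := w1_adm.value_bound w1_intpos (q.natDegree + 1) q hq z
  rw [h] at this
  simp at this
  simp [this]

lemma hankel_ne {ν : ℝ} (h0 : 0 < ν) (h1 : ν ≤ 1/2) (n : ℕ) : hankelDet ν n ≠ 0 := by
  intro hdet
  obtain ⟨v, hv, hMv⟩ := Matrix.exists_mulVec_eq_zero_iff.2 hdet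
  obtain ⟨c, hc, hcoer⟩ := Wf_coer h0.le h1
  set a : ℕ → ℝ := fun k => if h : k < n then v ⟨k, h⟩ else 0 with ha
  set q : Polynomial ℂ := ∑ k ∈ Finset.range n, Polynomial.monomial k ((a k : ℂ) * (Complex.I * π) ^ k) with hq
  have hqe : ∀ z : ℂ, q.eval z = ∑ k ∈ Finset.range n, (a k : ℂ) * (Complex.I * π * z) ^ k := by
    intro z
    rw [hq, Polynomial.eval_finsetSum]
    refine Finset.sum_congr rfl fun k _ => ?_
    rw [Polynomial.eval_monomial, mul_pow _ z]; ring
  have horth : ∀ j < n, ∫ x : ℝ, q.eval (x:ℂ) * (Complex.I * π * x) ^ j * Wf ν x = 0 := by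
    intro j hj
    simp_rw [hqe]
    rw [mom_poly h0 h1]
    have h2 := congrFun hMv ⟨j, hj⟩
    simp only [Matrix.mulVec, dotProduct, Matrix.of_apply, Pi.zero_apply] at h2
    rw [← Fin.sum_univ_eq_sum_range (fun k => (a k : ℂ) * (besselMoment ν (j + k) : ℂ)) n]
    have h3 : ∀ i : Fin n, (a i : ℂ) * (besselMoment ν (j + i) : ℂ) = ((besselMoment ν (j + i) * v i : ℝ) : ℂ) := by
      intro i
      simp only [ha, i.2, dif_pos]
      push_cast; ring
    simp_rw [h3]
    rw [← Complex.ofReal_sum, h2]; simp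
  have hpe : ∀ x : ℝ, (q * pconj q).eval (x:ℂ) * Wf ν x = ∑ j ∈ Finset.range n, ((a j : ℂ) * (-1) ^ j) * (q.eval (x:ℂ) * (Complex.I * π * x) ^ j * Wf ν x) := by
    intro x
    rw [Polynomial.eval_mul, pconj_eval]
    conv_lhs => rw [hqe x]
    rw [map_sum, ← hqe x, Finset.mul_sum, Finset.sum_mul]
    refine Finset.sum_congr rfl fun j _ => ?_
    simp only [map_mul, map_pow, Complex.conj_ofReal, Complex.conj_I]
    rw [show (-Complex.I * π * x : ℂ) = (-1) * (Complex.I * π * x) by ring, mul_pow]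
    ring
  have hz : ∫ x : ℝ, (q * pconj q).eval (x:ℂ) * Wf ν x = 0 := by
    simp_rw [hpe]
    rw [integral_finsetSum]
    · refine Finset.sum_eq_zero fun j hj => ?_
      rw [integral_const_mul, horth j (Finset.mem_range.1 hj), mul_zero]
    · intro j _
      refine Integrable.const_mul ?_ _
      have := ((Wf_dec h0.le h1).int (q * Polynomial.X ^ j)).const_mul ((Complex.I * π) ^ j)
      refine this.congr (Eventually.of_forall fun x => ?_)
      simp [mul_pow]; ring
  have hn := hcoer q
  rw [hz, norm_zero] at hn
  have hq0 : q = 0 := nsq_zero (le_antisymm (by nlinarith) (nsq_nonneg w1_adm q))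
  apply hv
  ext i
  have hco : q.coeff i = (a i : ℂ) * (Complex.I * π) ^ (i:ℕ) := by
    rw [hq, Polynomial.finsetSum_coeff]
    simp_rw [Polynomial.coeff_monomial]
    simp
  rw [hq0, Polynomial.coeff_zero] at hco
  have h5 := (mul_eq_zero.1 hco.symm).resolve_right (pow_ne_zero _ Ipi_ne)
  have h6 : a i = 0 := by exact_mod_cast h5
  simpa [ha] using h6

end BOP

namespace BOP

/-- the doubly slit plane -/
def DD : Set ℂ := {η | 1 - η ^ 2 ∈ Complex.slitPlane}

noncomputable def uu (η : ℂ) : ℂ := (1 - η ^ 2) ^ ((1:ℂ)/2)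
noncomputable def vv (η : ℂ) : ℂ := uu η + Complex.I * η
noncomputable def ll (η : ℂ) : ℂ := Complex.log ((1 + uu η) / 2)
noncomputable def Gp (η : ℂ) : ℂ := η * ll η - η - Complex.I * Complex.log (vv η)
noncomputable def AA (a : ℝ) (η : ℂ) : ℂ := ll η / 4 - Complex.log (uu η) / 2 + a * Complex.log (vv η)

lemma DD_open : IsOpen DD := Complex.isOpen_slitPlane.preimage (by fun_prop)

lemma uu_sq (η : ℂ) : uu η ^ 2 = 1 - η ^ 2 := by
  unfold uu
  rw [← Complex.cpow_mul_nat]; norm_num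

lemma uu_re_pos {η : ℂ} (h : η ∈ DD) : 0 < (uu η).re := by
  have h' : 1 - η ^ 2 ∈ Complex.slitPlane := h
  have hne := Complex.slitPlane_ne_zero h'
  have ha := Complex.mem_slitPlane_iff_arg.1 h'
  unfold uu
  rw [Complex.cpow_def_of_ne_zero hne, Complex.exp_re]
  refine mul_pos (Real.exp_pos _) ?_
  have e : (Complex.log (1 - η ^ 2) * (1 / 2)).im = Complex.arg (1 - η ^ 2) / 2 := by
    rw [show (1:ℂ)/2 = ((1/2:ℝ):ℂ) by norm_num, Complex.im_mul_ofReal, Complex.log_im]; ring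
  rw [e]
  have h1 := Complex.neg_pi_lt_arg (1 - η ^ 2)
  have h2 := lt_of_le_of_ne (Complex.arg_le_pi (1 - η ^ 2)) ha.1
  apply Real.cos_pos_of_mem_Ioo
  constructor <;> linarith

lemma uu_ne {η : ℂ} (h : η ∈ DD) : uu η ≠ 0 := fun e => by
  have := uu_re_pos h; rw [e] at this; simp at this

lemma one_add_uu_re {η : ℂ} (h : η ∈ DD) : 1 < (1 + uu η).re := by
  have := uu_re_pos h; simp; linarith

lemma one_add_uu_ne {η : ℂ} (h : η ∈ DD) : 1 + uu η ≠ 0 := fun e => by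
  have := one_add_uu_re h; rw [e] at this; simp at this; linarith

lemma vv_inv (η : ℂ) : vv η * (uu η - Complex.I * η) = 1 := by
  unfold vv
  have : (uu η + Complex.I * η) * (uu η - Complex.I * η) = uu η ^ 2 - Complex.I ^ 2 * η ^ 2 := by ring
  rw [this, uu_sq, Complex.I_sq]; ring

lemma vv_ne (η : ℂ) : vv η ≠ 0 := left_ne_zero_of_mul_eq_one (vv_inv η)

lemma vv_re_pos {η : ℂ} (h : η ∈ DD) : 0 < (vv η).re := by
  have h1 : (vv η)⁻¹ = uu η - Complex.I * η := inv_eq_of_mul_eq_one_right (vv_inv η)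
  have h2 : vv η + (vv η)⁻¹ = 2 * uu η := by rw [h1]; unfold vv; ring
  have h3 := congrArg Complex.re h2
  rw [Complex.add_re, Complex.inv_re] at h3
  have h4 := uu_re_pos h
  have h5 : (2 * uu η).re = 2 * (uu η).re := by simp
  have h6 : 0 < Complex.normSq (vv η) := Complex.normSq_pos.2 (vv_ne η)
  by_contra hc
  push Not at hc
  have : (vv η).re / Complex.normSq (vv η) ≤ 0 := div_nonpos_of_nonpos_of_nonneg hc h6.le
  linarith

lemma uu_deriv {η : ℂ} (h : η ∈ DD) : HasDerivAt uu (-η / uu η) η := by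
  have h1 : HasDerivAt (fun η : ℂ => 1 - η ^ 2) (-(2 * η)) η := by
    have := (hasDerivAt_pow 2 η).const_sub 1
    simpa using this
  have h2 := h1.cpow_const (c := (1:ℂ)/2) h
  refine h2.congr_deriv ?_
  have h' : 1 - η ^ 2 ∈ Complex.slitPlane := h
  have hne := Complex.slitPlane_ne_zero h'
  have : (1 - η ^ 2) ^ ((1:ℂ)/2 - 1) = uu η / (1 - η ^ 2) := by
    rw [Complex.cpow_sub _ _ hne, Complex.cpow_one]; rfl
  rw [this, ← uu_sq]
  have := uu_ne h
  field_simp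

lemma vv_deriv {η : ℂ} (h : η ∈ DD) : HasDerivAt vv (Complex.I * vv η / uu η) η := by
  have h1 := (uu_deriv h).add ((hasDerivAt_id η).const_mul Complex.I)
  refine h1.congr_deriv ?_
  have := uu_ne h
  unfold vv
  field_simp
  linear_combination (-η) * Complex.I_sq

lemma ll_deriv {η : ℂ} (h : η ∈ DD) : HasDerivAt ll (-η / (uu η * (1 + uu η))) η := by
  have h1 := ((uu_deriv h).const_add 1).div_const 2
  have hs : (1 + uu η) / 2 ∈ Complex.slitPlane := by
    left
    have := one_add_uu_re h
    have e : ((1 + uu η) / 2).re = (1 + uu η).re / 2 := by simp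
    rw [e]; linarith
  refine (h1.clog hs).congr_deriv ?_
  have := uu_ne h
  have := one_add_uu_ne h
  field_simp

lemma logvv_deriv {η : ℂ} (h : η ∈ DD) :
    HasDerivAt (fun η => Complex.log (vv η)) (Complex.I / uu η) η := by
  refine ((vv_deriv h).clog (Or.inl (vv_re_pos h))).congr_deriv ?_
  have := vv_ne η
  have := uu_ne h
  field_simp

lemma Gp_deriv {η : ℂ} (h : η ∈ DD) : HasDerivAt Gp (ll η) η := by
  have h1 := (((hasDerivAt_id η).mul (ll_deriv h)).sub (hasDerivAt_id η)).sub
    ((logvv_deriv h).const_mul Complex.I)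
  refine h1.congr_deriv ?_
  have h2 := uu_ne h
  have h3 := one_add_uu_ne h
  simp only [id]
  have : η * (-η / (uu η * (1 + uu η))) = 1 - 1 / uu η := by
    field_simp
    linear_combination (-1) * uu_sq η
  rw [this]
  field_simp
  linear_combination (-1) * Complex.I_sq

lemma AA_deriv (a : ℝ) {η : ℂ} (h : η ∈ DD) :
    HasDerivAt (AA a) (η * (uu η + 2) / (4 * uu η ^ 2 * (1 + uu η)) + Complex.I * a / uu η) η := by
  have h1 := (((ll_deriv h).div_const 4).sub
    (((uu_deriv h).clog (Or.inl (uu_re_pos h))).div_const 2)).add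
    ((logvv_deriv h).const_mul (a:ℂ))
  refine h1.congr_deriv ?_
  have h2 := uu_ne h
  have h3 := one_add_uu_ne h
  field_simp
  ring

lemma exp_ll {η : ℂ} (h : η ∈ DD) : Complex.exp (ll η) = (1 + uu η) / 2 := by
  unfold ll
  rw [Complex.exp_log]
  have := one_add_uu_ne h
  exact div_ne_zero this two_ne_zero

lemma norm_exp_ll {η : ℂ} (h : η ∈ DD) : 1/2 ≤ ‖Complex.exp (ll η)‖ := by
  rw [exp_ll h, norm_div]
  have := (one_add_uu_re h).le.trans (Complex.re_le_norm _)
  simp only [Complex.norm_ofNat]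
  linarith

lemma DD_zero : (0:ℂ) ∈ DD := by simp [DD]
lemma uu_zero : uu 0 = 1 := by simp [uu]
lemma vv_zero : vv 0 = 1 := by simp [vv, uu_zero]
lemma ll_zero : ll 0 = 0 := by simp [ll, uu_zero]
lemma Gp_zero : Gp 0 = 0 := by simp [Gp, vv_zero]
lemma AA_zero (a : ℝ) : AA a 0 = 0 := by simp [AA, ll_zero, uu_zero, vv_zero]

/-- ratio `(1-u)/(1+u)` has norm less than one -/
lemma ww_lt {η : ℂ} (h : η ∈ DD) : ‖(1 - uu η) / (1 + uu η)‖ < 1 := by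
  rw [norm_div, div_lt_one (norm_pos_iff.2 (one_add_uu_ne h))]
  have hr := uu_re_pos h
  have h1 : ‖1 - uu η‖ ^ 2 < ‖1 + uu η‖ ^ 2 := by
    rw [Complex.sq_norm, Complex.sq_norm, Complex.normSq_apply, Complex.normSq_apply]
    simp
    nlinarith
  exact lt_of_pow_lt_pow_left₀ 2 (norm_nonneg _) h1

lemma eta_ww {η : ℂ} (h : η ∈ DD) :
    η ^ 2 / 4 = (1 - uu η) / (1 + uu η) * Complex.exp (ll η) ^ 2 := by
  rw [exp_ll h]
  have h3 := one_add_uu_ne h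
  field_simp
  linear_combination (4:ℂ) * uu_sq η

/-- `DD` is symmetric and star shaped in the real direction -/
lemma DD_smul {η : ℂ} (h : η ∈ DD) {t : ℝ} (ht : |t| ≤ 1) : (t:ℂ) * η ∈ DD := by
  have h' : 1 - η ^ 2 ∈ Complex.slitPlane := h
  show 1 - ((t:ℂ) * η) ^ 2 ∈ Complex.slitPlane
  rw [Complex.mem_slitPlane_iff] at h' ⊢
  have e : 1 - ((t:ℂ) * η) ^ 2 = ((1 - t ^ 2 : ℝ) : ℂ) + ((t ^ 2 : ℝ) : ℂ) * (1 - η ^ 2) := by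
    push_cast; ring
  rw [e]
  have t2 : t ^ 2 ≤ 1 := by rw [← sq_abs]; nlinarith [abs_nonneg t]
  rw [Complex.add_re, Complex.add_im, Complex.re_ofReal_mul, Complex.im_ofReal_mul,
    Complex.ofReal_re, Complex.ofReal_im]
  rcases eq_or_ne t 0 with rfl | h0
  · left; simp
  have tp : 0 < t ^ 2 := by positivity
  rcases h' with h' | h'
  · left
    have := mul_pos tp h'
    linarith
  · right
    simp only [zero_add]
    exact mul_ne_zero tp.ne' h'

end BOP

namespace BOP

lemma seg_norm {a d y : ℂ} (hy : y ∈ segment ℝ a (a + d)) : ‖y - a‖ ≤ ‖d‖ := by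
  rw [segment_eq_image'] at hy
  obtain ⟨t, ht, rfl⟩ := hy
  simp only [add_sub_cancel_left, norm_smul, Real.norm_eq_abs, abs_of_nonneg ht.1]
  exact mul_le_of_le_one_left (norm_nonneg _) ht.2

lemma seg_sub {a d y : ℂ} (hy : y ∈ segment ℝ a (a + d)) : segment ℝ a y ⊆ segment ℝ a (a + d) :=
  (convex_segment _ _).segment_subset (left_mem_segment _ _ _) hy

lemma taylor2 {D : Set ℂ} (hD : IsOpen D) {f : ℂ → ℂ} (hf : DifferentiableOn ℂ f D) {Ω : Set ℂ}
    (hΩ : IsCompact Ω) (hs : Ω ⊆ D) :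
    ∃ C, 0 ≤ C ∧ ∀ a d : ℂ, segment ℝ a (a + d) ⊆ Ω → ‖f (a + d) - f a - d * deriv f a‖ ≤ C * ‖d‖ ^ 2 := by
  have hf1 : DifferentiableOn ℂ (deriv f) D := hf.deriv hD
  have hf2 : ContinuousOn (deriv (deriv f)) Ω := (hf1.deriv hD).continuousOn.mono hs
  obtain ⟨C, hC⟩ := hΩ.exists_bound_of_continuousOn hf2
  refine ⟨max C 0, le_max_right _ _, fun a d hseg => ?_⟩
  have hd1 : ∀ y ∈ segment ℝ a (a + d), ‖deriv f y - deriv f a‖ ≤ max C 0 * ‖d‖ := by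
    intro y hy
    have := (convex_segment a (a + d)).norm_image_sub_le_of_norm_hasDerivWithin_le
      (f := deriv f) (f' := deriv (deriv f)) (C := max C 0)
      (fun x hx => ((hf1 x (hs (hseg hx))).differentiableAt (hD.mem_nhds (hs (hseg hx)))).hasDerivAt.hasDerivWithinAt)
      (fun x hx => (hC x (hseg hx)).trans (le_max_left _ _)) (left_mem_segment _ _ _) hy
    exact this.trans (mul_le_mul_of_nonneg_left (seg_norm hy) (le_max_right _ _))
  have := (convex_segment a (a + d)).norm_image_sub_le_of_norm_hasDerivWithin_le
      (f := fun y => f y - y * deriv f a) (f' := fun y => deriv f y - deriv f a) (C := max C 0 * ‖d‖)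
      (fun x hx => by
        have h1 := ((hf x (hs (hseg hx))).differentiableAt (hD.mem_nhds (hs (hseg hx)))).hasDerivAt
        have h2 := (h1.sub ((hasDerivAt_id x).mul_const (deriv f a)))
        exact (h2.congr_deriv (by simp)).hasDerivWithinAt)
      hd1 (left_mem_segment _ _ _) (right_mem_segment _ _ _)
  calc ‖f (a + d) - f a - d * deriv f a‖ = ‖f (a + d) - (a + d) * deriv f a - (f a - a * deriv f a)‖ := by
        congr 1; ring
    _ ≤ max C 0 * ‖d‖ * ‖a + d - a‖ := this
    _ = _ := by rw [add_sub_cancel_left]; ring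

lemma taylor3 {D : Set ℂ} (hD : IsOpen D) {f g : ℂ → ℂ} (hf : DifferentiableOn ℂ f D)
    (hg : ∀ x ∈ D, HasDerivAt g (f x) x) {Ω : Set ℂ}
    (hΩ : IsCompact Ω) (hs : Ω ⊆ D) :
    ∃ C, 0 ≤ C ∧ ∀ a d : ℂ, segment ℝ a (a + d) ⊆ Ω →
      ‖g (a + d) - g a - d * f a - d ^ 2 / 2 * deriv f a‖ ≤ C * ‖d‖ ^ 3 := by
  obtain ⟨C, hC0, hC⟩ := taylor2 hD hf hΩ hs
  refine ⟨C, hC0, fun a d hseg => ?_⟩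
  have hd1 : ∀ y ∈ segment ℝ a (a + d), ‖f y - f a - (y - a) * deriv f a‖ ≤ C * ‖d‖ ^ 2 := by
    intro y hy
    have := hC a (y - a) (by rw [add_sub_cancel]; exact (seg_sub hy).trans hseg)
    rw [add_sub_cancel] at this
    exact this.trans (mul_le_mul_of_nonneg_left (pow_le_pow_left₀ (norm_nonneg _) (seg_norm hy) 2) hC0)
  have := (convex_segment a (a + d)).norm_image_sub_le_of_norm_hasDerivWithin_le
      (f := fun y => g y - y * f a - (y - a) ^ 2 / 2 * deriv f a)
      (f' := fun y => f y - f a - (y - a) * deriv f a) (C := C * ‖d‖ ^ 2)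
      (fun x hx => by
        have h1 := hg x (hs (hseg hx))
        have h3 := ((((hasDerivAt_id x).sub_const a).pow 2).div_const 2).mul_const (deriv f a)
        have h2 := (h1.sub ((hasDerivAt_id x).mul_const (f a))).sub h3
        exact (h2.congr_deriv (by simp)).hasDerivWithinAt)
      hd1 (left_mem_segment _ _ _) (right_mem_segment _ _ _)
  calc ‖g (a + d) - g a - d * f a - d ^ 2 / 2 * deriv f a‖
      = ‖g (a + d) - (a + d) * f a - (a + d - a) ^ 2 / 2 * deriv f a
          - (g a - a * f a - (a - a) ^ 2 / 2 * deriv f a)‖ := by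
        congr 1; ring
    _ ≤ C * ‖d‖ ^ 2 * ‖a + d - a‖ := this
    _ = _ := by rw [add_sub_cancel_left]; ring

lemma exp_lin {y s δ : ℂ} {C1 C2 : ℝ} (h1 : ‖y - δ * s‖ ≤ C1 * ‖δ‖ ^ 2) (h2 : ‖s‖ ≤ C2) (hC1 : 0 ≤ C1)
    (hd : ‖δ‖ ≤ 1) (hd2 : (C1 + C2) * ‖δ‖ ≤ 1) :
    ‖Complex.exp y - 1 - δ * s‖ ≤ (C1 + (C1 + C2) ^ 2) * ‖δ‖ ^ 2 := by
  have hy : ‖y‖ ≤ (C1 + C2) * ‖δ‖ := by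
    calc ‖y‖ = ‖(y - δ * s) + δ * s‖ := by rw [sub_add_cancel]
      _ ≤ ‖y - δ * s‖ + ‖δ * s‖ := norm_add_le _ _
      _ ≤ C1 * ‖δ‖ ^ 2 + ‖δ‖ * C2 := by
        rw [norm_mul]; exact add_le_add h1 (mul_le_mul_of_nonneg_left h2 (norm_nonneg _))
      _ ≤ _ := by nlinarith [norm_nonneg δ, mul_nonneg hC1 (norm_nonneg δ)]
  have he := Complex.norm_exp_sub_one_sub_id_le (hy.trans hd2)
  have hy2 : ‖y‖ ^ 2 ≤ ((C1 + C2) * ‖δ‖) ^ 2 := pow_le_pow_left₀ (norm_nonneg _) hy 2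
  calc ‖Complex.exp y - 1 - δ * s‖ = ‖(Complex.exp y - 1 - y) + (y - δ * s)‖ := by congr 1; ring
    _ ≤ _ := norm_add_le _ _
    _ ≤ ((C1 + C2) * ‖δ‖) ^ 2 + C1 * ‖δ‖ ^ 2 := add_le_add (he.trans hy2) h1
    _ = _ := by ring

/-- discrete stability -/
lemma disc_stab (e : ℕ → ℂ) (N : ℕ) {q ρ : ℝ} (hq0 : 0 ≤ q) (hq : q < 1) (hρ : 0 ≤ ρ) (he : e 0 = 1)
    (h0 : ‖e 1 - e 0‖ ≤ ρ * ‖e 0‖)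
    (h : ∀ k, k + 1 < N → ‖e (k + 2) - e (k + 1)‖ ≤ q * ‖e (k + 1) - e k‖ + ρ * ‖e (k + 1)‖)
    (hN : N * (2 * ρ / (1 - q)) ≤ 1) :
    ∀ k ≤ N, ‖e k - 1‖ ≤ k * (2 * ρ / (1 - q)) := by
  have hq' : 0 < 1 - q := by linarith
  set E := 2 * ρ / (1 - q) with hE
  have hE0 : 0 ≤ E := by positivity
  have hEq : q * E + 2 * ρ = E := by rw [hE]; field_simp; ring
  have key : ∀ k, k + 1 ≤ N → ‖e k - 1‖ ≤ k * E ∧ ‖e (k + 1) - e k‖ ≤ E := by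
    intro k
    induction k with
    | zero =>
      intro _
      refine ⟨by simp [he], h0.trans ?_⟩
      rw [he, norm_one, mul_one]
      nlinarith [mul_nonneg hq0 hE0]
    | succ k ih =>
      intro hk
      obtain ⟨i1, i2⟩ := ih (by omega)
      have i3 : ‖e (k + 1) - 1‖ ≤ (k + 1 : ℕ) * E := by
        calc ‖e (k + 1) - 1‖ = ‖(e (k + 1) - e k) + (e k - 1)‖ := by congr 1; ring
          _ ≤ E + k * E := (norm_add_le _ _).trans (add_le_add i2 i1)
          _ = _ := by push_cast; ring
      refine ⟨i3, (h k (by omega)).trans ?_⟩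
      have i4 : ‖e (k + 1)‖ ≤ 2 := by
        have : ((k + 1 : ℕ) : ℝ) * E ≤ N * E :=
          mul_le_mul_of_nonneg_right (by exact_mod_cast (by omega)) hE0
        calc ‖e (k + 1)‖ = ‖(e (k + 1) - 1) + 1‖ := by rw [sub_add_cancel]
          _ ≤ ‖e (k + 1) - 1‖ + ‖(1:ℂ)‖ := norm_add_le _ _
          _ ≤ _ := by rw [norm_one]; linarith
      have := mul_le_mul_of_nonneg_left i2 hq0
      have := mul_le_mul_of_nonneg_left i4 hρ
      linarith
  intro k hk
  rcases k with _ | k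
  · simp [he]
  · obtain ⟨i1, i2⟩ := key k hk
    calc ‖e (k + 1) - 1‖ = ‖(e (k + 1) - e k) + (e k - 1)‖ := by congr 1; ring
          _ ≤ E + k * E := (norm_add_le _ _).trans (add_le_add i2 i1)
          _ = _ := by push_cast; ring

end BOP

namespace BOP

noncomputable def Ep (a : ℝ) (η δ : ℂ) : ℂ := Complex.exp ((Gp (η + δ) - Gp η) / δ + (AA a (η + δ) - AA a η))
noncomputable def Em (a : ℝ) (η δ : ℂ) : ℂ := Complex.exp ((Gp (η - δ) - Gp η) / δ + (AA a (η - δ) - AA a η))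

lemma ll_diff : DifferentiableOn ℂ ll DD := fun _ hx => (ll_deriv hx).differentiableAt.differentiableWithinAt
lemma AA_diff (a : ℝ) : DifferentiableOn ℂ (AA a) DD :=
  fun _ hx => (AA_deriv a hx).differentiableAt.differentiableWithinAt
lemma uu_diff : DifferentiableOn ℂ uu DD := fun _ hx => (uu_deriv hx).differentiableAt.differentiableWithinAt

lemma zero_order (a : ℝ) {η : ℂ} (h : η ∈ DD) (δ : ℂ) :
    Complex.exp (ll η) * (1 + δ * (deriv ll η / 2 + deriv (AA a) η))
      + η ^ 2 / 4 * Complex.exp (-ll η) * (1 + δ * (deriv ll η / 2 - deriv (AA a) η))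
      - η * δ / 8 * Complex.exp (-ll η) - 1 - Complex.I * a * δ = 0 := by
  rw [Complex.exp_neg, exp_ll h, (ll_deriv h).deriv, (AA_deriv a h).deriv]
  have h1 := uu_ne h
  have h2 := one_add_uu_ne h
  have e : η ^ 2 / 4 * ((1 + uu η) / 2)⁻¹ = (1 - uu η) / 2 := by
    field_simp
    linear_combination (4:ℂ) * uu_sq η
  rw [e]
  field_simp
  ring

/-- expansions of `Ep` and `Em` -/
lemma Epm_exp (a : ℝ) {Ω : Set ℂ} (hΩ : IsCompact Ω) (hs : Ω ⊆ DD) :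
    ∃ C2 C4 δ0 : ℝ, 0 ≤ C2 ∧ 0 ≤ C4 ∧ 0 < δ0 ∧ ∀ η δ : ℂ, δ ≠ 0 → ‖δ‖ ≤ δ0 →
      segment ℝ η (η + δ) ⊆ Ω → segment ℝ η (η - δ) ⊆ Ω →
      ‖deriv ll η / 2 + deriv (AA a) η‖ ≤ C2 ∧ ‖deriv ll η / 2 - deriv (AA a) η‖ ≤ C2 ∧
      (∃ r, ‖r‖ ≤ C4 * ‖δ‖ ^ 2 ∧
        Ep a η δ = Complex.exp (ll η) * (1 + δ * (deriv ll η / 2 + deriv (AA a) η) + r)) ∧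
      (∃ r, ‖r‖ ≤ C4 * ‖δ‖ ^ 2 ∧
        Em a η δ = Complex.exp (-ll η) * (1 + δ * (deriv ll η / 2 - deriv (AA a) η) + r)) := by
  obtain ⟨CG, hG0, hG⟩ := taylor3 DD_open ll_diff (fun x hx => Gp_deriv hx) hΩ hs
  obtain ⟨CA, hA0, hA⟩ := taylor2 DD_open (AA_diff a) hΩ hs
  have c1 : ContinuousOn (deriv ll) Ω := (ll_diff.deriv DD_open).continuousOn.mono hs
  have c2 : ContinuousOn (deriv (AA a)) Ω := ((AA_diff a).deriv DD_open).continuousOn.mono hs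
  obtain ⟨B1, hB1⟩ := hΩ.exists_bound_of_continuousOn c1
  obtain ⟨B2, hB2⟩ := hΩ.exists_bound_of_continuousOn c2
  set C2 := |B1| + |B2|
  have hC2 : 0 ≤ C2 := by positivity
  set C1 := CG + CA
  have hC1 : 0 ≤ C1 := by positivity
  refine ⟨C2, C1 + (C1 + C2) ^ 2, min 1 (1 / (C1 + C2 + 1)), hC2, by positivity, by positivity, ?_⟩
  intro η δ hδ hd hp hm
  have hηΩ : η ∈ Ω := hp (left_mem_segment _ _ _)
  have hd1 : ‖δ‖ ≤ 1 := hd.trans (min_le_left _ _)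
  have hd2 : (C1 + C2) * ‖δ‖ ≤ 1 := by
    have := hd.trans (min_le_right _ _)
    rw [le_div_iff₀ (by positivity)] at this
    nlinarith [norm_nonneg δ]
  have n1 : ‖deriv ll η / 2‖ ≤ |B1| := by
    rw [norm_div, Complex.norm_ofNat]
    have := (hB1 η hηΩ).trans (le_abs_self _)
    linarith [norm_nonneg (deriv ll η)]
  have n2 : ‖deriv (AA a) η‖ ≤ |B2| := (hB2 η hηΩ).trans (le_abs_self _)
  have s1 : ‖deriv ll η / 2 + deriv (AA a) η‖ ≤ C2 := (norm_add_le _ _).trans (add_le_add n1 n2)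
  have s2 : ‖deriv ll η / 2 - deriv (AA a) η‖ ≤ C2 := (norm_sub_le _ _).trans (add_le_add n1 n2)
  have hδn : 0 < ‖δ‖ := norm_pos_iff.2 hδ
  have gp := hG η δ hp
  have gm := hG η (-δ) (by rw [← sub_eq_add_neg]; exact hm)
  have ap := hA η δ hp
  have am := hA η (-δ) (by rw [← sub_eq_add_neg]; exact hm)
  rw [← sub_eq_add_neg, norm_neg] at gm am
  have div3 : ∀ X : ℂ, ‖X‖ ≤ CG * ‖δ‖ ^ 3 → ‖X / δ‖ ≤ CG * ‖δ‖ ^ 2 := by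
    intro X hX
    rw [norm_div, div_le_iff₀ hδn]
    calc _ ≤ _ := hX
      _ = _ := by ring
  refine ⟨s1, s2, ?_, ?_⟩
  · have hy : ‖(Gp (η + δ) - Gp η) / δ + (AA a (η + δ) - AA a η) - ll η - δ * (deriv ll η / 2 + deriv (AA a) η)‖
        ≤ C1 * ‖δ‖ ^ 2 := by
      have e : (Gp (η + δ) - Gp η) / δ + (AA a (η + δ) - AA a η) - ll η - δ * (deriv ll η / 2 + deriv (AA a) η)
          = (Gp (η + δ) - Gp η - δ * ll η - δ ^ 2 / 2 * deriv ll η) / δ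
            + (AA a (η + δ) - AA a η - δ * deriv (AA a) η) := by
        field_simp; ring
      rw [e]
      refine (norm_add_le _ _).trans ((add_le_add (div3 _ gp) ap).trans ?_)
      rw [← add_mul]
    have := exp_lin hy s1 hC1 hd1 hd2
    refine ⟨_, this, ?_⟩
    rw [show ∀ X : ℂ, Complex.exp (ll η) * (1 + δ * (deriv ll η / 2 + deriv (AA a) η) + (Complex.exp X - 1 -
      δ * (deriv ll η / 2 + deriv (AA a) η))) = Complex.exp (ll η) * Complex.exp X by intro X; ring,
      ← Complex.exp_add, Ep]
    congr 1; ring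
  · have hy : ‖(Gp (η - δ) - Gp η) / δ + (AA a (η - δ) - AA a η) + ll η - δ * (deriv ll η / 2 - deriv (AA a) η)‖
        ≤ C1 * ‖δ‖ ^ 2 := by
      have e : (Gp (η - δ) - Gp η) / δ + (AA a (η - δ) - AA a η) + ll η - δ * (deriv ll η / 2 - deriv (AA a) η)
          = (Gp (η - δ) - Gp η - -δ * ll η - (-δ) ^ 2 / 2 * deriv ll η) / δ
            + (AA a (η - δ) - AA a η - -δ * deriv (AA a) η) := by
        field_simp; ring
      rw [e]
      refine (norm_add_le _ _).trans ((add_le_add (div3 _ gm) am).trans ?_)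
      rw [← add_mul]
    have := exp_lin hy s2 hC1 hd1 hd2
    refine ⟨_, this, ?_⟩
    rw [show ∀ X : ℂ, Complex.exp (-ll η) * (1 + δ * (deriv ll η / 2 - deriv (AA a) η) + (Complex.exp X - 1 -
      δ * (deriv ll η / 2 - deriv (AA a) η))) = Complex.exp (-ll η) * Complex.exp X by intro X; ring,
      ← Complex.exp_add, Em]
    congr 1; ring

lemma ww_bound {Ω : Set ℂ} (hΩ : IsCompact Ω) (hs : Ω ⊆ DD) :
    ∃ q : ℝ, 0 ≤ q ∧ q < 1 ∧ ∀ η ∈ Ω, ‖(1 - uu η) / (1 + uu η)‖ ≤ q := by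
  rcases Ω.eq_empty_or_nonempty with rfl | hne
  · exact ⟨0, le_rfl, one_pos, by simp⟩
  have hu : ContinuousOn uu Ω := uu_diff.continuousOn.mono hs
  have hc : ContinuousOn (fun η => ‖(1 - uu η) / (1 + uu η)‖) Ω :=
    ((continuousOn_const.sub hu).div (continuousOn_const.add hu) fun η hη => one_add_uu_ne (hs hη)).norm
  obtain ⟨η0, h0, hm⟩ := hΩ.exists_isMaxOn hne hc
  exact ⟨_, norm_nonneg _, ww_lt (hs h0), fun η hη => hm hη⟩

set_option maxHeartbeats 1000000 in
lemma local_est (a : ℝ) {Ω : Set ℂ} (hΩ : IsCompact Ω) (hs : Ω ⊆ DD) :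
    ∃ C q δ0 : ℝ, 0 ≤ C ∧ 0 ≤ q ∧ q < 1 ∧ 0 < δ0 ∧ ∀ η δ : ℂ, δ ≠ 0 → ‖δ‖ ≤ δ0 →
      segment ℝ η (η + δ) ⊆ Ω → segment ℝ η (η - δ) ⊆ Ω →
      ‖Ep a η δ + (η ^ 2 - η * δ / 2) / 4 * Em a η δ - 1 - Complex.I * a * δ‖ ≤ C * ‖δ‖ ^ 2 ∧
      ‖(η ^ 2 - η * δ / 2) / 4 * Em a η δ‖ ≤ q * ‖Ep a η δ‖ ∧
      1 / 4 ≤ ‖Ep a η δ‖ ∧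
      ‖(η + δ) * (η + δ / 2) / 4‖ ≤ q * ‖Ep a η δ‖ ^ 2 := by
  obtain ⟨C2, C4, d0, hC2, hC4, hd0, H⟩ := Epm_exp a hΩ hs
  obtain ⟨q0, hq0, hq1, hw⟩ := ww_bound hΩ hs
  obtain ⟨R', hR'⟩ := hΩ.isBounded.exists_norm_le
  obtain ⟨C3', hC3'⟩ := hΩ.exists_bound_of_continuousOn
    (Complex.continuous_exp.comp_continuousOn (ll_diff.continuousOn.mono hs))
  set R := |R'|
  set C3 := |C3'|
  have hR0 : 0 ≤ R := abs_nonneg _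
  have hC30 : 0 ≤ C3 := abs_nonneg _
  set C5 := C3 * (C2 + C4)
  set C6 := (R ^ 2 + R) * (2 * (C2 + C4)) + R
  have hC5 : 0 ≤ C5 := by positivity
  have hC6 : 0 ≤ C6 := by positivity
  set T := (C5 + C6 + 2 * C3 * C5 + R + 1) with hT
  have hT0 : 0 < T := by positivity
  refine ⟨C3 * C4 + (R ^ 2 + R) * (2 * C4) + R * 2 * C2, (1 + q0) / 2, min d0 (min 1 ((1 - q0) / 8 / T)),
    by positivity, by linarith, by linarith, ?_, ?_⟩
  · have : 0 < (1 - q0) / 8 / T := div_pos (by linarith) hT0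
    positivity
  intro η δ hδ hd hp hm
  obtain ⟨s1, s2, ⟨r1, hr1, e1⟩, ⟨r2, hr2, e2⟩⟩ := H η δ hδ (hd.trans (min_le_left _ _)) hp hm
  have hηΩ : η ∈ Ω := hp (left_mem_segment _ _ _)
  have hη := hs hηΩ
  have hd1 : ‖δ‖ ≤ 1 := hd.trans ((min_le_right _ _).trans (min_le_left _ _))
  have hd2 : T * ‖δ‖ ≤ (1 - q0) / 8 := by
    have := hd.trans ((min_le_right _ _).trans (min_le_right _ _))
    rw [le_div_iff₀ hT0] at this
    linarith
  have hηR : ‖η‖ ≤ R := (hR' η hηΩ).trans (le_abs_self _)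
  have hL3 : ‖Complex.exp (ll η)‖ ≤ C3 := (hC3' η hηΩ).trans (le_abs_self _)
  have hL := norm_exp_ll hη
  have hLm : ‖Complex.exp (-ll η)‖ ≤ 2 := by
    rw [Complex.exp_neg, norm_inv, inv_le_comm₀ (by linarith) two_pos]; linarith
  have hz := zero_order a hη δ
  have hwη := hw η hηΩ
  have hee : Complex.exp (ll η) * Complex.exp (-ll η) = 1 := by rw [← Complex.exp_add]; simp
  have hEta := eta_ww hη
  have dn := norm_nonneg δ
  have hdd : ‖δ‖ ^ 2 ≤ ‖δ‖ := by nlinarith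
  set s₁ := deriv ll η / 2 + deriv (AA a) η
  set s₂ := deriv ll η / 2 - deriv (AA a) η
  set L := Complex.exp (ll η)
  set L' := Complex.exp (-ll η)
  set w := (1 - uu η) / (1 + uu η)
  have hB : ‖(η ^ 2 - η * δ / 2) / 4‖ ≤ R ^ 2 + R := by
    rw [norm_div, Complex.norm_ofNat]
    have : ‖η ^ 2 - η * δ / 2‖ ≤ R ^ 2 + R * 1 / 2 := by
      refine (norm_sub_le _ _).trans ?_
      rw [norm_div, norm_mul, norm_pow, Complex.norm_ofNat]
      gcongr
    have : 0 ≤ R ^ 2 := by positivity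
    linarith
  have hηδ : ‖η * δ / 8‖ = ‖η‖ * ‖δ‖ / 8 := by rw [norm_div, norm_mul, Complex.norm_ofNat]
  have t1 : ‖δ * s₁ + r1‖ ≤ (C2 + C4) * ‖δ‖ := by
    refine (norm_add_le _ _).trans ?_
    rw [norm_mul]
    have x1 := mul_le_mul_of_nonneg_left s1 dn
    have x2 := mul_le_mul_of_nonneg_left hdd hC4
    linarith
  have t2 : ‖δ * s₂ + r2‖ ≤ (C2 + C4) * ‖δ‖ := by
    refine (norm_add_le _ _).trans ?_
    rw [norm_mul]
    have x1 := mul_le_mul_of_nonneg_left s2 dn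
    have x2 := mul_le_mul_of_nonneg_left hdd hC4
    linarith
  have p1 : ‖Ep a η δ - L‖ ≤ C5 * ‖δ‖ := by
    rw [e1, show L * (1 + δ * s₁ + r1) - L = L * (δ * s₁ + r1) by ring, norm_mul]
    calc _ ≤ C3 * ((C2 + C4) * ‖δ‖) := by gcongr
      _ = _ := by ring
  have p2 : ‖(η ^ 2 - η * δ / 2) / 4 * Em a η δ - η ^ 2 / 4 * L'‖ ≤ C6 * ‖δ‖ := by
    rw [e2, show (η ^ 2 - η * δ / 2) / 4 * (L' * (1 + δ * s₂ + r2)) - η ^ 2 / 4 * L'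
      = (η ^ 2 - η * δ / 2) / 4 * (L' * (δ * s₂ + r2)) - η * δ / 8 * L' by ring]
    refine (norm_sub_le _ _).trans ?_
    rw [norm_mul, norm_mul L', norm_mul _ L', hηδ]
    calc _ ≤ (R ^ 2 + R) * (2 * ((C2 + C4) * ‖δ‖)) + R * ‖δ‖ / 8 * 2 := by gcongr
      _ ≤ _ := by linarith [mul_nonneg hR0 dn]
  have hEL : η ^ 2 / 4 * L' = w * L := by
    rw [hEta]; linear_combination (w * L) * hee
  have q1 : ‖(η ^ 2 - η * δ / 2) / 4 * Em a η δ‖ ≤ q0 * ‖L‖ + C6 * ‖δ‖ := by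
    calc _ = ‖((η ^ 2 - η * δ / 2) / 4 * Em a η δ - η ^ 2 / 4 * L') + w * L‖ := by rw [← hEL, sub_add_cancel]
      _ ≤ C6 * ‖δ‖ + ‖w‖ * ‖L‖ := (norm_add_le _ _).trans (add_le_add p2 (norm_mul _ _).le)
      _ ≤ C6 * ‖δ‖ + q0 * ‖L‖ := by gcongr
      _ = _ := add_comm _ _
  have q2 : ‖L‖ - C5 * ‖δ‖ ≤ ‖Ep a η δ‖ := by
    have := norm_sub_norm_le L (Ep a η δ)
    rw [norm_sub_rev] at this
    linarith
  have b1 : 0 ≤ C5 * ‖δ‖ := by positivity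
  have b2 : 0 ≤ C6 * ‖δ‖ := by positivity
  have b3 : 0 ≤ C3 * C5 * ‖δ‖ := by positivity
  have b4 : 0 ≤ R * ‖δ‖ := by positivity
  have hTe : T * ‖δ‖ = C5 * ‖δ‖ + C6 * ‖δ‖ + 2 * (C3 * C5 * ‖δ‖) + R * ‖δ‖ + ‖δ‖ := by rw [hT]; ring
  rw [hTe] at hd2
  refine ⟨?_, ?_, ?_, ?_⟩
  · have e : Ep a η δ + (η ^ 2 - η * δ / 2) / 4 * Em a η δ - 1 - Complex.I * a * δ
      = L * r1 + (η ^ 2 - η * δ / 2) / 4 * (L' * r2) - η * δ / 8 * (L' * (δ * s₂)) := by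
      rw [e1, e2]; linear_combination hz
    rw [e]
    refine (norm_sub_le _ _).trans ((add_le_add (norm_add_le _ _) le_rfl).trans ?_)
    rw [norm_mul L, norm_mul _ (L' * r2), norm_mul L' r2, norm_mul _ (L' * (δ * s₂)), norm_mul L', norm_mul δ, hηδ]
    calc _ ≤ C3 * (C4 * ‖δ‖ ^ 2) + (R ^ 2 + R) * (2 * (C4 * ‖δ‖ ^ 2)) + R * ‖δ‖ / 8 * (2 * (‖δ‖ * C2)) := by gcongr
      _ ≤ _ := by linarith [mul_nonneg (mul_nonneg hR0 hC2) (sq_nonneg ‖δ‖)]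
  · refine q1.trans ?_
    have : (1 + q0) / 2 * (‖L‖ - C5 * ‖δ‖) ≤ (1 + q0) / 2 * ‖Ep a η δ‖ :=
      mul_le_mul_of_nonneg_left q2 (by linarith)
    have g1 : 0 ≤ (1 - q0) * (‖L‖ - 1 / 2) := mul_nonneg (sub_nonneg.2 hq1.le) (sub_nonneg.2 hL)
    have g2 : 0 ≤ (1 - q0) * (C5 * ‖δ‖) := mul_nonneg (sub_nonneg.2 hq1.le) b1
    linarith
  · linarith
  · have z1 : ‖(η + δ) * (η + δ / 2) / 4‖ ≤ q0 * ‖L‖ ^ 2 + (R + 1) * ‖δ‖ := by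
      have : (η + δ) * (η + δ / 2) / 4 = w * L ^ 2 + (η * δ * (3 / 8) + δ * δ / 8) := by
        rw [← hEta]; ring
      rw [this]
      refine (norm_add_le _ _).trans (add_le_add ?_ ((norm_add_le _ _).trans ?_))
      · rw [norm_mul, norm_pow]; gcongr
      · rw [norm_mul (η * δ), norm_mul η, norm_div (δ * δ), norm_mul δ]
        norm_num
        have : ‖η‖ * ‖δ‖ ≤ R * ‖δ‖ := by gcongr
        have x1 : ‖δ‖ * ‖δ‖ ≤ ‖δ‖ := by rw [← sq]; exact hdd
        linarith
    have z2 : ‖L‖ ^ 2 - 2 * C3 * C5 * ‖δ‖ ≤ ‖Ep a η δ‖ ^ 2 := by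
      have : (0:ℝ) ≤ ‖L‖ - C5 * ‖δ‖ := by linarith
      have := pow_le_pow_left₀ this q2 2
      have x1 := mul_le_mul_of_nonneg_right hL3 b1
      have x2 := mul_nonneg b1 b1
      linarith
    have z3 : (1 + q0) / 2 * (‖L‖ ^ 2 - 2 * C3 * C5 * ‖δ‖) ≤ (1 + q0) / 2 * ‖Ep a η δ‖ ^ 2 :=
      mul_le_mul_of_nonneg_left z2 (by linarith)
    have z4 : (1:ℝ)/4 ≤ ‖L‖ ^ 2 := by nlinarith
    have g1 : 0 ≤ (1 - q0) * (‖L‖ ^ 2 - 1 / 4) := mul_nonneg (sub_nonneg.2 hq1.le) (sub_nonneg.2 z4)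
    have g2 : 0 ≤ (1 - q0) * (C3 * C5 * ‖δ‖) := mul_nonneg (sub_nonneg.2 hq1.le) b3
    refine z1.trans (le_trans ?_ z3)
    linarith

end BOP

namespace BOP

noncomputable def MM (a : ℝ) (δ : ℂ) (k : ℕ) : ℂ := Complex.exp (Gp (k * δ) / δ + AA a (k * δ))

lemma MM_ne (a : ℝ) (δ : ℂ) (k : ℕ) : MM a δ k ≠ 0 := Complex.exp_ne_zero _
lemma MM_zero (a : ℝ) (δ : ℂ) : MM a δ 0 = 1 := by simp [MM, Gp_zero, AA_zero]
lemma MM_succ (a : ℝ) (δ : ℂ) (k : ℕ) : MM a δ (k + 1) = MM a δ k * Ep a (k * δ) δ := by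
  rw [MM, MM, Ep, ← Complex.exp_add, show ((k + 1 : ℕ) : ℂ) * δ = k * δ + δ by push_cast; ring]
  congr 1; ring
lemma MM_pred (a : ℝ) (δ : ℂ) (k : ℕ) : MM a δ k = MM a δ (k + 1) * Em a ((k + 1 : ℕ) * δ) δ := by
  rw [MM, MM, Em, ← Complex.exp_add, show ((k + 1 : ℕ) : ℂ) * δ - δ = k * δ by push_cast; ring]
  congr 1; ring

noncomputable def ee (a : ℝ) (δ : ℂ) (k : ℕ) : ℂ := mpe (δ⁻¹ + Complex.I * a) k * δ ^ k / MM a δ k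

lemma ee_zero (a : ℝ) (δ : ℂ) : ee a δ 0 = 1 := by simp [ee, MM_zero, mpe]

lemma Ep_ne (a : ℝ) (η δ : ℂ) : Ep a η δ ≠ 0 := Complex.exp_ne_zero _

lemma ee_one (a : ℝ) {δ : ℂ} (hδ : δ ≠ 0) :
    Ep a 0 δ * (ee a δ 1 - ee a δ 0) = -(Ep a 0 δ - 1 - Complex.I * a * δ) := by
  have h := MM_succ a δ 0
  rw [MM_zero, one_mul] at h
  simp only [Nat.cast_zero, zero_mul, zero_add] at h
  have := Ep_ne a 0 δ
  simp only [ee, h, mpe, MM_zero, pow_one, pow_zero]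
  field_simp
  ring

lemma ee_rec (a : ℝ) {δ : ℂ} (hδ : δ ≠ 0) (k : ℕ) (η : ℂ) (hη : η = ((k + 1 : ℕ) : ℂ) * δ) :
    Ep a η δ * (ee a δ (k + 2) - ee a δ (k + 1)) =
      (η ^ 2 - η * δ / 2) / 4 * Em a η δ * (ee a δ (k + 1) - ee a δ k)
      - (Ep a η δ + (η ^ 2 - η * δ / 2) / 4 * Em a η δ - 1 - Complex.I * a * δ) * ee a δ (k + 1) := by
  have hb : (bc (k + 1) : ℂ) * δ ^ 2 = (η ^ 2 - η * δ / 2) / 4 := by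
    rw [hη, bc]; push_cast; ring
  have h1 := MM_succ a δ (k + 1)
  have h2 := MM_pred a δ k
  rw [← hη] at h1 h2
  have key : Ep a η δ * ee a δ (k + 2) = (1 + Complex.I * a * δ) * ee a δ (k + 1)
      - (η ^ 2 - η * δ / 2) / 4 * Em a η δ * ee a δ k := by
    rw [← hb]
    have hE := Ep_ne a η δ
    have hE' : Em a η δ ≠ 0 := Complex.exp_ne_zero _
    have hM := MM_ne a δ (k + 1)
    simp only [ee, h1, h2, mpe]
    field_simp
    ring
  linear_combination key

lemma Omega_compact {K' : Set ℂ} (hK : IsCompact K') :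
    IsCompact ((fun p : ℝ × ℂ => (p.1 : ℂ) * p.2) '' (Set.Icc (-1) 1 ×ˢ K')) :=
  (isCompact_Icc.prod hK).image (by fun_prop)

lemma Omega_sub {K' : Set ℂ} (hs : K' ⊆ DD) :
    ((fun p : ℝ × ℂ => (p.1 : ℂ) * p.2) '' (Set.Icc (-1) 1 ×ˢ K')) ⊆ DD := by
  rintro _ ⟨⟨t, ω⟩, ⟨ht, hω⟩, rfl⟩
  exact DD_smul (hs hω) (abs_le.2 ht)

lemma Omega_seg {K' : Set ℂ} {ω : ℂ} (hω : ω ∈ K') {s t : ℝ} (hs : s ∈ Set.Icc (-1:ℝ) 1)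
    (ht : t ∈ Set.Icc (-1:ℝ) 1) :
    segment ℝ ((s:ℂ) * ω) ((t:ℂ) * ω) ⊆ ((fun p : ℝ × ℂ => (p.1 : ℂ) * p.2) '' (Set.Icc (-1) 1 ×ˢ K')) := by
  rintro _ ⟨x, y, hx, hy, hxy, rfl⟩
  refine ⟨(x * s + y * t, ω), ⟨?_, hω⟩, ?_⟩
  · exact (convex_Icc (-1:ℝ) 1) hs ht hx hy hxy
  · simp; ring

lemma model_asym (a : ℝ) {K' : Set ℂ} (hK : IsCompact K') (hs : K' ⊆ DD) :
    ∃ C q : ℝ, ∃ n0 : ℕ, 0 ≤ C ∧ 0 ≤ q ∧ q < 1 ∧ 1 ≤ n0 ∧ ∀ n ≥ n0, ∀ ω ∈ K', ω ≠ 0 → 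
      (∀ k ≤ n, ‖ee a (ω / n) k‖ ≤ 2) ∧ ‖ee a (ω / n) n - 1‖ ≤ C / n ∧
      ∀ k < n, bc (k + 1) * ‖ω / n‖ ^ 2 ≤ q * ‖Ep a (k * (ω / n)) (ω / n)‖ ^ 2 := by
  obtain ⟨C, q, δ0, hC, hq0, hq1, hδ0, H⟩ := local_est a (Omega_compact hK) (Omega_sub hs)
  obtain ⟨R', hR'⟩ := hK.isBounded.exists_norm_le
  set R := |R'|
  have hR0 : 0 ≤ R := abs_nonneg _
  have hq' : 0 < 1 - q := by linarith
  set C' := 8 * C * R ^ 2 / (1 - q) with hC'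
  have hC'0 : 0 ≤ C' := by positivity
  obtain ⟨n0, hn0⟩ := exists_nat_ge (max (R / δ0) (max C' 1))
  have n1 : (1:ℝ) ≤ n0 := (le_max_right _ _).trans ((le_max_right _ _).trans hn0)
  refine ⟨C', q, n0, hC'0, hq0, hq1, by exact_mod_cast n1, fun n hn ω hω hω0 => ?_⟩
  have hnn : (n0:ℝ) ≤ n := by exact_mod_cast hn
  have hnpos : (0:ℝ) < n := by linarith
  have hnC : (n:ℂ) ≠ 0 := by exact_mod_cast hnpos.ne'
  set δ := ω / n with hδ
  have hδne : δ ≠ 0 := div_ne_zero hω0 hnC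
  have hδn : ‖δ‖ ≤ R / n := by
    rw [hδ, norm_div, Complex.norm_natCast]
    gcongr
    exact (hR' ω hω).trans (le_abs_self _)
  have hδd : ‖δ‖ ≤ δ0 := by
    refine hδn.trans ?_
    rw [div_le_iff₀ hnpos, mul_comm, ← div_le_iff₀ hδ0]
    exact (le_max_left _ _).trans (hn0.trans hnn)
  have mem : ∀ k : ℕ, k < n → ((k:ℝ)/n ∈ Set.Icc (-1:ℝ) 1) ∧ (((k:ℝ)+1)/n ∈ Set.Icc (-1:ℝ) 1) ∧
      (((k:ℝ)-1)/n ∈ Set.Icc (-1:ℝ) 1) := by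
    intro k hk
    have h1 : (k:ℝ) + 1 ≤ n := by exact_mod_cast hk
    have h0 : (0:ℝ) ≤ k := Nat.cast_nonneg _
    have hn1 : (1:ℝ) ≤ n := by linarith
    refine ⟨⟨?_, ?_⟩, ⟨?_, ?_⟩, ⟨?_, ?_⟩⟩ <;>
      first | (rw [le_div_iff₀ hnpos]; linarith) | (rw [div_le_iff₀ hnpos]; linarith)
  have HH : ∀ k : ℕ, k < n → _ := fun k hk => H (k * δ) δ hδne hδd
    (by
      have := Omega_seg hω (mem k hk).1 (mem k hk).2.1
      convert this using 2
      · rw [hδ]; push_cast; field_simp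
      · rw [hδ]; push_cast; field_simp)
    (by
      have := Omega_seg hω (mem k hk).1 (mem k hk).2.2
      convert this using 2
      · rw [hδ]; push_cast; field_simp
      · rw [hδ]; push_cast; field_simp)
  have hdn : ‖δ‖ ^ 2 ≤ R ^ 2 / n ^ 2 := by
    rw [← div_pow]; exact pow_le_pow_left₀ (norm_nonneg _) hδn 2
  have step : ∀ (E d r : ℂ), 1/4 ≤ ‖E‖ → ∀ X Y : ℝ, ‖E * d‖ ≤ X * ‖E‖ + C * ‖δ‖ ^ 2 * Y → 0 ≤ Y →
      ‖d‖ ≤ X + 4 * C * (R ^ 2 / n ^ 2) * Y := by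
    intro E d r hE X Y h hY
    rw [norm_mul] at h
    have hp : 0 < ‖E‖ := by linarith
    have h2 : C * ‖δ‖ ^ 2 * Y ≤ C * (R ^ 2 / n ^ 2) * Y := by gcongr
    have h3 : 0 ≤ C * (R ^ 2 / n ^ 2) * Y := by positivity
    have h4 : ‖E‖ * ‖d‖ ≤ ‖E‖ * (X + 4 * C * (R ^ 2 / n ^ 2) * Y) := by nlinarith
    exact le_of_mul_le_mul_left h4 hp
  have hρ : (n:ℝ) * (2 * (4 * C * (R ^ 2 / n ^ 2)) / (1 - q)) = C' / n := by
    rw [hC']; field_simp; ring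
  have st := disc_stab (ee a δ) n hq0 hq1 (ρ := 4 * C * (R ^ 2 / n ^ 2)) (by positivity) (ee_zero a δ)
    (by
      have h := HH 0 (by exact_mod_cast hnpos)
      simp only [Nat.cast_zero, zero_mul] at h
      obtain ⟨h1, h2, h3, h4⟩ := h
      have := step _ (ee a δ 1 - ee a δ 0) 0 h3 0 1 (by
        rw [ee_one a hδne, norm_neg]
        simpa using h1) zero_le_one
      simpa [ee_zero] using this)
    (by
      intro k hk
      obtain ⟨h1, h2, h3, h4⟩ := HH (k + 1) hk
      refine step _ (ee a δ (k + 2) - ee a δ (k + 1)) 0 h3 _ _ ?_ (norm_nonneg _)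
      rw [ee_rec a hδne k _ rfl]
      refine (norm_sub_le _ _).trans ?_
      rw [norm_mul, norm_mul _ (ee a δ (k+1))]
      refine add_le_add ?_ (mul_le_mul_of_nonneg_right h1 (norm_nonneg _))
      calc _ ≤ q * ‖Ep a (((k + 1 : ℕ):ℂ) * δ) δ‖ * ‖ee a δ (k + 1) - ee a δ k‖ :=
            mul_le_mul_of_nonneg_right h2 (norm_nonneg _)
        _ = _ := by ring)
    (by
      rw [hρ, div_le_one hnpos]
      exact (le_max_left _ _).trans ((le_max_right _ _).trans (hn0.trans hnn)))
  refine ⟨fun k hk => ?_, ?_, fun k hk => ?_⟩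
  · have h1 := st k hk
    have h2 : (k:ℝ) * (2 * (4 * C * (R ^ 2 / n ^ 2)) / (1 - q)) ≤ n * (2 * (4 * C * (R ^ 2 / n ^ 2)) / (1 - q)) := by
      gcongr
    have h3 : C' / n ≤ 1 := by
      rw [div_le_one hnpos]
      exact (le_max_left _ _).trans ((le_max_right _ _).trans (hn0.trans hnn))
    calc ‖ee a δ k‖ = ‖(ee a δ k - 1) + 1‖ := by rw [sub_add_cancel]
      _ ≤ ‖ee a δ k - 1‖ + ‖(1:ℂ)‖ := norm_add_le _ _
      _ ≤ 2 := by rw [norm_one]; linarith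
  · have := st n le_rfl
    rwa [hρ] at this
  · obtain ⟨h1, h2, h3, h4⟩ := HH k hk
    refine le_trans (le_of_eq ?_) h4
    rw [show ((k:ℂ) * δ + δ) * (k * δ + δ / 2) / 4 = (bc (k + 1) : ℂ) * δ ^ 2 by rw [bc]; push_cast; ring,
      norm_mul, norm_pow, Complex.norm_real, Real.norm_of_nonneg (bc_succ_pos k).le]

end BOP

namespace BOP

lemma geo_sum (t : ℕ → ℝ) {q : ℝ} (hq0 : 0 ≤ q) (hq : q < 1) (n : ℕ) (ht : ∀ k ≤ n, 0 ≤ t k)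
    (h : ∀ k < n, t k ≤ q * t (k + 1)) :
    ∀ m ≤ n, ∑ k ∈ Finset.range m, t k ≤ q / (1 - q) * t m := by
  have hq' : 0 < 1 - q := by linarith
  intro m
  induction m with
  | zero => intro hm; simp; exact mul_nonneg (by positivity) (ht 0 hm)
  | succ m ih =>
    intro hm
    rw [Finset.sum_range_succ]
    have h1 := ih (by omega)
    have h2 := h m (by omega)
    calc _ ≤ q / (1 - q) * t m + t m := by linarith
      _ = t m / (1 - q) := by field_simp; ring
      _ ≤ q * t (m + 1) / (1 - q) := by gcongr
      _ = _ := by ring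

lemma mpe_ee (a : ℝ) {δ : ℂ} (hδ : δ ≠ 0) (k : ℕ) :
    mpe (δ⁻¹ + Complex.I * a) k = δ⁻¹ ^ k * MM a δ k * ee a δ k := by
  have := MM_ne a δ k
  have h2 : δ⁻¹ ^ k * δ ^ k = 1 := by rw [← mul_pow, inv_mul_cancel₀ hδ, one_pow]
  rw [ee, mul_div_assoc', eq_div_iff this]
  linear_combination (-(mpe (δ⁻¹ + Complex.I * a) k * MM a δ k)) * h2

lemma sum_bound {K' : Set ℂ} (hK : IsCompact K') (hs : K' ⊆ DD) :
    ∃ C : ℝ, ∃ n0 : ℕ, 0 ≤ C ∧ 1 ≤ n0 ∧ ∀ n ≥ n0, ∀ ω ∈ K', ω ≠ 0 → 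
      ∑ k ∈ Finset.range n, ‖mpe (ω / n)⁻¹ k‖ ^ 2 / hn k
        ≤ C * ((‖(ω / n)⁻¹ ^ n * MM 0 (ω / n) n‖) ^ 2 / hn n) := by
  obtain ⟨C, q, n0, hC, hq0, hq1, hn0, H⟩ := model_asym 0 hK hs
  have hq' : 0 < 1 - q := by linarith
  refine ⟨4 * (q / (1 - q)), n0, by positivity, hn0, fun n hnn ω hω hω0 => ?_⟩
  obtain ⟨h1, h2, h3⟩ := H n hnn ω hω hω0
  have hnC : (n:ℂ) ≠ 0 := by exact_mod_cast (by omega : n ≠ 0)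
  set δ := ω / n with hδ
  have hδne : δ ≠ 0 := div_ne_zero hω0 hnC
  have hδp : 0 < ‖δ‖ := norm_pos_iff.2 hδne
  have hg := geo_sum (fun k => ‖δ⁻¹ ^ k * MM 0 δ k‖ ^ 2 / hn k) hq0 hq1 n
    (fun k _ => div_nonneg (sq_nonneg _) (hn_pos k).le) (fun k hk => by
      have := h3 k hk
      have hb := bc_succ_pos k
      have hh := hn_pos k
      rw [MM_succ, hn_succ, pow_succ δ⁻¹ k, norm_mul _ (MM 0 δ k), norm_mul (_ * _) (_ * _), norm_mul (δ⁻¹ ^ k) δ⁻¹, norm_mul (MM 0 δ k) _, norm_inv]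
      have e : q * ((‖δ⁻¹ ^ k‖ * ‖δ‖⁻¹ * (‖MM 0 δ k‖ * ‖Ep 0 (k * δ) δ‖)) ^ 2 / (hn k * bc (k + 1)))
        = (‖δ⁻¹ ^ k‖ * ‖MM 0 δ k‖) ^ 2 / hn k * ((q * ‖Ep 0 (k * δ) δ‖ ^ 2) / (bc (k + 1) * ‖δ‖ ^ 2)) := by
        field_simp
      rw [e]
      refine le_mul_of_one_le_right (by positivity) ?_
      rwa [one_le_div (by positivity)]) n le_rfl
  calc _ ≤ ∑ k ∈ Finset.range n, 4 * (‖δ⁻¹ ^ k * MM 0 δ k‖ ^ 2 / hn k) := by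
        refine Finset.sum_le_sum fun k hk => ?_
        have e := mpe_ee 0 hδne k
        simp only [Complex.ofReal_zero, mul_zero, add_zero] at e
        rw [e, norm_mul _ (ee 0 δ k), mul_pow, ← mul_div_assoc]
        have hk2 := h1 k (Finset.mem_range.1 hk).le
        have : ‖ee 0 δ k‖ ^ 2 ≤ 2 ^ 2 := pow_le_pow_left₀ (norm_nonneg _) hk2 2
        have hh := hn_pos k
        rw [div_le_div_iff_of_pos_right hh]
        nlinarith [sq_nonneg ‖δ⁻¹ ^ k * MM 0 δ k‖]
    _ ≤ _ := by
        rw [← Finset.mul_sum, mul_assoc]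
        exact mul_le_mul_of_nonneg_left hg (by norm_num)

lemma MM_cmp (a : ℝ) {K' : Set ℂ} (hK : IsCompact K') (hs : K' ⊆ DD) :
    ∃ C : ℝ, 0 ≤ C ∧ ∀ n : ℕ, n ≠ 0 → ∀ ω ∈ K', ‖MM 0 (ω / n) n‖ ≤ C * ‖MM a (ω / n) n‖ := by
  have hc : ContinuousOn (fun ω => Complex.exp (-(a * Complex.log (vv ω)))) K' := by
    refine Complex.continuous_exp.comp_continuousOn (ContinuousOn.neg (ContinuousOn.mul continuousOn_const ?_))
    intro ω hω
    exact (logvv_deriv (hs hω)).continuousAt.continuousWithinAt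
  obtain ⟨C, hC⟩ := hK.exists_bound_of_continuousOn hc
  refine ⟨|C|, abs_nonneg _, fun n h0n ω hω => ?_⟩
  have hnC : (n:ℂ) ≠ 0 := by exact_mod_cast h0n
  have e : MM 0 (ω / n) n = Complex.exp (-(a * Complex.log (vv ω))) * MM a (ω / n) n := by
    rw [MM, MM, ← Complex.exp_add, show (n:ℂ) * (ω / n) = ω by field_simp, AA, AA]
    congr 1; push_cast; ring
  rw [e, norm_mul]
  exact mul_le_mul_of_nonneg_right ((hC ω hω).trans (le_abs_self _)) (norm_nonneg _)

lemma outer_err (a : ℝ) {K' : Set ℂ} (hK : IsCompact K') (hs : K' ⊆ DD) :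
    ∃ C : ℝ, ∃ n0 : ℕ, 0 ≤ C ∧ 1 ≤ n0 ∧ ∀ n ≥ n0, ∀ ω ∈ K', ω ≠ 0 → ∀ q : Polynomial ℂ, q.degree < (n:ℕ) →
      ‖q.eval (ω / n)⁻¹‖ ≤ C * (√(nsq w1 q) / √(hn n)) * ‖(ω / n)⁻¹ ^ n * MM a (ω / n) n‖ := by
  obtain ⟨C1, n0, hC1, hn0, H⟩ := sum_bound hK hs
  obtain ⟨C2, hC2, H2⟩ := MM_cmp a hK hs
  refine ⟨√(1 / ∫ x, w1 x) * √C1 * C2, n0, by positivity, hn0, fun n hnn ω hω hω0 q hq => ?_⟩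
  have hb := w1_adm.value_bound w1_intpos n q hq (ω / n)⁻¹
  have hm := H2 n (by omega) ω hω
  have hnp := hn_pos n
  refine hb.trans ?_
  calc _ ≤ √(nsq w1 q / ∫ x, w1 x) * √(C1 * ((‖(ω / n)⁻¹ ^ n * MM 0 (ω / n) n‖) ^ 2 / hn n)) := by
        gcongr; exact H n hnn ω hω hω0
    _ = √(1 / ∫ x, w1 x) * √C1 * (√(nsq w1 q) / √(hn n)) * (‖(ω / n)⁻¹ ^ n‖ * ‖MM 0 (ω / n) n‖) := by
        rw [Real.sqrt_div' _ w1_intpos.le, Real.sqrt_div' 1 w1_intpos.le, Real.sqrt_mul hC1, Real.sqrt_div' _ hnp.le,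
          Real.sqrt_sq (norm_nonneg _), Real.sqrt_one, norm_mul]
        ring
    _ ≤ √(1 / ∫ x, w1 x) * √C1 * (√(nsq w1 q) / √(hn n)) * (‖(ω / n)⁻¹ ^ n‖ * (C2 * ‖MM a (ω / n) n‖)) := by
        gcongr
    _ = _ := by rw [norm_mul]; ring

end BOP

namespace BOP

lemma inv_mem_DD {z : ℂ} (h : ¬(z.im = 0 ∧ |z.re| ≤ 1)) : z ≠ 0 ∧ z⁻¹ ∈ DD := by
  have hz : z ≠ 0 := by rintro rfl; simp at h
  refine ⟨hz, ?_⟩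
  show 1 - z⁻¹ ^ 2 ∈ Complex.slitPlane
  by_contra hc
  rw [Complex.mem_slitPlane_iff] at hc
  push Not at hc
  obtain ⟨h1, h2⟩ := hc
  set w := z⁻¹ with hw
  have e1 : (1 - w ^ 2).re = 1 - (w.re ^ 2 - w.im ^ 2) := by simp [pow_two]
  have e2 : (1 - w ^ 2).im = -(2 * w.re * w.im) := by simp [pow_two]; ring
  rw [e1] at h1; rw [e2] at h2
  have hre : w.re ≠ 0 := by
    intro h0; rw [h0] at h1; nlinarith [sq_nonneg w.im]
  have him : w.im = 0 := by
    have : w.re * w.im = 0 := by linarith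
    exact (mul_eq_zero.1 this).resolve_left hre
  apply h
  have hwr : w = (w.re : ℂ) := Complex.ext (by simp) (by simp [him])
  have hzr : z = ((w.re⁻¹ : ℝ) : ℂ) := by
    rw [Complex.ofReal_inv, ← hwr, hw, inv_inv]
  rw [hzr]
  refine ⟨Complex.ofReal_im _, ?_⟩
  rw [Complex.ofReal_re, abs_inv]
  apply inv_le_one_of_one_le₀
  rw [him] at h1
  have : 1 ≤ w.re ^ 2 := by nlinarith
  rwa [one_le_sq_iff_one_le_abs] at this

lemma sqBranch_eq (z : ℂ) : sqBranch z = z * uu z⁻¹ := rfl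

lemma log_im_bd {w : ℂ} (h : 0 < w.re) : |(Complex.log w).im| < π / 2 := by
  rw [Complex.log_im, Complex.abs_arg_lt_pi_div_two_iff]; exact Or.inl h

lemma log_ratio {η : ℂ} (h : η ∈ DD) :
    Complex.log ((1 + uu η) / (2 * uu η ^ 2)) = ll η - 2 * Complex.log (uu η) := by
  have hu := uu_ne h
  have hr := uu_re_pos h
  have b1 := abs_lt.1 (log_im_bd hr)
  have hr2 : 0 < ((1 + uu η) / 2).re := by
    have := one_add_uu_re h
    have e : ((1 + uu η) / 2).re = (1 + uu η).re / 2 := by simp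
    rw [e]; linarith
  have b2 := abs_lt.1 (log_im_bd hr2)
  have hr3 : 0 < ((1 + uu η) / (2 * uu η)).re := by
    have e : (1 + uu η) / (2 * uu η) = ((1/2:ℝ):ℂ) * ((uu η)⁻¹ + 1) := by push_cast; field_simp
    rw [e, Complex.re_ofReal_mul, Complex.add_re, Complex.inv_re, Complex.one_re]
    have : 0 < (uu η).re / Complex.normSq (uu η) := div_pos hr (Complex.normSq_pos.2 hu)
    linarith
  have b3 := abs_lt.1 (log_im_bd hr3)
  have hne := one_add_uu_ne h
  have e1 : Complex.exp (ll η - Complex.log (uu η)) = (1 + uu η) / (2 * uu η) := by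
    rw [Complex.exp_sub, exp_ll h, Complex.exp_log hu]; field_simp
  have e2 : ll η - Complex.log (uu η) = Complex.log ((1 + uu η) / (2 * uu η)) := by
    rw [← e1, Complex.log_exp]
    · rw [Complex.sub_im]; unfold ll; linarith [b1.2, b2.1]
    · rw [Complex.sub_im]; unfold ll; linarith [b1.1, b2.2]
  have e3 : Complex.exp (ll η - 2 * Complex.log (uu η)) = (1 + uu η) / (2 * uu η ^ 2) := by
    rw [show ll η - 2 * Complex.log (uu η) = (ll η - Complex.log (uu η)) - Complex.log (uu η) by ring,
      Complex.exp_sub, e1, Complex.exp_log hu]; field_simp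
  have e4 : (ll η - 2 * Complex.log (uu η)).im
      = (Complex.log ((1 + uu η) / (2 * uu η))).im - (Complex.log (uu η)).im := by
    rw [← e2, ← Complex.sub_im]; congr 1; ring
  rw [← e3, Complex.log_exp]
  · rw [e4]; linarith [b1.2, b3.1]
  · rw [e4]; linarith [b1.1, b3.2]

lemma outerFactor_eq (ν : ℝ) {z : ℂ} (hz : z ≠ 0) (h : z⁻¹ ∈ DD) :
    outerFactor ν z = Complex.exp (AA (ν / 2) z⁻¹) := by
  have hu := uu_ne h
  have hone := one_add_uu_ne h
  have hv := vv_ne z⁻¹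
  have husq : uu z⁻¹ ^ 2 = 1 - z⁻¹ ^ 2 := uu_sq _
  have hz2 : z ^ 2 - 1 = z ^ 2 * uu z⁻¹ ^ 2 := by rw [husq]; field_simp
  have e1 : z * (z + sqBranch z) / (2 * (z ^ 2 - 1)) = (1 + uu z⁻¹) / (2 * uu z⁻¹ ^ 2) := by
    rw [hz2, sqBranch_eq]; field_simp
  have hvm : uu z⁻¹ - Complex.I * z⁻¹ = (vv z⁻¹)⁻¹ := (inv_eq_of_mul_eq_one_right (vv_inv _)).symm
  have e2 : (sqBranch z - Complex.I) / (sqBranch z + Complex.I) = Complex.exp (-(2 * Complex.log (vv z⁻¹))) := by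
    have h1 : sqBranch z - Complex.I = z * (vv z⁻¹)⁻¹ := by
      rw [sqBranch_eq, ← hvm]; field_simp
    have h2 : sqBranch z + Complex.I = z * vv z⁻¹ := by
      rw [sqBranch_eq, vv]; field_simp
    rw [h1, h2, Complex.exp_neg, show 2 * Complex.log (vv z⁻¹) = Complex.log (vv z⁻¹) + Complex.log (vv z⁻¹) by ring,
      Complex.exp_add, Complex.exp_log hv]
    field_simp
  have b := abs_lt.1 (log_im_bd (vv_re_pos h))
  have e3 : Complex.log ((sqBranch z - Complex.I) / (sqBranch z + Complex.I)) = -(2 * Complex.log (vv z⁻¹)) := by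
    have ei : (-(2 * Complex.log (vv z⁻¹))).im = -(2 * (Complex.log (vv z⁻¹)).im) := by simp
    rw [e2, Complex.log_exp]
    · rw [ei]; linarith [b.2]
    · rw [ei]; linarith [b.1]
  have hne : (1 + uu z⁻¹) / (2 * uu z⁻¹ ^ 2) ≠ 0 := by
    refine div_ne_zero hone (mul_ne_zero two_ne_zero (pow_ne_zero _ hu))
  unfold outerFactor
  rw [e1, e3, Complex.cpow_def_of_ne_zero hne, log_ratio h, ← Complex.exp_add]
  congr 1
  unfold AA
  push_cast
  ring

lemma one_sub_slit {ω : ℂ} (h : ω ∈ DD) {x : ℝ} (hx : |x| ≤ 1) : 1 - (x:ℂ) * ω ∈ Complex.slitPlane := by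
  have h1 : 1 - ((x:ℂ) * ω) ^ 2 ∈ Complex.slitPlane := DD_smul h hx
  set y := (x:ℂ) * ω
  by_contra hc
  rw [Complex.mem_slitPlane_iff] at hc h1
  push Not at hc
  obtain ⟨c1, c2⟩ := hc
  simp at c1 c2
  have e1 : (1 - y ^ 2).re = 1 - (y.re ^ 2 - y.im ^ 2) := by simp [pow_two]
  have e2 : (1 - y ^ 2).im = -(2 * y.re * y.im) := by simp [pow_two]; ring
  rw [e1, e2, c2] at h1
  rcases h1 with h1 | h1
  · nlinarith
  · simp at h1

lemma log_split {z : ℂ} (h : ¬(z.im = 0 ∧ |z.re| ≤ 1)) {x : ℝ} (hx : |x| ≤ 1) :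
    Complex.log (z - x) = Complex.log z + Complex.log (1 - x * z⁻¹) := by
  obtain ⟨hz, hD⟩ := inv_mem_DD h
  have hs := one_sub_slit hD hx
  have hne := Complex.slitPlane_ne_zero hs
  have e : z - x = z * (1 - x * z⁻¹) := by field_simp
  rw [e, Complex.log_mul_eq_add_log_iff hz hne]
  by_cases him : z.im = 0
  · have hzr : z = (z.re : ℂ) := Complex.ext (by simp) (by simp [him])
    have hre : 1 < |z.re| := by
      by_contra hc; exact h ⟨him, not_lt.1 hc⟩
    have hpos : 0 < 1 - x * z.re⁻¹ := by
      have : |x * z.re⁻¹| < 1 := by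
        rw [abs_mul, abs_inv]
        have : |z.re|⁻¹ < 1 := inv_lt_one_of_one_lt₀ hre
        nlinarith [abs_nonneg x, abs_nonneg z.re, inv_nonneg.2 (abs_nonneg z.re)]
      linarith [(abs_lt.1 this).2]
    have e2 : 1 - (x:ℂ) * z⁻¹ = ((1 - x * z.re⁻¹ : ℝ) : ℂ) := by
      push_cast; rw [← hzr]
    rw [e2, Complex.arg_ofReal_of_nonneg hpos.le, add_zero]
    exact ⟨Complex.neg_pi_lt_arg _, Complex.arg_le_pi _⟩
  · -- `arg (1 - x/z)` via the sign of imaginary parts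
    have hwim : (1 - (x:ℂ) * z⁻¹).im = x * z.im / Complex.normSq z := by
      simp [Complex.inv_im]; ring
    have hn : 0 < Complex.normSq z := Complex.normSq_pos.2 hz
    set w := 1 - (x:ℂ) * z⁻¹ with hw
    have hzw : (z * w).im = z.im := by rw [← e]; simp
    have ha := Complex.neg_pi_lt_arg z
    have hb := Complex.arg_le_pi z
    have hc := Complex.neg_pi_lt_arg w
    have hd := Complex.arg_le_pi w
    have hsin : Real.sin (Complex.arg z + Complex.arg w) * (‖z‖ * ‖w‖) = z.im := by
      rw [← hzw, Complex.mul_im, Real.sin_add]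
      have a1 := Complex.norm_mul_cos_arg z
      have a2 := Complex.norm_mul_sin_arg z
      have a3 := Complex.norm_mul_cos_arg w
      have a4 := Complex.norm_mul_sin_arg w
      rw [← a1, ← a2, ← a3, ← a4]; ring
    have hpp : 0 < ‖z‖ * ‖w‖ := mul_pos (norm_pos_iff.2 hz) (norm_pos_iff.2 hne)
    rcases lt_or_gt_of_ne him with hneg | hpos
    · have az : Complex.arg z < 0 := Complex.arg_neg_iff.2 hneg
      have hs2 : Real.sin (Complex.arg z + Complex.arg w) < 0 := by
        by_contra hcc; push Not at hcc; nlinarith [mul_nonneg hcc hpp.le]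
      refine ⟨?_, by linarith⟩
      by_contra hcc
      push Not at hcc
      have : 0 ≤ Real.sin (Complex.arg z + Complex.arg w + 2 * π) :=
        Real.sin_nonneg_of_nonneg_of_le_pi (by linarith) (by linarith)
      rw [Real.sin_add_two_pi] at this
      linarith
    · have az : 0 ≤ Complex.arg z := Complex.arg_nonneg_iff.2 hpos.le
      have hs2 : 0 < Real.sin (Complex.arg z + Complex.arg w) := by
        by_contra hcc; push Not at hcc; nlinarith [mul_nonneg (neg_nonneg.2 hcc) hpp.le]
      refine ⟨by linarith, ?_⟩
      by_contra hcc
      push Not at hcc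
      have : 0 ≤ Real.sin (Complex.arg z + Complex.arg w - π) :=
        Real.sin_nonneg_of_nonneg_of_le_pi (by linarith) (by linarith)
      rw [Real.sin_sub_pi] at this
      linarith

end BOP

namespace BOP

lemma poisson_int {η : ℂ} (h : η ∈ DD) :
    ∫ θ in (0:ℝ)..π, (1 - (Real.cos θ : ℂ) * η)⁻¹ = π / uu η := by
  have hu := uu_ne h
  have h1 := one_add_uu_ne h
  set ζ : ℂ := η / (1 + uu η) with hζ
  have hz2 : ζ ^ 2 = (1 - uu η) / (1 + uu η) := by
    have := uu_sq η
    rw [hζ, div_pow, div_eq_div_iff (pow_ne_zero 2 h1) h1]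
    linear_combination (1 + uu η) * this
  have hzl : ‖ζ‖ < 1 := by
    have := ww_lt h
    rw [← hz2, norm_pow] at this
    nlinarith [norm_nonneg ζ]
  have hsl : ∀ w : ℂ, ‖w‖ = 1 → 1 - ζ * w ∈ Complex.slitPlane := by
    intro w hw
    apply Complex.mem_slitPlane_iff.2
    left
    have := Complex.re_le_norm (ζ * w)
    rw [norm_mul, hw, mul_one] at this
    rw [Complex.sub_re, Complex.one_re]; linarith
  have hn1 : ∀ θ : ℝ, ‖Complex.exp (θ * Complex.I)‖ = 1 := Complex.norm_exp_ofReal_mul_I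
  have hn2 : ∀ θ : ℝ, ‖Complex.exp (-(θ * Complex.I))‖ = 1 := by
    intro θ
    have := Complex.norm_exp_ofReal_mul_I (-θ)
    rw [← this]; congr 2; push_cast; ring
  have hd : ∀ θ ∈ Set.uIcc (0:ℝ) π, HasDerivAt (fun θ : ℝ => (uu η)⁻¹ * ((θ : ℂ)
      + Complex.I * Complex.log (1 - ζ * Complex.exp (θ * Complex.I))
      - Complex.I * Complex.log (1 - ζ * Complex.exp (-(θ * Complex.I)))))
      ((1 - (Real.cos θ : ℂ) * η)⁻¹) θ := by
    intro θ _
    have d0 : HasDerivAt (fun θ : ℝ => (θ : ℂ)) 1 θ := Complex.ofRealCLM.hasDerivAt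
    have d1 : HasDerivAt (fun θ : ℝ => (θ : ℂ) * Complex.I) (Complex.I) θ := by
      simpa using d0.mul_const Complex.I
    have s1 := hsl _ (hn1 θ)
    have s2 := hsl _ (hn2 θ)
    have d2 := ((d1.cexp.const_mul ζ).const_sub 1).clog_real s1
    have d3 := ((d1.neg.cexp.const_mul ζ).const_sub 1).clog_real s2
    have d4 := (((d0.add (d2.const_mul Complex.I)).sub (d3.const_mul Complex.I)).const_mul
      (uu η)⁻¹)
    refine d4.congr_deriv ?_
    have n1 := Complex.slitPlane_ne_zero s1
    have n2 := Complex.slitPlane_ne_zero s2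
    have hc : (Real.cos θ : ℂ) = (Complex.exp (θ * Complex.I) + Complex.exp (-(θ * Complex.I))) / 2 := by
      rw [Complex.ofReal_cos, Complex.cos]; ring_nf
    have hee : Complex.exp (θ * Complex.I) * Complex.exp (-(θ * Complex.I)) = 1 := by
      rw [← Complex.exp_add]; simp
    simp only [Pi.neg_apply] at *
    set e1 := Complex.exp (θ * Complex.I)
    set e2 := Complex.exp (-(θ * Complex.I))
    have hη : η = ζ * (1 + uu η) := by rw [hζ]; field_simp
    have hz3 : ζ ^ 2 * (1 + uu η) = 1 - uu η := by rw [hz2]; field_simp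
    have hprod : (1 - (Real.cos θ : ℂ) * η) = (1 + uu η) / 2 * ((1 - ζ * e1) * (1 - ζ * e2)) := by
      rw [hc]
      linear_combination (-(e1+e2)/2) * hη - 1/2 * hz3 - (1 + uu η) / 2 * ζ ^ 2 * hee
    rw [hprod]
    generalize uu η = u at *
    field_simp
    rw [Complex.I_sq]
    linear_combination ((-1:ℂ) * (1 + u) * ζ ^ 2) * hee - hz3
  rw [intervalIntegral.integral_eq_sub_of_hasDerivAt hd]
  · have e1 : Complex.exp (-((π:ℝ) * Complex.I)) = -1 := by
      rw [Complex.exp_neg, Complex.exp_pi_mul_I]; norm_num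
    rw [e1, Complex.exp_pi_mul_I]
    simp
    field_simp
  · apply ContinuousOn.intervalIntegrable
    intro θ _
    apply ContinuousAt.continuousWithinAt
    have : 1 - (Real.cos θ : ℂ) * η ≠ 0 :=
      Complex.slitPlane_ne_zero (one_sub_slit h (Real.abs_cos_le_one θ))
    exact ContinuousAt.inv₀ (by fun_prop) this

lemma swap_cont {f : ℝ → ℝ → ℂ} {a b c d : ℝ}
    (h : ContinuousOn (Function.uncurry f) (Set.uIcc a b ×ˢ Set.uIcc c d)) :
    ∫ x in a..b, ∫ y in c..d, f x y = ∫ y in c..d, ∫ x in a..b, f x y := by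
  apply MeasureTheory.intervalIntegral_intervalIntegral_swap
  exact (h.integrableOn_compact (isCompact_uIcc.prod isCompact_uIcc)).mono_set
    (Set.prod_mono Set.uIoc_subset_uIcc Set.uIoc_subset_uIcc)

lemma abs_mul_le_one {s x : ℝ} (hs : s ∈ Set.uIcc (0:ℝ) 1) (hx : |x| ≤ 1) : |s * x| ≤ 1 := by
  rw [Set.uIcc_of_le zero_le_one] at hs
  rw [abs_mul, abs_of_nonneg hs.1]
  nlinarith [hs.1, hs.2, abs_nonneg x]

lemma abs_le_one_of {s : ℝ} (hs : s ∈ Set.uIcc (0:ℝ) 1) : |s| ≤ 1 := by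
  simpa using abs_mul_le_one hs (x := 1) (by simp)

lemma log_int_form {η : ℂ} (h : η ∈ DD) {x : ℝ} (hx : |x| ≤ 1) :
    Complex.log (1 - (x:ℂ) * η) = ∫ s in (0:ℝ)..1, -((x:ℂ) * η) * (1 - (s:ℂ) * ((x:ℂ) * η))⁻¹ := by
  have hd : ∀ s ∈ Set.uIcc (0:ℝ) 1, HasDerivAt
      (fun s : ℝ => Complex.log (1 - (s:ℂ) * ((x:ℂ) * η)))
      (-((x:ℂ) * η) * (1 - (s:ℂ) * ((x:ℂ) * η))⁻¹) s := by
    intro s hs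
    have hsl := one_sub_slit h (abs_mul_le_one hs hx)
    rw [Complex.ofReal_mul, mul_assoc] at hsl
    have d0 : HasDerivAt (fun θ : ℝ => (θ : ℂ)) 1 s := Complex.ofRealCLM.hasDerivAt
    have := ((d0.mul_const ((x:ℂ) * η)).const_sub 1).clog_real hsl
    refine this.congr_deriv ?_
    rw [one_mul, div_eq_mul_inv]
  rw [intervalIntegral.integral_eq_sub_of_hasDerivAt hd]
  · simp
  · apply ContinuousOn.intervalIntegrable
    intro s hs
    apply ContinuousAt.continuousWithinAt
    have hsl := one_sub_slit h (abs_mul_le_one hs hx)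
    rw [Complex.ofReal_mul, mul_assoc] at hsl
    have := Complex.slitPlane_ne_zero hsl
    exact ContinuousAt.mul (by fun_prop) (ContinuousAt.inv₀ (by fun_prop) this)

lemma log_cos_int {η : ℂ} (h : η ∈ DD) :
    ∫ θ in (0:ℝ)..π, Complex.log (1 - (Real.cos θ : ℂ) * η) = π * ll η := by
  have hpi : (π : ℂ) ≠ 0 := by exact_mod_cast Real.pi_ne_zero
  simp_rw [fun θ => log_int_form h (Real.abs_cos_le_one θ)]
  rw [swap_cont]
  · have hmem : ∀ s ∈ Set.uIcc (0:ℝ) 1, (s:ℂ) * η ∈ DD := fun s hs => DD_smul h (abs_le_one_of hs)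
    have e1 : ∫ s in (0:ℝ)..1, ∫ θ in (0:ℝ)..π, -((Real.cos θ : ℂ) * η) *
        (1 - (s:ℂ) * ((Real.cos θ : ℂ) * η))⁻¹ =
        ∫ s in (0:ℝ)..1, π * (η * (-((s:ℂ)*η) / (uu ((s:ℂ)*η) * (1 + uu ((s:ℂ)*η))))) := by
      apply intervalIntegral.integral_congr_ae
      refine Eventually.of_forall ?_
      intro s hs
      have hs' : s ∈ Set.uIcc (0:ℝ) 1 := Set.uIoc_subset_uIcc hs
      rw [Set.uIoc_of_le zero_le_one] at hs
      have hs0 : (s:ℂ) ≠ 0 := by exact_mod_cast hs.1.ne'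
      have hm := hmem s hs'
      have hu := uu_ne hm
      have h1 := one_add_uu_ne hm
      have hsq := uu_sq ((s:ℂ) * η)
      have hpo := poisson_int hm
      have hcont : Continuous (fun θ : ℝ => (1 - (Real.cos θ : ℂ) * ((s:ℂ)*η))⁻¹) := by
        rw [continuous_iff_continuousAt]
        intro θ
        have : 1 - (Real.cos θ : ℂ) * ((s:ℂ)*η) ≠ 0 :=
          Complex.slitPlane_ne_zero (one_sub_slit hm (Real.abs_cos_le_one θ))
        exact ContinuousAt.inv₀ (by fun_prop) this
      have e2 : ∀ θ : ℝ, -((Real.cos θ : ℂ) * η) * (1 - (s:ℂ) * ((Real.cos θ : ℂ) * η))⁻¹ =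
          (s:ℂ)⁻¹ * (1 - (1 - (Real.cos θ : ℂ) * ((s:ℂ)*η))⁻¹) := by
        intro θ
        have hne : 1 - (Real.cos θ : ℂ) * ((s:ℂ)*η) ≠ 0 :=
          Complex.slitPlane_ne_zero (one_sub_slit hm (Real.abs_cos_le_one θ))
        have e3 : 1 - (s:ℂ) * ((Real.cos θ : ℂ) * η) = 1 - (Real.cos θ : ℂ) * ((s:ℂ)*η) := by ring
        rw [e3]
        have hX : (Real.cos θ : ℂ) * η = (s:ℂ)⁻¹ * (1 - (1 - (Real.cos θ : ℂ) * ((s:ℂ)*η))) := by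
          field_simp
          ring
        generalize 1 - (Real.cos θ : ℂ) * ((s:ℂ)*η) = X at *
        rw [hX]
        field_simp
        ring
      simp_rw [e2]
      rw [intervalIntegral.integral_const_mul, intervalIntegral.integral_sub
        (continuous_const.intervalIntegrable _ _) (hcont.intervalIntegrable _ _), hpo]
      simp only [intervalIntegral.integral_const, sub_zero, Complex.real_smul, mul_one]
      generalize uu ((s:ℂ) * η) = u at *
      field_simp
      linear_combination hsq
    rw [e1, intervalIntegral.integral_const_mul]
    congr 1
    have hd : ∀ s ∈ Set.uIcc (0:ℝ) 1, HasDerivAt (fun s : ℝ => ll ((s:ℂ) * η))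
        (η * (-((s:ℂ)*η) / (uu ((s:ℂ)*η) * (1 + uu ((s:ℂ)*η))))) s := by
      intro s hs
      have d0 : HasDerivAt (fun θ : ℝ => (θ : ℂ)) 1 s := Complex.ofRealCLM.hasDerivAt
      have := (ll_deriv (hmem s hs)).comp s (d0.mul_const η)
      refine this.congr_deriv ?_
      ring
    rw [intervalIntegral.integral_eq_sub_of_hasDerivAt hd]
    · simp [ll_zero]
    · apply ContinuousOn.intervalIntegrable
      intro s hs
      apply ContinuousAt.continuousWithinAt
      have hm := hmem s hs
      have hcu : ContinuousAt (fun s : ℝ => uu ((s:ℂ) * η)) s :=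
        ContinuousAt.comp (g := uu) (f := fun s : ℝ => (s:ℂ) * η)
          (uu_deriv hm).continuousAt (by fun_prop)
      refine ContinuousAt.mul (by fun_prop) (ContinuousAt.div (by fun_prop) ?_
        (mul_ne_zero (uu_ne hm) (one_add_uu_ne hm)))
      exact hcu.mul (continuousAt_const.add hcu)
  · rintro ⟨θ, s⟩ hp
    apply ContinuousAt.continuousWithinAt
    have hsl := one_sub_slit h (abs_mul_le_one hp.2 (Real.abs_cos_le_one θ))
    rw [Complex.ofReal_mul, mul_assoc] at hsl
    have := Complex.slitPlane_ne_zero hsl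
    unfold Function.uncurry
    exact ContinuousAt.mul (by fun_prop) (ContinuousAt.inv₀ (by fun_prop) this)

lemma ll_int {ω : ℂ} (h : ω ∈ DD) (h0 : ω ≠ 0) :
    ∫ t in (0:ℝ)..1, ll ((t:ℂ) * ω) = Gp ω / ω := by
  have hmem : ∀ s ∈ Set.uIcc (0:ℝ) 1, (s:ℂ) * ω ∈ DD := fun s hs => DD_smul h (abs_le_one_of hs)
  have hd : ∀ s ∈ Set.uIcc (0:ℝ) 1, HasDerivAt (fun s : ℝ => Gp ((s:ℂ) * ω) / ω)
      (ll ((s:ℂ)*ω)) s := by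
    intro s hs
    have d0 : HasDerivAt (fun θ : ℝ => (θ : ℂ)) 1 s := Complex.ofRealCLM.hasDerivAt
    have := ((Gp_deriv (hmem s hs)).comp s (d0.mul_const ω)).div_const ω
    refine this.congr_deriv ?_
    field_simp
  rw [intervalIntegral.integral_eq_sub_of_hasDerivAt hd]
  · simp [Gp_zero]
  · apply ContinuousOn.intervalIntegrable
    intro s hs
    apply ContinuousAt.continuousWithinAt
    exact ContinuousAt.comp (g := ll) (f := fun s : ℝ => (s:ℂ) * ω)
          (ll_deriv (hmem s hs)).continuousAt (by fun_prop)

end BOP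

namespace BOP

/-- A version of the density with a convenient value at the origin. -/
noncomputable def ps (x : ℝ) : ℝ := (1 / π) * (Real.log (1 + Real.sqrt (1 - x ^ 2)) - Real.log x)

lemma one_add_sqrt_pos (x : ℝ) : 0 < 1 + Real.sqrt (1 - x ^ 2) := by
  have := Real.sqrt_nonneg (1 - x ^ 2); linarith

lemma psiDens_eq {x : ℝ} (hx : x ≠ 0) : psiDens x = ps x := by
  unfold psiDens ps
  rw [Real.log_div (one_add_sqrt_pos x).ne' (abs_pos.2 hx).ne', Real.log_abs]

lemma log_sqrt_cont : Continuous (fun x : ℝ => Real.log (1 + Real.sqrt (1 - x ^ 2))) := by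
  apply Continuous.log
  · fun_prop
  · intro x; exact (one_add_sqrt_pos x).ne'

lemma mul_ps_cont : Continuous (fun x : ℝ => x * ps x) := by
  have e : (fun x : ℝ => x * ps x) = fun x => (1 / π) *
      (x * Real.log (1 + Real.sqrt (1 - x ^ 2)) - x * Real.log x) := by
    funext x; unfold ps; ring
  rw [e]
  exact continuous_const.mul ((continuous_id.mul log_sqrt_cont).sub Real.continuous_mul_log)

lemma ps_int (a b : ℝ) : IntervalIntegrable ps volume a b := by
  unfold ps
  exact ((log_sqrt_cont.intervalIntegrable a b).sub
    intervalIntegral.intervalIntegrable_log').const_mul _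

lemma ps_one : ps 1 = 0 := by simp [ps]
lemma ps_neg_one : ps (-1) = 0 := by simp [ps]

lemma ps_deriv {x : ℝ} (h1 : x ∈ Set.Ioo (-1:ℝ) 1) (h0 : x ≠ 0) :
    HasDerivAt ps (-(1 / (π * x * Real.sqrt (1 - x ^ 2)))) x := by
  have hp : 0 < 1 - x ^ 2 := by nlinarith [h1.1, h1.2]
  have hs : 0 < Real.sqrt (1 - x ^ 2) := Real.sqrt_pos.2 hp
  have hsq : Real.sqrt (1 - x ^ 2) ^ 2 = 1 - x ^ 2 := Real.sq_sqrt hp.le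
  have d1 : HasDerivAt (fun x : ℝ => 1 - x ^ 2) (-(2 * x)) x := by
    simpa using ((hasDerivAt_id x).pow 2).const_sub 1
  have d2 := ((d1.sqrt hp.ne').const_add 1).log (one_add_sqrt_pos x).ne'
  have d3 := (d2.sub (Real.hasDerivAt_log h0)).const_mul (1 / π)
  refine d3.congr_deriv ?_
  have hq := one_add_sqrt_pos x
  have hpi := Real.pi_pos
  generalize Real.sqrt (1 - x ^ 2) = s at *
  have hq' := hq.ne'
  field_simp
  linear_combination -hsq

lemma psi_int {f : ℝ → ℂ} (hf : Continuous f) :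
    ∫ x in (-1:ℝ)..1, f x * (psiDens x : ℂ) =
      (1 / π) * ∫ θ in (0:ℝ)..π, ∫ t in (0:ℝ)..1, f (t * Real.cos θ) := by
  have hpi : (π : ℂ) ≠ 0 := by exact_mod_cast Real.pi_ne_zero
  set Λ : ℝ → ℂ := fun x => ∫ t in (0:ℝ)..1, f (t * x) with hΛ
  have hΛc : Continuous Λ := by
    apply intervalIntegral.continuous_parametric_intervalIntegral_of_continuous'
    unfold Function.uncurry
    fun_prop
  have hF : ∀ x : ℝ, (x:ℂ) * Λ x = ∫ t in (0:ℝ)..x, f t := by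
    intro x
    have := intervalIntegral.smul_integral_comp_mul_right f x (a := 0) (b := 1)
    rw [Complex.real_smul, zero_mul, one_mul] at this
    exact this
  have hFd : ∀ x : ℝ, HasDerivAt (fun x : ℝ => (x:ℂ) * Λ x) (f x) x := by
    intro x
    have : (fun x : ℝ => (x:ℂ) * Λ x) = fun x => ∫ t in (0:ℝ)..x, f t := funext hF
    rw [this]
    exact hf.integral_hasStrictDerivAt 0 x |>.hasDerivAt
  set V : ℝ → ℂ := fun θ => ∫ φ in (0:ℝ)..θ, Λ (Real.cos φ) with hV
  have hVd : ∀ θ : ℝ, HasDerivAt V (Λ (Real.cos θ)) θ := by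
    intro θ
    exact (hΛc.comp Real.continuous_cos).integral_hasStrictDerivAt 0 θ |>.hasDerivAt
  have hVc : Continuous V := continuous_iff_continuousAt.2 fun θ => (hVd θ).continuousAt
  have e0 : ∫ x in (-1:ℝ)..1, f x * (psiDens x : ℂ) = ∫ x in (-1:ℝ)..1, f x * (ps x : ℂ) := by
    apply intervalIntegral.integral_congr_ae
    have : ∀ᵐ x : ℝ, x ≠ 0 := by
      rw [ae_iff]; simp
    filter_upwards [this] with x hx _
    rw [psiDens_eq hx]
  set Q : ℝ → ℂ := fun x => (x:ℂ) * Λ x * (ps x : ℂ) - (1 / π) * V (Real.arccos x) with hQ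
  have hQc : Continuous Q := by
    have e : Q = fun x => Λ x * ((x * ps x : ℝ) : ℂ) - (1 / π) * V (Real.arccos x) := by
      funext x; rw [hQ]; push_cast; ring
    rw [e]
    exact (hΛc.mul (Complex.continuous_ofReal.comp mul_ps_cont)).sub
      (continuous_const.mul (hVc.comp Real.continuous_arccos))
  have hQd : ∀ x ∈ Set.Ioo (-1:ℝ) 1 \ {0}, HasDerivAt Q (f x * (ps x : ℂ)) x := by
    rintro x ⟨hx, hx0⟩
    have hx0 : x ≠ 0 := hx0
    have hp : 0 < 1 - x ^ 2 := by nlinarith [hx.1, hx.2]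
    have hs : 0 < Real.sqrt (1 - x ^ 2) := Real.sqrt_pos.2 hp
    have d1 := (hFd x).mul (ps_deriv hx hx0).ofReal_comp
    have d2 := (hVd (Real.arccos x)).scomp x (Real.hasDerivAt_arccos hx.1.ne' hx.2.ne)
    rw [Real.cos_arccos hx.1.le hx.2.le] at d2
    have d3 := d1.sub (d2.const_mul (1 / (π:ℂ)))
    refine d3.congr_deriv ?_
    have hsc : (Real.sqrt (1 - x ^ 2) : ℂ) ≠ 0 := by exact_mod_cast hs.ne'
    have hxc : (x : ℂ) ≠ 0 := by exact_mod_cast hx0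
    rw [Complex.real_smul]
    push_cast
    field_simp
    ring
  have hQi : IntervalIntegrable (fun x => f x * (ps x : ℂ)) volume (-1) 1 := by
    have : IntervalIntegrable (fun x => (ps x : ℂ)) volume (-1) 1 :=
      ⟨(ps_int (-1) 1).1.ofReal, (ps_int (-1) 1).2.ofReal⟩
    exact this.continuousOn_mul hf.continuousOn
  rw [e0, integral_eq_of_hasDerivAt_off_countable_of_le Q _ (by norm_num)
    (Set.countable_singleton 0) hQc.continuousOn hQd hQi]
  simp [hQ, ps_one, ps_neg_one, hV, hΛ]

lemma gFun_eq {z : ℂ} (h : ¬(z.im = 0 ∧ |z.re| ≤ 1)) :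
    gFun z = Complex.log z + z * Gp z⁻¹ := by
  have hpi : (π : ℂ) ≠ 0 := by exact_mod_cast Real.pi_ne_zero
  obtain ⟨hz, hD⟩ := inv_mem_DD h
  set ω := z⁻¹ with hω
  have hω0 : ω ≠ 0 := inv_ne_zero hz
  set cl : ℝ → ℝ := fun x => max (-1) (min x 1) with hcl
  have hclb : ∀ x, |cl x| ≤ 1 := by
    intro x; rw [abs_le]
    exact ⟨le_max_left _ _, max_le (by norm_num) (min_le_right _ _)⟩
  have hcle : ∀ x, |x| ≤ 1 → cl x = x := by
    intro x hx; rw [abs_le] at hx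
    simp only [hcl]; rw [min_eq_left hx.2, max_eq_right hx.1]
  have hclc : Continuous cl := by fun_prop
  have hfc : Continuous (fun x => Complex.log z + Complex.log (1 - (cl x : ℂ) * ω)) := by
    apply continuous_const.add
    apply Continuous.clog
    · fun_prop
    · intro x; exact one_sub_slit hD (hclb x)
  have e1 : gFun z = ∫ x in (-1:ℝ)..1, (Complex.log z + Complex.log (1 - (cl x : ℂ) * ω)) *
      (psiDens x : ℂ) := by
    unfold gFun
    apply intervalIntegral.integral_congr
    intro x hx
    rw [Set.uIcc_of_le (by norm_num)] at hx
    have hx1 : |x| ≤ 1 := abs_le.2 hx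
    simp only
    rw [log_split h hx1, hcle x hx1]
  have e2 : ∀ θ : ℝ, ∫ t in (0:ℝ)..1, (Complex.log z + Complex.log
      (1 - (cl (t * Real.cos θ) : ℂ) * ω)) =
      ∫ t in (0:ℝ)..1, (Complex.log z + Complex.log (1 - (Real.cos θ : ℂ) * ((t:ℂ) * ω))) := by
    intro θ
    apply intervalIntegral.integral_congr
    intro t ht
    simp only
    rw [hcle _ (abs_mul_le_one ht (Real.abs_cos_le_one θ))]
    congr 3
    push_cast; ring
  rw [e1, psi_int hfc]
  simp_rw [e2]
  rw [swap_cont]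
  · have e3 : ∫ t in (0:ℝ)..1, ∫ θ in (0:ℝ)..π, (Complex.log z + Complex.log
        (1 - (Real.cos θ : ℂ) * ((t:ℂ) * ω))) =
        ∫ t in (0:ℝ)..1, (π * Complex.log z + π * ll ((t:ℂ) * ω)) := by
      apply intervalIntegral.integral_congr
      intro t ht
      have hm : (t:ℂ) * ω ∈ DD := DD_smul hD (abs_le_one_of ht)
      simp only
      rw [intervalIntegral.integral_add, log_cos_int hm]
      · simp
      · exact continuous_const.intervalIntegrable _ _
      · apply Continuous.intervalIntegrable
        apply Continuous.clog
        · fun_prop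
        · intro θ; exact one_sub_slit hm (Real.abs_cos_le_one θ)
    rw [e3, intervalIntegral.integral_add, intervalIntegral.integral_const_mul,
      intervalIntegral.integral_const_mul, ll_int hD hω0]
    · simp only [intervalIntegral.integral_const, sub_zero, one_smul]
      rw [hω]
      field_simp
    · exact continuous_const.intervalIntegrable _ _
    · apply ContinuousOn.intervalIntegrable
      intro s hs
      apply ContinuousAt.continuousWithinAt
      apply continuousAt_const.mul
      exact ContinuousAt.comp (g := ll) (f := fun s : ℝ => (s:ℂ) * ω)
          (ll_deriv (DD_smul hD (abs_le_one_of hs))).continuousAt (by fun_prop)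
  · rintro ⟨θ, t⟩ hp
    apply ContinuousAt.continuousWithinAt
    have hsl := one_sub_slit (DD_smul hD (abs_le_one_of hp.2)) (Real.abs_cos_le_one θ)
    unfold Function.uncurry
    apply continuousAt_const.add
    exact ContinuousAt.clog (by fun_prop) hsl

end BOP

namespace BOP

lemma nf_hn_lower {n : ℕ} (h : 1 ≤ n) : (n:ℝ) ^ (-(1/4):ℝ) / 2 ≤ nf n * √(hn n) := by
  have hn1 : (1:ℝ) ≤ n := by exact_mod_cast h
  have h0 : 0 ≤ nf n * √(hn n) := mul_nonneg (nf_pos n).le (Real.sqrt_nonneg _)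
  have e1 : (nf n * √(hn n)) ^ 4 = rr n ^ 2 := by
    have : √(hn n) ^ 2 = hn n := Real.sq_sqrt (hn_pos n).le
    unfold rr
    calc (nf n * √(hn n)) ^ 4 = (nf n ^ 2 * √(hn n) ^ 2) ^ 2 := by ring
      _ = _ := by rw [this]
  have e2 : ((n:ℝ) ^ (-(1/4):ℝ) / 2) ^ 4 = 1 / (16 * n) := by
    rw [div_pow, ← Real.rpow_natCast, ← Real.rpow_mul (by positivity)]
    norm_num
    rw [Real.rpow_neg_one]; field_simp
  apply le_of_pow_le_pow_left₀ (n := 4) (by norm_num) h0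
  rw [e1, e2]
  refine le_trans ?_ (rr_lower n)
  apply one_div_le_one_div_of_le
  · positivity
  · linarith

lemma eps_lower {ν : ℝ} (h0 : 0 < ν) : ∃ D > 0, ∀ n : ℕ, 2 ≤ n →
    (n:ℝ) ^ (5 * ν / 8 - 1 / 2) ≤ D * epsSeq ν n := by
  set ε := (3 * ν / 8) / (ν + 1/2) with hε
  have hε0 : 0 < ε := by positivity
  refine ⟨(1 / ε) ^ (ν + 1/2), by positivity, fun n h2 => ?_⟩
  have hn2 : (2:ℝ) ≤ n := by exact_mod_cast h2
  have hn0 : (0:ℝ) < n := by linarith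
  have hl : 0 < Real.log n := Real.log_pos (by linarith)
  have hb := Real.log_le_rpow_div hn0.le hε0
  have hb2 : Real.log n ^ (ν + 1/2) ≤ (1 / ε) ^ (ν + 1/2) * (n:ℝ) ^ (3 * ν / 8) := by
    calc Real.log n ^ (ν + 1/2) ≤ ((n:ℝ) ^ ε / ε) ^ (ν + 1/2) :=
          Real.rpow_le_rpow hl.le hb (by positivity)
      _ = ((1/ε) * (n:ℝ) ^ ε) ^ (ν + 1/2) := by congr 1; ring
      _ = _ := by
        rw [Real.mul_rpow (by positivity) (by positivity), ← Real.rpow_mul hn0.le]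
        congr 2
        rw [hε]; field_simp
  unfold epsSeq
  rw [mul_div_assoc', le_div_iff₀ (Real.rpow_pos_of_pos hl _)]
  have e : (n:ℝ) ^ (ν - 1/2) = (n:ℝ) ^ (5 * ν / 8 - 1 / 2) * (n:ℝ) ^ (3 * ν / 8) := by
    rw [← Real.rpow_add hn0]; congr 1; ring
  rw [e]
  have hp : 0 < (n:ℝ) ^ (5 * ν / 8 - 1 / 2) := Real.rpow_pos_of_pos hn0 _
  nlinarith [mul_le_mul_of_nonneg_left hb2 hp.le]

lemma quantity_eq (ν : ℝ) {z : ℂ} (h : ¬(z.im = 0 ∧ |z.re| ≤ 1)) {n : ℕ} (h1 : 1 ≤ n)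
    {P p : Polynomial ℂ}
    (hP : ∀ z : ℂ, P.eval (Complex.I * π * z) = (Complex.I * π) ^ n * p.eval z) :
    ((Complex.I * n * π) ^ n)⁻¹ * P.eval (Complex.I * n * π * z) *
      Complex.exp (-(n : ℂ) * gFun z) * (outerFactor ν z)⁻¹ =
    p.eval (z⁻¹ / n)⁻¹ / ((z⁻¹ / n)⁻¹ ^ n * MM (ν/2) (z⁻¹ / n) n) := by
  obtain ⟨hz, hD⟩ := inv_mem_DD h
  have hnc : (n:ℂ) ≠ 0 := by exact_mod_cast (by omega : n ≠ 0)
  have hpi : (π : ℂ) ≠ 0 := by exact_mod_cast Real.pi_ne_zero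
  have ex : (z⁻¹ / n)⁻¹ = n * z := by field_simp
  have e1 : Complex.I * n * π * z = Complex.I * π * (n * z) := by ring
  have e2 : (n:ℂ) * (z⁻¹ / n) = z⁻¹ := by field_simp
  have e3 : Complex.exp (-(n : ℂ) * gFun z) = (z ^ n)⁻¹ * (Complex.exp (n * z * Gp z⁻¹))⁻¹ := by
    rw [gFun_eq h, ← Complex.exp_neg]
    have : (z ^ n)⁻¹ = Complex.exp (-(n * Complex.log z)) := by
      rw [Complex.exp_neg, Complex.exp_nat_mul, Complex.exp_log hz]
    rw [this, ← Complex.exp_add]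
    congr 1; ring
  have e4 : MM (ν/2) (z⁻¹ / n) n = Complex.exp (n * z * Gp z⁻¹) * outerFactor ν z := by
    rw [outerFactor_eq ν hz hD, ← Complex.exp_add, MM, e2]
    congr 2
    field_simp
  rw [e1, hP, e3, ex, e4]
  have n1 := Complex.exp_ne_zero (n * z * Gp z⁻¹)
  have n2 : outerFactor ν z ≠ 0 := by
    rw [outerFactor_eq ν hz hD]; exact Complex.exp_ne_zero _
  have hI := Complex.I_ne_zero
  rw [show Complex.I * n * π = (n:ℂ) * (Complex.I * π) by ring,
    mul_pow (n:ℂ) (Complex.I * π), mul_pow (n:ℂ) z]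
  have n3 : (n:ℂ) ^ n ≠ 0 := pow_ne_zero _ hnc
  have n4 : (Complex.I * π) ^ n ≠ 0 := pow_ne_zero _ (mul_ne_zero hI hpi)
  have n5 : z ^ n ≠ 0 := pow_ne_zero _ hz
  generalize (n:ℂ) ^ n = A at *
  generalize (Complex.I * π) ^ n = B at *
  generalize z ^ n = Z at *
  generalize Complex.exp (n * z * Gp z⁻¹) = E at *
  generalize outerFactor ν z = F at *
  generalize Polynomial.eval (n * z) p = X at *
  field_simp

lemma main_bound {ν : ℝ} (hν0 : 0 < ν) (hν : ν ≤ 1 / 2) {K : Set ℂ}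
    (hK : IsCompact K) (hK' : ∀ z ∈ K, ¬(z.im = 0 ∧ |z.re| ≤ 1)) :
    ∃ C > (0 : ℝ), ∃ n₀ : ℕ, ∀ n ≥ n₀,
      hankelDet ν n ≠ 0 ∧
        ∀ P : Polynomial ℂ, IsBesselOP ν n P →
          ∀ z ∈ K,
            ‖((Complex.I * n * π) ^ n)⁻¹ * P.eval (Complex.I * n * π * z) *
                Complex.exp (-(n : ℂ) * gFun z) * (outerFactor ν z)⁻¹ - 1‖ ≤
              C * epsSeq ν n := by
  obtain ⟨κ0, κ1, c, C0, hcmp⟩ := cmp_inst hν0 hν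
  obtain ⟨C1, hC1, H1⟩ := hcmp.diff_bound
  have hKi : IsCompact ((fun z : ℂ => z⁻¹) '' K) := by
    apply hK.image_of_continuousOn
    intro z hz
    exact (continuousAt_inv₀ (inv_mem_DD (hK' z hz)).1).continuousWithinAt
  have hKs : (fun z : ℂ => z⁻¹) '' K ⊆ DD := by
    rintro _ ⟨z, hz, rfl⟩
    exact (inv_mem_DD (hK' z hz)).2
  obtain ⟨C2, q, n2, hC2, -, -, -, H2⟩ := model_asym (ν/2) hKi hKs
  obtain ⟨C3, n3, hC3, -, H3⟩ := outer_err (ν/2) hKi hKs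
  obtain ⟨D, hD, H4⟩ := eps_lower hν0
  refine ⟨(C2 + C3 * C1 * 2 + 1) * D, by positivity, max n2 (max n3 2), fun n hnn => ⟨hankel_ne hν0 hν n, ?_⟩⟩
  intro P hP z hz
  have m2 : n2 ≤ n := (le_max_left _ _).trans hnn
  have m3 : n3 ≤ n := ((le_max_left _ _).trans (le_max_right _ _)).trans hnn
  have m4 : 2 ≤ n := ((le_max_right _ _).trans (le_max_right _ _)).trans hnn
  have m1 : 1 ≤ n := by omega
  have hn1 : (1:ℝ) ≤ n := by exact_mod_cast m1
  have hn0 : (0:ℝ) < n := by linarith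
  obtain ⟨p, hpm, hpd, hpo, hPp⟩ := OP_scale hν0 hν n P hP
  obtain ⟨hdeg, hsq⟩ := H1 n m1 p hpm hpd hpo
  have hzz := hK' z hz
  obtain ⟨hz0, hzD⟩ := inv_mem_DD hzz
  rw [quantity_eq ν hzz m1 hPp]
  set ω := z⁻¹ with hω
  have hω0 : ω ≠ 0 := inv_ne_zero hz0
  have hωm : ω ∈ (fun z : ℂ => z⁻¹) '' K := ⟨z, hz, rfl⟩
  obtain ⟨-, hee, -⟩ := H2 n m2 ω hωm hω0
  have hnc : (n:ℂ) ≠ 0 := by exact_mod_cast (by omega : n ≠ 0)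
  have hδ : ω / n ≠ 0 := div_ne_zero hω0 hnc
  set e := p - mp (Complex.I * ((ν/2 : ℝ) : ℂ)) n with he
  have h3 := H3 n m3 ω hωm hω0 e hdeg
  have hM : (ω / n)⁻¹ ^ n * MM (ν/2) (ω / n) n ≠ 0 :=
    mul_ne_zero (pow_ne_zero _ (inv_ne_zero hδ)) (MM_ne _ _ _)
  have hpe : p.eval (ω / n)⁻¹ = (ω / n)⁻¹ ^ n * MM (ν/2) (ω / n) n * ee (ν/2) (ω / n) n
      + e.eval (ω / n)⁻¹ := by
    rw [he, Polynomial.eval_sub, mp_eval, mpe_ee (ν/2) hδ]; ring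
  have hq : p.eval (ω / n)⁻¹ / ((ω / n)⁻¹ ^ n * MM (ν/2) (ω / n) n) - 1 =
      (ee (ν/2) (ω / n) n - 1) + e.eval (ω / n)⁻¹ / ((ω / n)⁻¹ ^ n * MM (ν/2) (ω / n) n) := by
    rw [hpe, add_div, mul_div_cancel_left₀ _ hM]; ring
  rw [hq]
  have hb1 : ‖e.eval (ω / n)⁻¹ / ((ω / n)⁻¹ ^ n * MM (ν/2) (ω / n) n)‖ ≤
      C3 * (√(nsq w1 e) / √(hn n)) := by
    rw [norm_div, div_le_iff₀ (norm_pos_iff.2 hM)]; exact h3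
  set X := (n:ℝ) ^ (5 * ν / 8 - 1 / 2) with hX
  have hb2 : √(nsq w1 e) / √(hn n) ≤ C1 * 2 * X := by
    have hs : 0 < √(hn n) := Real.sqrt_pos.2 (hn_pos n)
    have hf := nf_pos n
    have hl := nf_hn_lower m1
    have hr : 0 < (n:ℝ) ^ (-(1/4):ℝ) := Real.rpow_pos_of_pos hn0 _
    have ey : (n:ℝ) ^ (2 * (ν/16) + ν/2 - 3/4) = X * (n:ℝ) ^ (-(1/4):ℝ) := by
      rw [hX, ← Real.rpow_add hn0]; congr 1; ring
    have hX0 : 0 < X := Real.rpow_pos_of_pos hn0 _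
    rw [ey] at hsq
    rw [div_le_iff₀ hs]
    refine hsq.trans ?_
    rw [mul_div_assoc', div_le_iff₀ hf]
    have := mul_le_mul_of_nonneg_left hl (by positivity : 0 ≤ 2 * C1 * X)
    nlinarith
  have hb3 : C2 / n ≤ C2 * X := by
    rw [div_eq_mul_inv]
    apply mul_le_mul_of_nonneg_left _ hC2
    rw [← Real.rpow_neg_one]
    exact Real.rpow_le_rpow_of_exponent_le hn1 (by linarith)
  have hX0 : 0 < X := Real.rpow_pos_of_pos hn0 _
  calc _ ≤ ‖ee (ν/2) (ω / n) n - 1‖ + ‖e.eval (ω / n)⁻¹ / ((ω / n)⁻¹ ^ n * MM (ν/2) (ω / n) n)‖ :=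
        norm_add_le _ _
    _ ≤ C2 * X + C3 * (C1 * 2 * X) := by
        refine add_le_add (hee.trans hb3) (hb1.trans (mul_le_mul_of_nonneg_left hb2 hC3))
    _ ≤ (C2 + C3 * C1 * 2 + 1) * X := by nlinarith
    _ ≤ (C2 + C3 * C1 * 2 + 1) * (D * epsSeq ν n) :=
        mul_le_mul_of_nonneg_left (H4 n m4) (by positivity)
    _ = _ := by ring

end BOP

/-- **Theorem (outer asymptotics).**
Let `0 < ν ≤ 1/2` and let `K` be a compact subset of `ℂ∖[-1,1]`. Then there are `C > 0`
and `n₀` such that for all `n ≥ n₀` the Hankel determinant is nonzero and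
`|(inπ)^{-n} P_n(inπz) e^{-n g(z)} F(z)⁻¹ - 1| ≤ C ε_n` uniformly on `K`. -/
theorem outer_asymptotics (ν : ℝ) (hν0 : 0 < ν) (hν : ν ≤ 1 / 2) (K : Set ℂ)
    (hK : IsCompact K) (hK' : ∀ z ∈ K, ¬(z.im = 0 ∧ |z.re| ≤ 1)) :
    ∃ C > (0 : ℝ), ∃ n₀ : ℕ, ∀ n ≥ n₀,
      hankelDet ν n ≠ 0 ∧
        ∀ P : Polynomial ℂ, IsBesselOP ν n P →
          ∀ z ∈ K,
            ‖((Complex.I * n * π) ^ n)⁻¹ * P.eval (Complex.I * n * π * z) *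
                Complex.exp (-(n : ℂ) * gFun z) * (outerFactor ν z)⁻¹ - 1‖ ≤
              C * epsSeq ν n := by
  exact BOP.main_bound hν0 hν hK hK'
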